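/- Let n ≥ 1, Q = 4n+6, 2* = 2Q/(Q−2), and let dVol = 2^{−3}(2n)! dH be the measure on ℝ^{4n+3} induced by the standard qc volume form of the quaternionic Heisenberg group. Then inf { ∫_{ℝ^{4n+3}} |∇v|² dVol : v ∈ C_c^∞(ℝ^{4n+3}), v ≥ 0, ∫_{ℝ^{4n+3}} v^{2*} dVol = 1 } = 4n(n+1) [ (2n)! ω_{4n+3} ]^{1/(2n+3)}. -/

import Mathlib

open MeasureTheory Real

/-- The quaternionic Heisenberg group `G(ℍ) = ℍⁿ × Im ℍ`, identified with `ℝ^{4n+3}`: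
a point is `(q, ω)` where `q α = (t_α, x_α, y_α, z_α)` are the coordinates of the
quaternion `q_α = t_α + i x_α + j y_α + k z_α`, and `ω = (x, y, z)` are the coordinates
of `ω = ix + jy + kz ∈ Im ℍ`. -/
abbrev QH (n : ℕ) : Type := (Fin n → ℝ × ℝ × ℝ × ℝ) × (ℝ × ℝ × ℝ)

namespace QH

/-- `t`-coordinate of a quaternion quadruple. -/
def tC (a : ℝ × ℝ × ℝ × ℝ) : ℝ := a.1
/-- `x`-coordinate of a quaternion quadruple. -/
def xC (a : ℝ × ℝ × ℝ × ℝ) : ℝ := a.2.1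
/-- `y`-coordinate of a quaternion quadruple. -/
def yC (a : ℝ × ℝ × ℝ × ℝ) : ℝ := a.2.2.1
/-- `z`-coordinate of a quaternion quadruple. -/
def zC (a : ℝ × ℝ × ℝ × ℝ) : ℝ := a.2.2.2

/-- The value at `g` of the left-invariant vector field
`T_α = ∂_{t_α} + 2x_α ∂_x + 2y_α ∂_y + 2z_α ∂_z`, as a tangent vector. -/
def Tvec (n : ℕ) (α : Fin n) (g : QH n) : QH n :=
  (Pi.single α (1, 0, 0, 0),
    (2 * xC (g.1 α), 2 * yC (g.1 α), 2 * zC (g.1 α)))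

/-- The value at `g` of `X_α = ∂_{x_α} − 2t_α ∂_x − 2z_α ∂_y + 2y_α ∂_z`. -/
def Xvec (n : ℕ) (α : Fin n) (g : QH n) : QH n :=
  (Pi.single α (0, 1, 0, 0),
    (-2 * tC (g.1 α), -2 * zC (g.1 α), 2 * yC (g.1 α)))

/-- The value at `g` of `Y_α = ∂_{y_α} + 2z_α ∂_x − 2t_α ∂_y − 2x_α ∂_z`. -/
def Yvec (n : ℕ) (α : Fin n) (g : QH n) : QH n :=
  (Pi.single α (0, 0, 1, 0),
    (2 * zC (g.1 α), -2 * tC (g.1 α), -2 * xC (g.1 α)))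

/-- The value at `g` of `Z_α = ∂_{z_α} − 2y_α ∂_x + 2x_α ∂_y − 2t_α ∂_z`. -/
def Zvec (n : ℕ) (α : Fin n) (g : QH n) : QH n :=
  (Pi.single α (0, 0, 0, 1),
    (-2 * yC (g.1 α), 2 * xC (g.1 α), -2 * tC (g.1 α)))

/-- Derivative of `u` along `T_α`. -/
noncomputable def TD (n : ℕ) (α : Fin n) (u : QH n → ℝ) (g : QH n) : ℝ :=
  fderiv ℝ u g (Tvec n α g)
/-- Derivative of `u` along `X_α`. -/
noncomputable def XD (n : ℕ) (α : Fin n) (u : QH n → ℝ) (g : QH n) : ℝ :=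
  fderiv ℝ u g (Xvec n α g)
/-- Derivative of `u` along `Y_α`. -/
noncomputable def YD (n : ℕ) (α : Fin n) (u : QH n → ℝ) (g : QH n) : ℝ :=
  fderiv ℝ u g (Yvec n α g)
/-- Derivative of `u` along `Z_α`. -/
noncomputable def ZD (n : ℕ) (α : Fin n) (u : QH n → ℝ) (g : QH n) : ℝ :=
  fderiv ℝ u g (Zvec n α g)

/-- Square of the length of the horizontal gradient:
`|∇u|² = Σ_α ((T_α u)² + (X_α u)² + (Y_α u)² + (Z_α u)²)`. -/
noncomputable def hGradSq (n : ℕ) (u : QH n → ℝ) (g : QH n) : ℝ :=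
  ∑ α : Fin n, ((TD n α u g) ^ 2 + (XD n α u g) ^ 2 + (YD n α u g) ^ 2 + (ZD n α u g) ^ 2)

/-- The sub-Laplacian `Δu = Σ_α (T_α(T_α u) + X_α(X_α u) + Y_α(Y_α u) + Z_α(Z_α u))`. -/
noncomputable def subLap (n : ℕ) (u : QH n → ℝ) (g : QH n) : ℝ :=
  ∑ α : Fin n, (TD n α (TD n α u) g + XD n α (XD n α u) g
    + YD n α (YD n α u) g + ZD n α (ZD n α u) g)

/-- `|q|² = Σ_α (t_α² + x_α² + y_α² + z_α²)`. -/
def qSq (n : ℕ) (g : QH n) : ℝ :=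
  ∑ α : Fin n, ((tC (g.1 α)) ^ 2 + (xC (g.1 α)) ^ 2 + (yC (g.1 α)) ^ 2 + (zC (g.1 α)) ^ 2)

/-- `|ω|² = x² + y² + z²`. -/
def wSq (n : ℕ) (g : QH n) : ℝ := g.2.1 ^ 2 + g.2.2.1 ^ 2 + g.2.2.2 ^ 2

/-- `i`-component of `Im (a·b̄)` for quaternions given as coordinate quadruples. -/
def imI (a b : ℝ × ℝ × ℝ × ℝ) : ℝ :=
  -tC a * xC b + xC a * tC b - yC a * zC b + zC a * yC b

/-- `j`-component of `Im (a·b̄)`. -/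
def imJ (a b : ℝ × ℝ × ℝ × ℝ) : ℝ :=
  -tC a * yC b + xC a * zC b + yC a * tC b - zC a * xC b

/-- `k`-component of `Im (a·b̄)`. -/
def imK (a b : ℝ × ℝ × ℝ × ℝ) : ℝ :=
  -tC a * zC b - xC a * yC b + yC a * xC b + zC a * tC b

/-- The group law `(q₀,ω₀)∘(q,ω) = (q₀+q, ω+ω₀+2 Im(q₀ q̄))`. -/
def op (n : ℕ) (a g : QH n) : QH n :=
  (a.1 + g.1,
    (g.2.1 + a.2.1 + 2 * ∑ α : Fin n, imI (a.1 α) (g.1 α),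
     g.2.2.1 + a.2.2.1 + 2 * ∑ α : Fin n, imJ (a.1 α) (g.1 α),
     g.2.2.2 + a.2.2.2 + 2 * ∑ α : Fin n, imK (a.1 α) (g.1 α)))

/-- The anisotropic dilations `δ_λ(q,ω) = (λq, λ²ω)`. -/
def dil (n : ℕ) (lam : ℝ) (g : QH n) : QH n :=
  (fun α => (lam * tC (g.1 α), lam * xC (g.1 α), lam * yC (g.1 α), lam * zC (g.1 α)),
    (lam ^ 2 * g.2.1, lam ^ 2 * g.2.2.1, lam ^ 2 * g.2.2.2))

end QH

namespace QH

instance instIsAddHaarQuad : (volume : Measure (ℝ × ℝ × ℝ × ℝ)).IsAddHaarMeasure := by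
  have : (volume : Measure (ℝ × ℝ)).IsAddHaarMeasure :=
    Measure.prod.instIsAddHaarMeasure volume volume
  have : (volume : Measure (ℝ × ℝ × ℝ)).IsAddHaarMeasure :=
    Measure.prod.instIsAddHaarMeasure volume volume
  exact Measure.prod.instIsAddHaarMeasure volume volume

instance instIsAddHaarTriple : (volume : Measure (ℝ × ℝ × ℝ)).IsAddHaarMeasure := by
  have : (volume : Measure (ℝ × ℝ)).IsAddHaarMeasure :=
    Measure.prod.instIsAddHaarMeasure volume volume
  exact Measure.prod.instIsAddHaarMeasure volume volume

instance instIsAddHaarFst (n : ℕ) :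
    (volume : Measure (Fin n → ℝ × ℝ × ℝ × ℝ)).IsAddHaarMeasure :=
  Measure.pi.isAddHaarMeasure _

instance instIsAddHaar (n : ℕ) : (volume : Measure (QH n)).IsAddHaarMeasure :=
  Measure.prod.instIsAddHaarMeasure volume volume

variable {n : ℕ}

/-- The standard basis of the quaternions, as coordinate quadruples. -/
def qb (i : Fin 4) : ℝ × ℝ × ℝ × ℝ :=
  match i with
  | 0 => (1, 0, 0, 0)
  | 1 => (0, 1, 0, 0)
  | 2 => (0, 0, 1, 0)
  | 3 => (0, 0, 0, 1)

/-- The `i`-th coordinate of a quaternion. -/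
def qc (i : Fin 4) (a : ℝ × ℝ × ℝ × ℝ) : ℝ :=
  match i with
  | 0 => tC a
  | 1 => xC a
  | 2 => yC a
  | 3 => zC a

/-- The left-invariant horizontal vector field whose value at the origin is the quaternion `e`
in the block `α`. -/
def hvec (α : Fin n) (e : ℝ × ℝ × ℝ × ℝ) (g : QH n) : QH n :=
  (Pi.single α e, (2 * imI (g.1 α) e, 2 * imJ (g.1 α) e, 2 * imK (g.1 α) e))

/-- Derivative along the horizontal vector field `hvec α e`. -/
noncomputable def hd (α : Fin n) (e : ℝ × ℝ × ℝ × ℝ) (u : QH n → ℝ) (g : QH n) : ℝ :=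
  fderiv ℝ u g (hvec α e g)

/-- The inner product of two horizontal gradients. -/
noncomputable def hGrad (u v : QH n → ℝ) (g : QH n) : ℝ :=
  ∑ α : Fin n, ∑ i : Fin 4, hd α (qb i) u g * hd α (qb i) v g

lemma hGradSq_eq (u : QH n → ℝ) (g : QH n) : hGradSq n u g = hGrad u u g := by
  unfold hGradSq hGrad
  refine Finset.sum_congr rfl fun α _ => ?_
  simp only [Fin.sum_univ_four, hd, TD, XD, YD, ZD, Tvec, Xvec, Yvec, Zvec, hvec, qb, imI, imJ,
    imK, tC, xC, yC, zC]
  simp only [mul_zero, mul_one, zero_add, add_zero, sub_zero, zero_sub, neg_mul, mul_neg,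
    pow_two]

lemma hGradSq_nonneg (u : QH n → ℝ) (g : QH n) : 0 ≤ hGradSq n u g := by
  rw [hGradSq_eq]
  exact Finset.sum_nonneg fun α _ => Finset.sum_nonneg fun i _ => mul_self_nonneg _

section Rules

variable {α : Fin n} {e : ℝ × ℝ × ℝ × ℝ} {u v : QH n → ℝ} {g : QH n}

lemma hd_add (hu : DifferentiableAt ℝ u g) (hv : DifferentiableAt ℝ v g) :
    hd α e (fun x => u x + v x) g = hd α e u g + hd α e v g := by
  simp [hd, fderiv_fun_add hu hv]

lemma hd_sub (hu : DifferentiableAt ℝ u g) (hv : DifferentiableAt ℝ v g) :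
    hd α e (fun x => u x - v x) g = hd α e u g - hd α e v g := by
  simp [hd, fderiv_fun_sub hu hv]

lemma hd_mul (hu : DifferentiableAt ℝ u g) (hv : DifferentiableAt ℝ v g) :
    hd α e (fun x => u x * v x) g = hd α e u g * v g + u g * hd α e v g := by
  simp [hd, fderiv_fun_mul hu hv]; ring

lemma hd_const (c : ℝ) : hd α e (fun _ => c) g = 0 := by simp [hd]

lemma hd_comp {f : ℝ → ℝ} {f' : ℝ} (hf : HasDerivAt f f' (u g)) (hu : DifferentiableAt ℝ u g) :
    hd α e (fun x => f (u x)) g = f' * hd α e u g := by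
  have := (hf.comp_hasFDerivAt g hu.hasFDerivAt).fderiv
  simp only [hd]
  rw [show (fun x => f (u x)) = f ∘ u from rfl, this]
  simp

lemma hd_const_mul (c : ℝ) (hu : DifferentiableAt ℝ u g) :
    hd α e (fun x => c * u x) g = c * hd α e u g := by
  rw [hd_mul (by fun_prop) hu, hd_const]; ring

lemma hd_pow (m : ℕ) (hu : DifferentiableAt ℝ u g) :
    hd α e (fun x => u x ^ m) g = m * u g ^ (m - 1) * hd α e u g :=
  hd_comp (hasDerivAt_pow m _) hu

lemma hd_inv (hu : DifferentiableAt ℝ u g) (h0 : u g ≠ 0) :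
    hd α e (fun x => (u x)⁻¹) g = -(u g ^ 2)⁻¹ * hd α e u g :=
  hd_comp (hasDerivAt_inv h0) hu

lemma hd_sum {ι : Type*} (s : Finset ι) (f : ι → QH n → ℝ)
    (hf : ∀ i ∈ s, DifferentiableAt ℝ (f i) g) :
    hd α e (fun x => ∑ i ∈ s, f i x) g = ∑ i ∈ s, hd α e (f i) g := by
  simp [hd, fderiv_fun_sum hf]

lemma hd_clm (L : QH n →L[ℝ] ℝ) : hd α e (fun x => L x) g = L (hvec α e g) := by
  simp [hd]

end Rules

section Smooth

@[fun_prop] lemma contDiff_tC {k : WithTop ℕ∞} : ContDiff ℝ k tC := contDiff_fst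
@[fun_prop] lemma contDiff_xC {k : WithTop ℕ∞} : ContDiff ℝ k xC := by unfold xC; fun_prop
@[fun_prop] lemma contDiff_yC {k : WithTop ℕ∞} : ContDiff ℝ k yC := by unfold yC; fun_prop
@[fun_prop] lemma contDiff_zC {k : WithTop ℕ∞} : ContDiff ℝ k zC := by unfold zC; fun_prop

@[fun_prop] lemma contDiff_qSq {k : WithTop ℕ∞} : ContDiff ℝ k (qSq n) := by
  unfold qSq tC xC yC zC; fun_prop

@[fun_prop] lemma contDiff_wSq {k : WithTop ℕ∞} : ContDiff ℝ k (wSq n) := by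
  unfold wSq; fun_prop

end Smooth

/-- The function `(1 + |q|²)² + |ω|²`. -/
def FF (n : ℕ) (g : QH n) : ℝ := (1 + qSq n g) ^ 2 + wSq n g

@[fun_prop] lemma contDiff_FF {k : WithTop ℕ∞} : ContDiff ℝ k (FF n) := by
  unfold FF; fun_prop

lemma qSq_nonneg (g : QH n) : 0 ≤ qSq n g := by unfold qSq; positivity
lemma wSq_nonneg (g : QH n) : 0 ≤ wSq n g := by unfold wSq; positivity
lemma one_le_FF (g : QH n) : 1 ≤ FF n g := by
  unfold FF; nlinarith [qSq_nonneg g, wSq_nonneg g]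
lemma FF_pos (g : QH n) : 0 < FF n g := zero_lt_one.trans_le (one_le_FF g)

lemma hd_blk (α β : Fin n) (e : ℝ × ℝ × ℝ × ℝ) (L : (ℝ × ℝ × ℝ × ℝ) →L[ℝ] ℝ) (g : QH n) :
    hd α e (fun x => L (x.1 β)) g = if β = α then L e else 0 := by
  have := hd_clm (α := α) (e := e) (g := g)
    (L.comp ((ContinuousLinearMap.proj β).comp
      (ContinuousLinearMap.fst ℝ (Fin n → ℝ × ℝ × ℝ × ℝ) (ℝ × ℝ × ℝ))))
  simp only [ContinuousLinearMap.comp_apply, ContinuousLinearMap.proj_apply,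
    ContinuousLinearMap.coe_fst'] at this
  rw [this]
  simp only [hvec, Pi.single_apply]
  split_ifs <;> simp

lemma hd_wlin (α : Fin n) (e : ℝ × ℝ × ℝ × ℝ) (L : (ℝ × ℝ × ℝ) →L[ℝ] ℝ) (g : QH n) :
    hd α e (fun x => L x.2) g
      = L (2 * imI (g.1 α) e, 2 * imJ (g.1 α) e, 2 * imK (g.1 α) e) := by
  have := hd_clm (α := α) (e := e) (g := g)
    (L.comp (ContinuousLinearMap.snd ℝ (Fin n → ℝ × ℝ × ℝ × ℝ) (ℝ × ℝ × ℝ)))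
  simpa [hvec] using this

lemma hd_tC (α β : Fin n) (e : ℝ × ℝ × ℝ × ℝ) (g : QH n) :
    hd α e (fun x => tC (x.1 β)) g = if β = α then tC e else 0 :=
  hd_blk α β e (ContinuousLinearMap.fst ℝ _ _) g

lemma hd_xC (α β : Fin n) (e : ℝ × ℝ × ℝ × ℝ) (g : QH n) :
    hd α e (fun x => xC (x.1 β)) g = if β = α then xC e else 0 :=
  hd_blk α β e ((ContinuousLinearMap.fst ℝ _ _).comp (ContinuousLinearMap.snd ℝ _ _)) g

lemma hd_yC (α β : Fin n) (e : ℝ × ℝ × ℝ × ℝ) (g : QH n) :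
    hd α e (fun x => yC (x.1 β)) g = if β = α then yC e else 0 :=
  hd_blk α β e ((ContinuousLinearMap.fst ℝ _ _).comp ((ContinuousLinearMap.snd ℝ _ _).comp
    (ContinuousLinearMap.snd ℝ _ _))) g

lemma hd_zC (α β : Fin n) (e : ℝ × ℝ × ℝ × ℝ) (g : QH n) :
    hd α e (fun x => zC (x.1 β)) g = if β = α then zC e else 0 :=
  hd_blk α β e ((ContinuousLinearMap.snd ℝ _ _).comp ((ContinuousLinearMap.snd ℝ _ _).comp
    (ContinuousLinearMap.snd ℝ _ _))) g

lemma hd_w1 (α : Fin n) (e : ℝ × ℝ × ℝ × ℝ) (g : QH n) :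
    hd α e (fun x => x.2.1) g = 2 * imI (g.1 α) e :=
  hd_wlin α e (ContinuousLinearMap.fst ℝ _ _) g

lemma hd_w2 (α : Fin n) (e : ℝ × ℝ × ℝ × ℝ) (g : QH n) :
    hd α e (fun x => x.2.2.1) g = 2 * imJ (g.1 α) e :=
  hd_wlin α e ((ContinuousLinearMap.fst ℝ _ _).comp (ContinuousLinearMap.snd ℝ _ _)) g

lemma hd_w3 (α : Fin n) (e : ℝ × ℝ × ℝ × ℝ) (g : QH n) :
    hd α e (fun x => x.2.2.2) g = 2 * imK (g.1 α) e :=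
  hd_wlin α e ((ContinuousLinearMap.snd ℝ _ _).comp (ContinuousLinearMap.snd ℝ _ _)) g

/-- The real inner product of two quaternions. -/
def qdot (a b : ℝ × ℝ × ℝ × ℝ) : ℝ := tC a * tC b + xC a * xC b + yC a * yC b + zC a * zC b

@[fun_prop] lemma differentiable_tC : Differentiable ℝ tC := by unfold tC; fun_prop
@[fun_prop] lemma differentiable_xC : Differentiable ℝ xC := by unfold xC; fun_prop
@[fun_prop] lemma differentiable_yC : Differentiable ℝ yC := by unfold yC; fun_prop
@[fun_prop] lemma differentiable_zC : Differentiable ℝ zC := by unfold zC; fun_prop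
@[fun_prop] lemma differentiable_qSq : Differentiable ℝ (qSq n) :=
  (contDiff_qSq (k := 1)).differentiable (by norm_num)
@[fun_prop] lemma differentiable_wSq : Differentiable ℝ (wSq n) :=
  (contDiff_wSq (k := 1)).differentiable (by norm_num)
@[fun_prop] lemma differentiable_FF : Differentiable ℝ (FF n) :=
  (contDiff_FF (k := 1)).differentiable (by norm_num)
@[fun_prop] lemma continuous_FF : Continuous (FF n) := (contDiff_FF (k := 1)).continuous
@[fun_prop] lemma continuous_qSq : Continuous (qSq n) := (contDiff_qSq (k := 1)).continuous
@[fun_prop] lemma continuous_wSq : Continuous (wSq n) := (contDiff_wSq (k := 1)).continuous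

lemma hd_qSq (α : Fin n) (e : ℝ × ℝ × ℝ × ℝ) (g : QH n) :
    hd α e (qSq n) g = 2 * qdot (g.1 α) e := by
  change hd α e (fun x => ∑ β : Fin n, ((tC (x.1 β)) ^ 2 + (xC (x.1 β)) ^ 2 + (yC (x.1 β)) ^ 2
    + (zC (x.1 β)) ^ 2)) g = _
  rw [hd_sum _ _ (fun i _ => by fun_prop)]
  have : ∀ β : Fin n, hd α e (fun x : QH n => ((tC (x.1 β)) ^ 2 + (xC (x.1 β)) ^ 2
      + (yC (x.1 β)) ^ 2 + (zC (x.1 β)) ^ 2)) g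
      = if β = α then 2 * qdot (g.1 α) e else 0 := by
    intro β
    rw [hd_add (by fun_prop) (by fun_prop), hd_add (by fun_prop) (by fun_prop),
      hd_add (by fun_prop) (by fun_prop), hd_pow _ (by fun_prop), hd_pow _ (by fun_prop),
      hd_pow _ (by fun_prop), hd_pow _ (by fun_prop), hd_tC, hd_xC, hd_yC, hd_zC]
    split_ifs with h
    · subst h; simp [qdot]; ring
    · simp
  simp [this]

lemma hd_wSq (α : Fin n) (e : ℝ × ℝ × ℝ × ℝ) (g : QH n) :
    hd α e (wSq n) g = 4 * (g.2.1 * imI (g.1 α) e + g.2.2.1 * imJ (g.1 α) e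
      + g.2.2.2 * imK (g.1 α) e) := by
  change hd α e (fun x => x.2.1 ^ 2 + x.2.2.1 ^ 2 + x.2.2.2 ^ 2) g = _
  rw [hd_add (by fun_prop) (by fun_prop), hd_add (by fun_prop) (by fun_prop),
    hd_pow _ (by fun_prop), hd_pow _ (by fun_prop), hd_pow _ (by fun_prop), hd_w1, hd_w2, hd_w3]
  push_cast; ring

/-- The derivative of `FF` along `hvec α e`. -/
def dFF (α : Fin n) (e : ℝ × ℝ × ℝ × ℝ) (g : QH n) : ℝ :=
  4 * ((1 + qSq n g) * qdot (g.1 α) e + (g.2.1 * imI (g.1 α) e + g.2.2.1 * imJ (g.1 α) e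
      + g.2.2.2 * imK (g.1 α) e))

lemma hd_FF (α : Fin n) (e : ℝ × ℝ × ℝ × ℝ) (g : QH n) : hd α e (FF n) g = dFF α e g := by
  change hd α e (fun x => (1 + qSq n x) ^ 2 + wSq n x) g = _
  rw [hd_add (by fun_prop) (by fun_prop), hd_pow _ (by fun_prop),
    hd_add (by fun_prop) (by fun_prop), hd_const, hd_qSq, hd_wSq, dFF]
  push_cast; ring

lemma sum_dFF_sq (g : QH n) :
    ∑ α : Fin n, ∑ i : Fin 4, dFF α (qb i) g * dFF α (qb i) g = 16 * qSq n g * FF n g := by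
  have : ∀ α : Fin n, ∑ i : Fin 4, dFF α (qb i) g * dFF α (qb i) g
      = 16 * FF n g * ((tC (g.1 α)) ^ 2 + (xC (g.1 α)) ^ 2 + (yC (g.1 α)) ^ 2
        + (zC (g.1 α)) ^ 2) := by
    intro α
    simp only [Fin.sum_univ_four, dFF, qb, qdot, imI, imJ, imK, FF, wSq]
    simp only [tC, xC, yC, zC]
    ring
  rw [Finset.sum_congr rfl fun α _ => this α, ← Finset.mul_sum]
  unfold qSq; ring

lemma hvec_eq (α : Fin n) (e : ℝ × ℝ × ℝ × ℝ) (g : QH n) :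
    hvec α e g = ((Pi.single α e, 0) : QH n) + (2 * imI (g.1 α) e) • ((0, (1, 0, 0)) : QH n)
      + (2 * imJ (g.1 α) e) • ((0, (0, 1, 0)) : QH n)
      + (2 * imK (g.1 α) e) • ((0, (0, 0, 1)) : QH n) := by
  ext <;> simp [hvec]

lemma integrable_add_and_integral {X : Type*} [MeasurableSpace X] {μ : Measure X} {f g : X → ℝ}
    {a b : ℝ} (hf : Integrable f μ ∧ ∫ x, f x ∂μ = a) (hg : Integrable g μ ∧ ∫ x, g x ∂μ = b) :
    Integrable (fun x => f x + g x) μ ∧ ∫ x, (f x + g x) ∂μ = a + b :=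
  ⟨hf.1.add hg.1, by rw [integral_add hf.1 hg.1, hf.2, hg.2]⟩

lemma integral_mul_fderiv_eq_zero {f l : QH n → ℝ} (hf : ContDiff ℝ 1 f)
    (hfc : HasCompactSupport f) (hl : ContDiff ℝ 1 l) (w : QH n) (hw : ∀ g, fderiv ℝ l g w = 0) :
    Integrable (fun g => l g * fderiv ℝ f g w) ∧ ∫ g, l g * fderiv ℝ f g w = 0 := by
  have hc : Continuous fun g => fderiv ℝ f g w :=
    (hf.continuous_fderiv (by norm_num)).clm_apply continuous_const
  have hI : Integrable (fun g => l g * fderiv ℝ f g w) :=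
    (hl.continuous.mul hc).integrable_of_hasCompactSupport
      ((hfc.fderiv_apply (𝕜 := ℝ) w).mul_left)
  refine ⟨hI, ?_⟩
  rw [integral_mul_fderiv_eq_neg_fderiv_mul_of_integrable _ hI]
  · simp [hw]
  · exact (hl.continuous.mul hf.continuous).integrable_of_hasCompactSupport hfc.mul_left
  · exact fun x _ => hl.differentiable (by norm_num) x
  · exact fun x _ => hf.differentiable (by norm_num) x
  · simp [hw]

lemma continuous_hd {f : QH n → ℝ} (hf : ContDiff ℝ 1 f) (α : Fin n) (e : ℝ × ℝ × ℝ × ℝ) :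
    Continuous (hd α e f) := by
  have : Continuous (hvec α e) := by
    unfold hvec imI imJ imK tC xC yC zC
    fun_prop
  exact (hf.continuous_fderiv (by norm_num)).clm_apply this

lemma hasCompactSupport_hd {f : QH n → ℝ} (hfc : HasCompactSupport f) (α : Fin n)
    (e : ℝ × ℝ × ℝ × ℝ) : HasCompactSupport (hd α e f) := by
  refine (hfc.fderiv (𝕜 := ℝ)).mono ?_
  intro x hx h0
  simp only [Function.mem_support, ne_eq, hd] at hx
  exact hx (by rw [h0]; simp)

/-- The integral of a horizontal derivative of a compactly supported function vanishes. -/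
lemma integral_hd {f : QH n → ℝ} (hf : ContDiff ℝ 1 f) (hfc : HasCompactSupport f)
    (α : Fin n) (e : ℝ × ℝ × ℝ × ℝ) : ∫ g, hd α e f g = 0 := by
  have key : ∀ (l : (ℝ × ℝ × ℝ × ℝ) → ℝ) (_ : ContDiff ℝ 1 l) (w : ℝ × ℝ × ℝ),
      Integrable (fun g : QH n => l (g.1 α) * fderiv ℝ f g (0, w)) ∧
      ∫ g : QH n, l (g.1 α) * fderiv ℝ f g (0, w) = 0 := by
    intro l hl w
    refine integral_mul_fderiv_eq_zero hf hfc (l := fun g => l (g.1 α)) (by fun_prop) _ ?_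
    intro g
    have h1 : HasFDerivAt (fun g : QH n => g.1 α) ((ContinuousLinearMap.proj α).comp
      (ContinuousLinearMap.fst ℝ (Fin n → ℝ × ℝ × ℝ × ℝ) (ℝ × ℝ × ℝ))) g :=
      ((ContinuousLinearMap.proj α).comp
      (ContinuousLinearMap.fst ℝ (Fin n → ℝ × ℝ × ℝ × ℝ) (ℝ × ℝ × ℝ))).hasFDerivAt
    have h2 := ((hl.differentiable (by norm_num) (g.1 α)).hasFDerivAt.comp g h1).fderiv
    rw [show (fun g : QH n => l (g.1 α)) = l ∘ (fun g : QH n => g.1 α) from rfl, h2]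
    simp
  have e1 : ∀ g, hd α e f g = 1 * fderiv ℝ f g ((Pi.single α e, 0) : QH n)
      + 2 * imI (g.1 α) e * fderiv ℝ f g ((0, (1, 0, 0)) : QH n)
      + 2 * imJ (g.1 α) e * fderiv ℝ f g ((0, (0, 1, 0)) : QH n)
      + 2 * imK (g.1 α) e * fderiv ℝ f g ((0, (0, 0, 1)) : QH n) := by
    intro g
    simp only [hd, hvec_eq, map_add, map_smul, smul_eq_mul, one_mul]
  have h0 := integral_mul_fderiv_eq_zero hf hfc (l := fun _ => 1) contDiff_const
    ((Pi.single α e, 0) : QH n) (by simp)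
  have hI := key (fun a => 2 * imI a e) (by unfold imI; fun_prop) (1, 0, 0)
  have hJ := key (fun a => 2 * imJ a e) (by unfold imJ; fun_prop) (0, 1, 0)
  have hK := key (fun a => 2 * imK a e) (by unfold imK; fun_prop) (0, 0, 1)
  simp_rw [e1]
  have := (integrable_add_and_integral
    (integrable_add_and_integral (integrable_add_and_integral h0 hI) hJ) hK).2
  simpa using this

lemma contDiff_dFF {k : WithTop ℕ∞} (α : Fin n) (e : ℝ × ℝ × ℝ × ℝ) :
    ContDiff ℝ k (dFF α e) := by
  unfold dFF qdot imI imJ imK; fun_prop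

@[fun_prop] lemma differentiable_dFF (α : Fin n) (e : ℝ × ℝ × ℝ × ℝ) :
    Differentiable ℝ (dFF α e) := (contDiff_dFF (k := 1) α e).differentiable (by norm_num)

lemma hd_qdot (α : Fin n) (e : ℝ × ℝ × ℝ × ℝ) (g : QH n) :
    hd α e (fun x => qdot (x.1 α) e) g = qdot e e := by
  unfold qdot
  rw [hd_add (by fun_prop) (by fun_prop), hd_add (by fun_prop) (by fun_prop),
    hd_add (by fun_prop) (by fun_prop), hd_mul (by fun_prop) (by fun_prop),
    hd_mul (by fun_prop) (by fun_prop), hd_mul (by fun_prop) (by fun_prop),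
    hd_mul (by fun_prop) (by fun_prop), hd_tC, hd_xC, hd_yC, hd_zC]
  simp [hd_const]

lemma hd_im (α : Fin n) (e : ℝ × ℝ × ℝ × ℝ) (g : QH n) :
    hd α e (fun x => imI (x.1 α) e) g = 0 ∧ hd α e (fun x => imJ (x.1 α) e) g = 0 ∧
    hd α e (fun x => imK (x.1 α) e) g = 0 := by
  unfold imI imJ imK
  refine ⟨?_, ?_, ?_⟩ <;>
  · have c1 := hd_tC α α e g
    have c2 := hd_xC α α e g
    have c3 := hd_yC α α e g
    have c4 := hd_zC α α e g
    have ht : DifferentiableAt ℝ (fun x : QH n => tC (x.1 α)) g := by fun_prop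
    have hx : DifferentiableAt ℝ (fun x : QH n => xC (x.1 α)) g := by fun_prop
    have hy : DifferentiableAt ℝ (fun x : QH n => yC (x.1 α)) g := by fun_prop
    have hz : DifferentiableAt ℝ (fun x : QH n => zC (x.1 α)) g := by fun_prop
    have ev : ∀ (a b c d : ℝ), hd α e (fun x => a * tC (x.1 α) + b * xC (x.1 α)
        + c * yC (x.1 α) + d * zC (x.1 α)) g = a * tC e + b * xC e + c * yC e + d * zC e := by
      intro a b c d
      rw [hd_add (by fun_prop) (by fun_prop), hd_add (by fun_prop) (by fun_prop),
        hd_add (by fun_prop) (by fun_prop), hd_const_mul _ ht, hd_const_mul _ hx,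
        hd_const_mul _ hy, hd_const_mul _ hz, c1, c2, c3, c4]
      simp
    first
      | (have h := ev (-xC e) (tC e) (-zC e) (yC e)
         convert h using 2
         · ext x; ring
         · ring)
      | (have h := ev (-yC e) (zC e) (tC e) (-xC e)
         convert h using 2
         · ext x; ring
         · ring)
      | (have h := ev (-zC e) (-yC e) (xC e) (tC e)
         convert h using 2
         · ext x; ring
         · ring)

lemma hd_dFF (α : Fin n) (e : ℝ × ℝ × ℝ × ℝ) (g : QH n) :
    hd α e (dFF α e) g = 4 * (2 * qdot (g.1 α) e ^ 2 + (1 + qSq n g) * qdot e e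
      + 2 * (imI (g.1 α) e ^ 2 + imJ (g.1 α) e ^ 2 + imK (g.1 α) e ^ 2)) := by
  have d0 : DifferentiableAt ℝ (fun x : QH n => qdot (x.1 α) e) g := by unfold qdot; fun_prop
  have d1 : DifferentiableAt ℝ (fun x : QH n => imI (x.1 α) e) g := by unfold imI; fun_prop
  have d2 : DifferentiableAt ℝ (fun x : QH n => imJ (x.1 α) e) g := by unfold imJ; fun_prop
  have d3 : DifferentiableAt ℝ (fun x : QH n => imK (x.1 α) e) g := by unfold imK; fun_prop
  obtain ⟨h1, h2, h3⟩ := hd_im α e g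
  unfold dFF
  rw [hd_const_mul _ (by fun_prop), hd_add (by fun_prop) (by fun_prop),
    hd_add (by fun_prop) (by fun_prop), hd_add (by fun_prop) (by fun_prop),
    hd_mul (by fun_prop) d0, hd_mul (by fun_prop) d1, hd_mul (by fun_prop) d2,
    hd_mul (by fun_prop) d3, hd_add (by fun_prop) (by fun_prop), hd_const, hd_qSq, hd_qdot,
    hd_w1, hd_w2, hd_w3, h1, h2, h3]
  ring

lemma sum_hd_dFF (g : QH n) :
    ∑ α : Fin n, ∑ i : Fin 4, hd α (qb i) (dFF α (qb i)) g
      = 16 * n * (1 + qSq n g) + 32 * qSq n g := by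
  have : ∀ α : Fin n, ∑ i : Fin 4, hd α (qb i) (dFF α (qb i)) g
      = 16 * (1 + qSq n g) + 32 * ((tC (g.1 α)) ^ 2 + (xC (g.1 α)) ^ 2 + (yC (g.1 α)) ^ 2
        + (zC (g.1 α)) ^ 2) := by
    intro α
    simp only [Fin.sum_univ_four, hd_dFF, qb, qdot, imI, imJ, imK]
    simp only [tC, xC, yC, zC]
    ring
  rw [Finset.sum_congr rfl fun α _ => this α, Finset.sum_add_distrib, ← Finset.mul_sum]
  simp only [Finset.sum_const, Finset.card_univ, Fintype.card_fin, nsmul_eq_mul]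
  rw [← Finset.mul_sum]
  change _ + 32 * qSq n g = _
  ring

/-- The density of the energy that remains after subtracting the ground state part:
`φ² |∇(v/φ)|²` with `φ = F^{-(n+1)}`. -/
noncomputable def rem (v : QH n → ℝ) (g : QH n) : ℝ :=
  ∑ α : Fin n, ∑ i : Fin 4,
    (hd α (qb i) v g + (n + 1) * (v g * ((FF n g)⁻¹ * dFF α (qb i) g))) ^ 2

lemma rem_nonneg (v : QH n → ℝ) (g : QH n) : 0 ≤ rem v g := by unfold rem; positivity

lemma hGradSq_eq_rem {v : QH n → ℝ} (hv : Differentiable ℝ v) (g : QH n) :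
    hGradSq n v g = rem v g + 16 * n * (n + 1) * (v g ^ 2 * (FF n g)⁻¹)
      - (n + 1) * ∑ α : Fin n, ∑ i : Fin 4,
        hd α (qb i) (fun x => v x ^ 2 * ((FF n x)⁻¹ * dFF α (qb i) x)) g := by
  have hF : FF n g ≠ 0 := (FF_pos g).ne'
  have dI : DifferentiableAt ℝ (fun x => (FF n x)⁻¹) g :=
    (differentiable_FF g).inv hF
  have e1 : ∀ (α : Fin n) (i : Fin 4),
      hd α (qb i) (fun x => v x ^ 2 * ((FF n x)⁻¹ * dFF α (qb i) x)) g
      = 2 * v g * hd α (qb i) v g * ((FF n g)⁻¹ * dFF α (qb i) g)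
        + v g ^ 2 * ((FF n g)⁻¹ * hd α (qb i) (dFF α (qb i)) g
          - (FF n g ^ 2)⁻¹ * (dFF α (qb i) g * dFF α (qb i) g)) := by
    intro α i
    rw [hd_mul (by fun_prop) (by fun_prop), hd_mul dI (by fun_prop), hd_pow _ (hv g),
      hd_inv (by fun_prop) hF, hd_FF]
    push_cast; ring
  have e2 : ∀ (α : Fin n) (i : Fin 4),
      (hd α (qb i) v g + (n + 1) * (v g * ((FF n g)⁻¹ * dFF α (qb i) g))) ^ 2
      = hd α (qb i) v g * hd α (qb i) v g + (n + 1) * (2 * v g * hd α (qb i) v g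
        * ((FF n g)⁻¹ * dFF α (qb i) g))
        + (n + 1) ^ 2 * v g ^ 2 * (FF n g ^ 2)⁻¹ * (dFF α (qb i) g * dFF α (qb i) g) := by
    intro α i; field_simp; ring
  rw [hGradSq_eq, rem, hGrad]
  simp_rw [e1, e2, Finset.sum_add_distrib, ← Finset.mul_sum, Finset.sum_sub_distrib,
    ← Finset.mul_sum, sum_hd_dFF, sum_dFF_sq]
  field_simp
  rw [FF]
  ring

lemma continuous_inv_FF : Continuous fun g : QH n => (FF n g)⁻¹ :=
  continuous_FF.inv₀ fun g => (FF_pos g).ne'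

lemma contDiff_inv_FF {k : WithTop ℕ∞} : ContDiff ℝ k fun g : QH n => (FF n g)⁻¹ :=
  contDiff_FF.inv fun g => (FF_pos g).ne'

lemma continuous_hGradSq {v : QH n → ℝ} (hv : ContDiff ℝ 1 v) : Continuous (hGradSq n v) := by
  have : hGradSq n v = hGrad v v := funext (hGradSq_eq v)
  rw [this]
  unfold hGrad
  have := fun α i => continuous_hd hv α (qb i)
  fun_prop

lemma continuous_rem {v : QH n → ℝ} (hv : ContDiff ℝ 1 v) : Continuous (rem v) := by
  unfold rem
  have h1 := fun α i => continuous_hd hv α (qb i)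
  have h2 := continuous_inv_FF (n := n)
  have h3 := fun α i => (contDiff_dFF (n := n) (k := 1) α (qb i)).continuous
  have h4 := hv.continuous
  fun_prop

lemma hd_eq_zero_of_notMem {v : QH n → ℝ} {g : QH n} (hg : g ∉ tsupport v) (α : Fin n)
    (e : ℝ × ℝ × ℝ × ℝ) : hd α e v g = 0 := by
  have : fderiv ℝ v g = 0 := by
    by_contra h
    exact hg (support_fderiv_subset ℝ h)
  simp [hd, this]

lemma hasCompactSupport_hGradSq {v : QH n → ℝ} (hvc : HasCompactSupport v) :
    HasCompactSupport (hGradSq n v) := by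
  refine HasCompactSupport.intro' hvc (isClosed_tsupport v) fun g hg => ?_
  simp [hGradSq_eq, hGrad, hd_eq_zero_of_notMem hg]

lemma hasCompactSupport_rem {v : QH n → ℝ} (hvc : HasCompactSupport v) :
    HasCompactSupport (rem v) := by
  refine HasCompactSupport.intro' hvc (isClosed_tsupport v) fun g hg => ?_
  simp [rem, hd_eq_zero_of_notMem hg, image_eq_zero_of_notMem_tsupport hg]

lemma integrable_hGradSq {v : QH n → ℝ} (hv : ContDiff ℝ 1 v) (hvc : HasCompactSupport v) :
    Integrable (hGradSq n v) :=
  (continuous_hGradSq hv).integrable_of_hasCompactSupport (hasCompactSupport_hGradSq hvc)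

lemma integrable_rem {v : QH n → ℝ} (hv : ContDiff ℝ 1 v) (hvc : HasCompactSupport v) :
    Integrable (rem v) :=
  (continuous_rem hv).integrable_of_hasCompactSupport (hasCompactSupport_rem hvc)

lemma integrable_sq_inv_FF {v : QH n → ℝ} (hv : Continuous v) (hvc : HasCompactSupport v) :
    Integrable fun g => v g ^ 2 * (FF n g)⁻¹ := by
  refine ((hv.pow 2).mul continuous_inv_FF).integrable_of_hasCompactSupport ?_
  refine HasCompactSupport.intro' hvc (isClosed_tsupport v) fun g hg => ?_
  simp [image_eq_zero_of_notMem_tsupport hg]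

/-- Ground state representation of the energy. -/
lemma integral_hGradSq {v : QH n → ℝ} (hv : ContDiff ℝ 1 v) (hvc : HasCompactSupport v) :
    ∫ g, hGradSq n v g = (∫ g, rem v g)
      + 16 * n * (n + 1) * ∫ g, v g ^ 2 * (FF n g)⁻¹ := by
  have hd1 : ∀ (α : Fin n) (i : Fin 4),
      ContDiff ℝ 1 (fun x => v x ^ 2 * ((FF n x)⁻¹ * dFF α (qb i) x)) := fun α i =>
    (hv.pow 2).mul (contDiff_inv_FF.mul (contDiff_dFF α _))
  have hc1 : ∀ (α : Fin n) (i : Fin 4),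
      HasCompactSupport (fun x => v x ^ 2 * ((FF n x)⁻¹ * dFF α (qb i) x)) := fun α i =>
    HasCompactSupport.intro' hvc (isClosed_tsupport v) fun g hg => by
      simp [image_eq_zero_of_notMem_tsupport hg]
  have hI : ∀ (α : Fin n) (i : Fin 4), Integrable
      (hd α (qb i) (fun x => v x ^ 2 * ((FF n x)⁻¹ * dFF α (qb i) x))) := fun α i =>
    (continuous_hd (hd1 α i) _ _).integrable_of_hasCompactSupport
      (hasCompactSupport_hd (hc1 α i) _ _)
  have hIs : Integrable fun g => ∑ α : Fin n, ∑ i : Fin 4,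
        hd α (qb i) (fun x => v x ^ 2 * ((FF n x)⁻¹ * dFF α (qb i) x)) g :=
    integrable_finsetSum _ fun α _ => integrable_finsetSum _ fun i _ => hI α i
  have : ∀ α : Fin n, ∫ g, ∑ i : Fin 4,
        hd α (qb i) (fun x => v x ^ 2 * ((FF n x)⁻¹ * dFF α (qb i) x)) g = 0 := by
    intro α
    rw [integral_finsetSum _ fun i _ => hI α i]
    exact Finset.sum_eq_zero fun i _ => integral_hd (hd1 α i) (hc1 α i) _ _
  have h0 : ∫ g, ∑ α : Fin n, ∑ i : Fin 4,
        hd α (qb i) (fun x => v x ^ 2 * ((FF n x)⁻¹ * dFF α (qb i) x)) g = 0 := by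
    rw [integral_finsetSum _ fun α _ => integrable_finsetSum _ fun i _ => hI α i]
    exact Finset.sum_eq_zero fun α _ => this α
  have h1 := (integrable_add_and_integral (integrable_add_and_integral
    ⟨integrable_rem hv hvc, rfl⟩
    ⟨(integrable_sq_inv_FF hv.continuous hvc).const_mul (16 * n * (n + 1)),
      integral_const_mul _ _⟩) ⟨hIs.const_mul (-(n + 1)), integral_const_mul _ _⟩).2
  rw [h0, mul_zero, add_zero] at h1
  rw [← h1]
  refine integral_congr_ae (Filter.Eventually.of_forall fun g => ?_)
  simp only [hGradSq_eq_rem (hv.differentiable (by norm_num)) g]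
  ring

/-- The components of the quaternion product `(a + i w₁ + j w₂ + k w₃) q`. -/
def qmul (a w₁ w₂ w₃ : ℝ) (q : ℝ × ℝ × ℝ × ℝ) (i : Fin 4) : ℝ :=
  match i with
  | 0 => a * tC q - w₁ * xC q - w₂ * yC q - w₃ * zC q
  | 1 => a * xC q + w₁ * tC q + w₂ * zC q - w₃ * yC q
  | 2 => a * yC q + w₂ * tC q + w₃ * xC q - w₁ * zC q
  | 3 => a * zC q + w₃ * tC q + w₁ * yC q - w₂ * xC q

/-- Numerators of the Cartesian coordinates of the quaternionic Cayley transform. -/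
def eta (j : (Fin n × Fin 4) ⊕ Fin 4) (g : QH n) : ℝ :=
  match j with
  | Sum.inl (β, i) => 2 * qmul (1 + qSq n g) g.2.1 g.2.2.1 g.2.2.2 (g.1 β) i
  | Sum.inr 0 => 2 + 2 * qSq n g - FF n g
  | Sum.inr 1 => 2 * g.2.1
  | Sum.inr 2 => 2 * g.2.2.1
  | Sum.inr 3 => 2 * g.2.2.2

/-- The Cartesian coordinates of the quaternionic Cayley transform. -/
noncomputable def xi (j : (Fin n × Fin 4) ⊕ Fin 4) (g : QH n) : ℝ := eta j g * (FF n g)⁻¹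

lemma qSq_eq (g : QH n) : qSq n g = ∑ α : Fin n, qdot (g.1 α) (g.1 α) := by
  unfold qSq qdot
  exact Finset.sum_congr rfl fun α _ => by ring

lemma contDiff_eta {k : WithTop ℕ∞} (j : (Fin n × Fin 4) ⊕ Fin 4) : ContDiff ℝ k (eta j) := by
  match j with
  | Sum.inl (β, 0) | Sum.inl (β, 1) | Sum.inl (β, 2) | Sum.inl (β, 3) =>
    unfold eta qmul; fun_prop
  | Sum.inr 0 | Sum.inr 1 | Sum.inr 2 | Sum.inr 3 => unfold eta; fun_prop

lemma differentiable_eta (j : (Fin n × Fin 4) ⊕ Fin 4) : Differentiable ℝ (eta j) :=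
  (contDiff_eta (k := 1) j).differentiable (by norm_num)

lemma contDiff_xi {k : WithTop ℕ∞} (j : (Fin n × Fin 4) ⊕ Fin 4) : ContDiff ℝ k (xi j) :=
  (contDiff_eta j).mul contDiff_inv_FF

lemma differentiable_xi (j : (Fin n × Fin 4) ⊕ Fin 4) : Differentiable ℝ (xi j) :=
  (contDiff_xi (k := 1) j).differentiable (by norm_num)

lemma sum_eta_sq (g : QH n) : ∑ j, eta j g ^ 2 = FF n g ^ 2 := by
  rw [Fintype.sum_sum_type, Fintype.sum_prod_type]
  have h1 : ∀ β : Fin n, ∑ i : Fin 4, eta (Sum.inl (β, i)) g ^ 2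
      = 4 * FF n g * qdot (g.1 β) (g.1 β) := by
    intro β
    simp only [Fin.sum_univ_four, eta, qmul, FF, wSq, qdot]
    ring
  simp only [h1, ← Finset.mul_sum, ← qSq_eq]
  simp only [Fin.sum_univ_four, eta, FF, wSq]
  ring

lemma sum_xi_sq (g : QH n) : ∑ j, xi j g ^ 2 = 1 := by
  have hF : FF n g ≠ 0 := (FF_pos g).ne'
  simp only [xi, mul_pow, ← Finset.sum_mul, sum_eta_sq]
  field_simp

lemma abs_xi_le (j : (Fin n × Fin 4) ⊕ Fin 4) (g : QH n) : |xi j g| ≤ 1 := by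
  rw [← sq_le_one_iff_abs_le_one, ← sum_xi_sq g]
  exact Finset.single_le_sum (f := fun j => xi j g ^ 2) (fun i _ => sq_nonneg _)
    (Finset.mem_univ j)

lemma sum_xi_mul_hd (α : Fin n) (e : ℝ × ℝ × ℝ × ℝ) (g : QH n) :
    ∑ j, xi j g * hd α e (xi j) g = 0 := by
  have h : hd α e (fun x => ∑ j, xi j x ^ 2) g = 0 := by
    have : (fun x : QH n => ∑ j, xi j x ^ 2) = fun _ => 1 := funext sum_xi_sq
    rw [this, hd_const]
  have hd2 : ∀ j ∈ Finset.univ, DifferentiableAt ℝ (fun x : QH n => xi j x ^ 2) g :=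
    fun j _ => ((differentiable_xi j).pow 2) g
  rw [hd_sum _ _ hd2] at h
  simp only [hd_pow 2 (differentiable_xi _ g)] at h
  have h2 : ∑ j, ((2 : ℕ) : ℝ) * xi j g ^ (2 - 1) * hd α e (xi j) g
      = 2 * ∑ j, xi j g * hd α e (xi j) g := by
    rw [Finset.mul_sum]
    exact Finset.sum_congr rfl fun j _ => by push_cast; ring
  rw [h2] at h
  linarith

lemma sum_eta_mul_hd (α : Fin n) (e : ℝ × ℝ × ℝ × ℝ) (g : QH n) :
    ∑ j, eta j g * hd α e (eta j) g = FF n g * dFF α e g := by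
  have h : hd α e (fun x => ∑ j, eta j x ^ 2) g = 2 * FF n g * dFF α e g := by
    have : (fun x : QH n => ∑ j, eta j x ^ 2) = fun x => FF n x ^ 2 := funext sum_eta_sq
    rw [this, hd_pow 2 (by fun_prop), hd_FF]
    push_cast; ring
  have hd2 : ∀ j ∈ Finset.univ, DifferentiableAt ℝ (fun x : QH n => eta j x ^ 2) g :=
    fun j _ => ((differentiable_eta j).pow 2) g
  rw [hd_sum _ _ hd2] at h
  simp only [hd_pow 2 (differentiable_eta _ g)] at h
  have h2 : ∑ j, ((2 : ℕ) : ℝ) * eta j g ^ (2 - 1) * hd α e (eta j) g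
      = 2 * ∑ j, eta j g * hd α e (eta j) g := by
    rw [Finset.mul_sum]
    exact Finset.sum_congr rfl fun j _ => by push_cast; ring
  rw [h2] at h
  linarith

lemma hd_xi (j : (Fin n × Fin 4) ⊕ Fin 4) (α : Fin n) (e : ℝ × ℝ × ℝ × ℝ) (g : QH n) :
    hd α e (xi j) g = (FF n g)⁻¹ * hd α e (eta j) g
      - (FF n g ^ 2)⁻¹ * dFF α e g * eta j g := by
  have hF : FF n g ≠ 0 := (FF_pos g).ne'
  have dI : DifferentiableAt ℝ (fun x => (FF n x)⁻¹) g := (differentiable_FF g).inv hF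
  change hd α e (fun x => eta j x * (FF n x)⁻¹) g = _
  rw [hd_mul (differentiable_eta j g) dI, hd_inv (by fun_prop) hF,
    hd_FF]
  ring

lemma sum_hd_xi_sq (α : Fin n) (e : ℝ × ℝ × ℝ × ℝ) (g : QH n) :
    ∑ j, hd α e (xi j) g ^ 2
      = (FF n g ^ 2)⁻¹ * (∑ j, hd α e (eta j) g ^ 2 - dFF α e g * dFF α e g) := by
  have hF : FF n g ≠ 0 := (FF_pos g).ne'
  have h : ∀ j, hd α e (xi j) g ^ 2 = (FF n g ^ 2)⁻¹ * hd α e (eta j) g ^ 2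
      - 2 * (FF n g ^ 3)⁻¹ * dFF α e g * (eta j g * hd α e (eta j) g)
      + (FF n g ^ 4)⁻¹ * dFF α e g ^ 2 * eta j g ^ 2 := by
    intro j; rw [hd_xi]; field_simp; ring
  simp only [h, Finset.sum_add_distrib, Finset.sum_sub_distrib, ← Finset.mul_sum, sum_eta_mul_hd,
    sum_eta_sq]
  field_simp
  ring

lemma hd_eta_inl (α β : Fin n) (i : Fin 4) (e : ℝ × ℝ × ℝ × ℝ) (g : QH n) :
    hd α e (eta (Sum.inl (β, i))) g = 2 * (qmul (2 * qdot (g.1 α) e) (2 * imI (g.1 α) e)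
      (2 * imJ (g.1 α) e) (2 * imK (g.1 α) e) (g.1 β) i
      + if β = α then qmul (1 + qSq n g) g.2.1 g.2.2.1 g.2.2.2 e i else 0) := by
  have ht : DifferentiableAt ℝ (fun x : QH n => tC (x.1 β)) g := by fun_prop
  have hx : DifferentiableAt ℝ (fun x : QH n => xC (x.1 β)) g := by fun_prop
  have hy : DifferentiableAt ℝ (fun x : QH n => yC (x.1 β)) g := by fun_prop
  have hz : DifferentiableAt ℝ (fun x : QH n => zC (x.1 β)) g := by fun_prop
  have h1 : DifferentiableAt ℝ (fun x : QH n => x.2.1) g := by fun_prop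
  have h2 : DifferentiableAt ℝ (fun x : QH n => x.2.2.1) g := by fun_prop
  have h3 : DifferentiableAt ℝ (fun x : QH n => x.2.2.2) g := by fun_prop
  have hA : DifferentiableAt ℝ (fun x : QH n => 1 + qSq n x) g := by fun_prop
  have hdA : hd α e (fun x : QH n => 1 + qSq n x) g = 2 * qdot (g.1 α) e := by
    rw [hd_add (by fun_prop) (by fun_prop), hd_const, hd_qSq]; ring
  have r1 := hd_tC α β e g
  have r2 := hd_xC α β e g
  have r3 := hd_yC α β e g
  have r4 := hd_zC α β e g
  fin_cases i
  · change hd α e (fun x : QH n => 2 * ((1 + qSq n x) * tC (x.1 β) - x.2.1 * xC (x.1 β)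
      - x.2.2.1 * yC (x.1 β) - x.2.2.2 * zC (x.1 β))) g = _
    rw [hd_const_mul _ (by fun_prop), hd_sub (by fun_prop) (by fun_prop),
      hd_sub (by fun_prop) (by fun_prop), hd_sub (by fun_prop) (by fun_prop),
      hd_mul hA ht, hd_mul h1 hx, hd_mul h2 hy, hd_mul h3 hz, r1, r2, r3, r4, hdA, hd_w1, hd_w2,
      hd_w3]
    simp only [qmul]
    split_ifs <;> ring
  · change hd α e (fun x : QH n => 2 * ((1 + qSq n x) * xC (x.1 β) + x.2.1 * tC (x.1 β)
      + x.2.2.1 * zC (x.1 β) - x.2.2.2 * yC (x.1 β))) g = _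
    rw [hd_const_mul _ (by fun_prop), hd_sub (by fun_prop) (by fun_prop),
      hd_add (by fun_prop) (by fun_prop), hd_add (by fun_prop) (by fun_prop),
      hd_mul hA hx, hd_mul h1 ht, hd_mul h2 hz, hd_mul h3 hy, r1, r2, r3, r4, hdA, hd_w1, hd_w2,
      hd_w3]
    simp only [qmul]
    split_ifs <;> ring
  · change hd α e (fun x : QH n => 2 * ((1 + qSq n x) * yC (x.1 β) + x.2.2.1 * tC (x.1 β)
      + x.2.2.2 * xC (x.1 β) - x.2.1 * zC (x.1 β))) g = _
    rw [hd_const_mul _ (by fun_prop), hd_sub (by fun_prop) (by fun_prop),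
      hd_add (by fun_prop) (by fun_prop), hd_add (by fun_prop) (by fun_prop),
      hd_mul hA hy, hd_mul h2 ht, hd_mul h3 hx, hd_mul h1 hz, r1, r2, r3, r4, hdA, hd_w1, hd_w2,
      hd_w3]
    simp only [qmul]
    split_ifs <;> ring
  · change hd α e (fun x : QH n => 2 * ((1 + qSq n x) * zC (x.1 β) + x.2.2.2 * tC (x.1 β)
      + x.2.1 * yC (x.1 β) - x.2.2.1 * xC (x.1 β))) g = _
    rw [hd_const_mul _ (by fun_prop), hd_sub (by fun_prop) (by fun_prop),
      hd_add (by fun_prop) (by fun_prop), hd_add (by fun_prop) (by fun_prop),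
      hd_mul hA hz, hd_mul h3 ht, hd_mul h1 hy, hd_mul h2 hx, r1, r2, r3, r4, hdA, hd_w1, hd_w2,
      hd_w3]
    simp only [qmul]
    split_ifs <;> ring

lemma sum_hd_eta_inl_sq (α β : Fin n) (g : QH n) :
    ∑ i : Fin 4, ∑ k : Fin 4, hd α (qb k) (eta (Sum.inl (β, i))) g ^ 2
      = 64 * qdot (g.1 α) (g.1 α) * qdot (g.1 β) (g.1 β)
        + if β = α then -32 * (1 + qSq n g) * qdot (g.1 α) (g.1 α) + 16 * FF n g else 0 := by
  simp only [hd_eta_inl]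
  split_ifs with h
  · subst h
    simp only [Fin.sum_univ_four, qmul, FF, wSq, qdot, imI, imJ, imK, qb]
    simp only [tC, xC, yC, zC]
    ring
  · simp only [Fin.sum_univ_four, qmul, qdot, imI, imJ, imK, qb]
    simp only [tC, xC, yC, zC]
    ring

lemma sum_hd_eta_inr_sq (α : Fin n) (g : QH n) :
    ∑ i : Fin 4, ∑ k : Fin 4, hd α (qb k) (eta (Sum.inr i)) g ^ 2
      = ∑ k : Fin 4, dFF α (qb k) g * dFF α (qb k) g
        + (64 - 32 * (1 + qSq n g)) * qdot (g.1 α) (g.1 α) := by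
  have h0 : ∀ e, hd α e (eta (Sum.inr 0)) g = 2 * (2 * qdot (g.1 α) e) - dFF α e g := by
    intro e
    change hd α e (fun x => 2 + 2 * qSq n x - FF n x) g = _
    rw [hd_sub (by fun_prop) (by fun_prop), hd_add (by fun_prop) (by fun_prop), hd_const,
      hd_const_mul _ (by fun_prop), hd_qSq, hd_FF]
    ring
  have h1 : ∀ e, hd α e (eta (Sum.inr 1)) g = 2 * (2 * imI (g.1 α) e) := by
    intro e
    change hd α e (fun x => 2 * x.2.1) g = _
    rw [hd_const_mul _ (by fun_prop), hd_w1]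
  have h2 : ∀ e, hd α e (eta (Sum.inr 2)) g = 2 * (2 * imJ (g.1 α) e) := by
    intro e
    change hd α e (fun x => 2 * x.2.2.1) g = _
    rw [hd_const_mul _ (by fun_prop), hd_w2]
  have h3 : ∀ e, hd α e (eta (Sum.inr 3)) g = 2 * (2 * imK (g.1 α) e) := by
    intro e
    change hd α e (fun x => 2 * x.2.2.2) g = _
    rw [hd_const_mul _ (by fun_prop), hd_w3]
  simp only [Fin.sum_univ_four, h0, h1, h2, h3, dFF, qdot, imI, imJ, imK, qb]
  simp only [tC, xC, yC, zC]
  ring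

/-- The squared horizontal gradients of the coordinates of the Cayley transform add up to
a multiple of `F⁻¹`. -/
lemma sum_hGradSq_xi (g : QH n) : ∑ j, hGradSq n (xi j) g = 16 * n * (FF n g)⁻¹ := by
  have hF : FF n g ≠ 0 := (FF_pos g).ne'
  have e1 : ∑ j, hGradSq n (xi j) g
      = ∑ α : Fin n, ∑ k : Fin 4, ∑ j, hd α (qb k) (xi j) g ^ 2 := by
    simp only [hGradSq_eq, hGrad, ← pow_two]
    rw [Finset.sum_comm]
    exact Finset.sum_congr rfl fun α _ => Finset.sum_comm
  have e2 : ∀ α : Fin n, ∑ k : Fin 4, ∑ j, hd α (qb k) (eta j) g ^ 2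
      = 64 * qdot (g.1 α) (g.1 α) * qSq n g + (-32 * (1 + qSq n g) * qdot (g.1 α) (g.1 α)
        + 16 * FF n g) + (∑ k : Fin 4, dFF α (qb k) g * dFF α (qb k) g
        + (64 - 32 * (1 + qSq n g)) * qdot (g.1 α) (g.1 α)) := by
    intro α
    simp only [Fintype.sum_sum_type, Fintype.sum_prod_type, Finset.sum_add_distrib]
    rw [Finset.sum_comm (s := Finset.univ (α := Fin 4)) (t := Finset.univ (α := Fin n))]
    rw [Finset.sum_congr rfl fun β _ => (Finset.sum_comm (s := Finset.univ (α := Fin 4))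
      (t := Finset.univ (α := Fin 4))).trans (sum_hd_eta_inl_sq α β g)]
    rw [Finset.sum_comm (s := Finset.univ (α := Fin 4)) (t := Finset.univ (α := Fin 4)),
      sum_hd_eta_inr_sq, Finset.sum_add_distrib, ← Finset.mul_sum, ← qSq_eq]
    simp
  rw [e1]
  simp only [sum_hd_xi_sq, ← Finset.mul_sum, Finset.sum_sub_distrib, e2, Finset.sum_add_distrib,
    sum_dFF_sq]
  simp only [← Finset.sum_mul, ← Finset.mul_sum, ← qSq_eq, Finset.sum_const, Finset.card_univ,
    Fintype.card_fin, nsmul_eq_mul]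
  field_simp
  ring

lemma sum_hGradSq_xi_mul {v : QH n → ℝ} (hv : Differentiable ℝ v) (g : QH n) :
    ∑ j, hGradSq n (fun x => xi j x * v x) g
      = hGradSq n v g + 16 * n * (v g ^ 2 * (FF n g)⁻¹) := by
  have h : ∀ j, hGradSq n (fun x => xi j x * v x) g = ∑ α : Fin n, ∑ k : Fin 4,
      (v g ^ 2 * (hd α (qb k) (xi j) g * hd α (qb k) (xi j) g)
        + 2 * v g * hd α (qb k) v g * (xi j g * hd α (qb k) (xi j) g)
        + hd α (qb k) v g * hd α (qb k) v g * xi j g ^ 2) := by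
    intro j
    rw [hGradSq_eq, hGrad]
    refine Finset.sum_congr rfl fun α _ => Finset.sum_congr rfl fun k _ => ?_
    rw [hd_mul (differentiable_xi j g) (hv g)]
    ring
  simp only [h]
  rw [Finset.sum_comm]
  have h2 : ∀ α : Fin n, ∑ j, ∑ k : Fin 4,
      (v g ^ 2 * (hd α (qb k) (xi j) g * hd α (qb k) (xi j) g)
        + 2 * v g * hd α (qb k) v g * (xi j g * hd α (qb k) (xi j) g)
        + hd α (qb k) v g * hd α (qb k) v g * xi j g ^ 2)
      = v g ^ 2 * (∑ j, ∑ k : Fin 4, hd α (qb k) (xi j) g * hd α (qb k) (xi j) g)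
        + ∑ k : Fin 4, hd α (qb k) v g * hd α (qb k) v g := by
    intro α
    rw [Finset.sum_comm, Finset.sum_comm (s := Finset.univ (α := (Fin n × Fin 4) ⊕ Fin 4)),
      Finset.mul_sum, ← Finset.sum_add_distrib]
    refine Finset.sum_congr rfl fun k _ => ?_
    rw [Finset.sum_add_distrib, Finset.sum_add_distrib, ← Finset.mul_sum, ← Finset.mul_sum,
      ← Finset.mul_sum, sum_xi_mul_hd, sum_xi_sq]
    ring
  rw [Finset.sum_congr rfl fun α _ => h2 α, Finset.sum_add_distrib, ← Finset.mul_sum,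
    Finset.sum_comm, hGradSq_eq, hGrad]
  have := sum_hGradSq_xi g
  simp only [hGradSq_eq, hGrad] at this
  rw [this]
  ring

/-- The bilinear form `2 Im (a b̄)` on `ℍⁿ`. -/
def imB (a b : Fin n → ℝ × ℝ × ℝ × ℝ) : ℝ × ℝ × ℝ :=
  (2 * ∑ α, imI (a α) (b α), 2 * ∑ α, imJ (a α) (b α), 2 * ∑ α, imK (a α) (b α))

lemma op_eq (a g : QH n) : op n a g = (a.1 + g.1, g.2 + a.2 + imB a.1 g.1) := rfl

lemma imB_add_left (a b c : Fin n → ℝ × ℝ × ℝ × ℝ) : imB (a + b) c = imB a c + imB b c := by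
  simp only [imB, Prod.mk_add_mk, ← mul_add, ← Finset.sum_add_distrib]
  refine Prod.ext ?_ (Prod.ext ?_ ?_) <;> dsimp only <;> congr 1 <;>
    refine Finset.sum_congr rfl fun α _ => ?_ <;>
    simp only [imI, imJ, imK, tC, xC, yC, zC, Pi.add_apply, Prod.fst_add, Prod.snd_add] <;> ring

lemma imB_comm (a b : Fin n → ℝ × ℝ × ℝ × ℝ) : imB a b = -imB b a := by
  simp only [imB, Prod.neg_mk, ← mul_neg, ← Finset.sum_neg_distrib]
  refine Prod.ext ?_ (Prod.ext ?_ ?_) <;> dsimp only <;> congr 1 <;>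
    refine Finset.sum_congr rfl fun α _ => ?_ <;>
    simp only [imI, imJ, imK] <;> ring

lemma imB_smul_left (s : ℝ) (a b : Fin n → ℝ × ℝ × ℝ × ℝ) : imB (s • a) b = s • imB a b := by
  simp only [imB, Prod.smul_mk, smul_eq_mul, mul_left_comm s]
  refine Prod.ext ?_ (Prod.ext ?_ ?_) <;> dsimp only <;> congr 1 <;> rw [Finset.mul_sum] <;>
    refine Finset.sum_congr rfl fun α _ => ?_ <;>
    simp only [imI, imJ, imK, tC, xC, yC, zC, Pi.smul_apply, Prod.smul_fst, Prod.smul_snd,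
      smul_eq_mul] <;> ring

lemma imB_add_right (a b c : Fin n → ℝ × ℝ × ℝ × ℝ) : imB a (b + c) = imB a b + imB a c := by
  rw [imB_comm, imB_add_left, imB_comm b, imB_comm c, neg_add, neg_neg, neg_neg]

lemma imB_smul_right (s : ℝ) (a b : Fin n → ℝ × ℝ × ℝ × ℝ) : imB a (s • b) = s • imB a b := by
  rw [imB_comm, imB_smul_left, imB_comm b, smul_neg, neg_neg]

lemma imB_self (a : Fin n → ℝ × ℝ × ℝ × ℝ) : imB a a = 0 := by
  have h := imB_comm a a
  have : (2 : ℝ) • imB a a = 0 := by rw [two_smul]; nth_rewrite 2 [h]; exact add_neg_cancel _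
  exact (smul_eq_zero.mp this).resolve_left two_ne_zero

lemma imB_neg_left (a b : Fin n → ℝ × ℝ × ℝ × ℝ) : imB (-a) b = -imB a b := by
  rw [← neg_one_smul ℝ a, imB_smul_left, neg_one_smul]

lemma imB_neg_right (a b : Fin n → ℝ × ℝ × ℝ × ℝ) : imB a (-b) = -imB a b := by
  rw [← neg_one_smul ℝ b, imB_smul_right, neg_one_smul]

lemma imB_single (a : Fin n → ℝ × ℝ × ℝ × ℝ) (α : Fin n) (e : ℝ × ℝ × ℝ × ℝ) :
    imB a (Pi.single α e) = (2 * imI (a α) e, 2 * imJ (a α) e, 2 * imK (a α) e) := by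
  have h : ∀ f : (ℝ × ℝ × ℝ × ℝ) → (ℝ × ℝ × ℝ × ℝ) → ℝ, (∀ x, f x 0 = 0) →
      ∑ β, f (a β) ((Pi.single α e : Fin n → ℝ × ℝ × ℝ × ℝ) β) = f (a α) e := by
    intro f hf
    rw [Finset.sum_eq_single α]
    · simp
    · intro β _ hβ; rw [Pi.single_eq_of_ne hβ, hf]
    · simp
  simp only [imB]
  rw [h imI, h imJ, h imK] <;> intro x <;> simp [imI, imJ, imK, tC, xC, yC, zC]

lemma hvec_eq_imB (α : Fin n) (e : ℝ × ℝ × ℝ × ℝ) (g : QH n) :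
    hvec α e g = (Pi.single α e, imB g.1 (Pi.single α e)) := by
  rw [imB_single]; rfl

lemma op_assoc (a b c : QH n) : op n (op n a b) c = op n a (op n b c) := by
  simp only [op_eq, imB_add_left, imB_add_right]
  refine Prod.ext ?_ ?_ <;> dsimp only <;> abel

lemma op_zero (a : QH n) : op n a 0 = a := by
  have : imB a.1 0 = 0 := by simpa using imB_smul_right 0 a.1 0
  simp [op_eq, this]

lemma zero_op (a : QH n) : op n 0 a = a := by
  have : imB 0 a.1 = 0 := by simpa using imB_smul_left 0 0 a.1
  simp [op_eq, this]

lemma op_neg_self (a : QH n) : op n a (-a) = 0 := by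
  simp [op_eq, imB_neg_right, imB_self]

lemma neg_op_self (a : QH n) : op n (-a) a = 0 := by
  simp [op_eq, imB_neg_left, imB_self]

lemma neg_op_cancel (a g : QH n) : op n (-a) (op n a g) = g := by
  rw [← op_assoc, neg_op_self, zero_op]

lemma op_neg_cancel (a g : QH n) : op n a (op n (-a) g) = g := by
  rw [← op_assoc, op_neg_self, zero_op]

lemma dil_eq (l : ℝ) (g : QH n) : dil n l g = (l • g.1, l ^ 2 • g.2) := rfl

lemma dil_op (l : ℝ) (a g : QH n) : dil n l (op n a g) = op n (dil n l a) (dil n l g) := by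
  simp only [dil_eq, op_eq, imB_smul_left, imB_smul_right, smul_add, smul_smul, pow_two]

lemma dil_dil (l m : ℝ) (g : QH n) : dil n l (dil n m g) = dil n (l * m) g := by
  simp only [dil_eq, smul_smul, mul_pow]

lemma dil_one (g : QH n) : dil n 1 g = g := by simp [dil_eq]

lemma contDiff_imB {k : WithTop ℕ∞} : ContDiff ℝ k
    fun x : (Fin n → ℝ × ℝ × ℝ × ℝ) × (Fin n → ℝ × ℝ × ℝ × ℝ) => imB x.1 x.2 := by
  unfold imB imI imJ imK; fun_prop

@[fun_prop] lemma Continuous.imB {X : Type*} [TopologicalSpace X]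
    {f g : X → Fin n → ℝ × ℝ × ℝ × ℝ} (hf : Continuous f) (hg : Continuous g) :
    Continuous fun x => imB (f x) (g x) :=
  ((contDiff_imB (k := 1)).continuous).comp (hf.prodMk hg)

lemma contDiff_op {k : WithTop ℕ∞} : ContDiff ℝ k fun x : QH n × QH n => op n x.1 x.2 := by
  have := (contDiff_imB (n := n) (k := k)).comp
    (f := fun x : QH n × QH n => (x.1.1, x.2.1)) (by fun_prop)
  simp only [op_eq]
  exact ContDiff.prodMk (by fun_prop) (ContDiff.add (by fun_prop) this)

lemma contDiff_dil {k : WithTop ℕ∞} : ContDiff ℝ k fun x : ℝ × QH n => dil n x.1 x.2 := by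
  simp only [dil_eq]; fun_prop

lemma continuous_op : Continuous fun x : QH n × QH n => op n x.1 x.2 :=
  (contDiff_op (k := 1)).continuous

@[fun_prop] lemma Continuous.op {X : Type*} [TopologicalSpace X] {f g : X → QH n}
    (hf : Continuous f) (hg : Continuous g) : Continuous fun x => op n (f x) (g x) :=
  continuous_op.comp (hf.prodMk hg)

@[fun_prop] lemma Continuous.dil {X : Type*} [TopologicalSpace X] {f : X → ℝ} {g : X → QH n}
    (hf : Continuous f) (hg : Continuous g) : Continuous fun x => dil n (f x) (g x) :=
  ((contDiff_dil (k := 1)).continuous).comp (hf.prodMk hg)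

/-- The shear `(q, ω) ↦ (a + q, ω + c(q))`. -/
def shear (a : Fin n → ℝ × ℝ × ℝ × ℝ) (c : (Fin n → ℝ × ℝ × ℝ × ℝ) → ℝ × ℝ × ℝ)
    (hc : Continuous c) : QH n ≃ₜ QH n where
  toFun g := (a + g.1, g.2 + c g.1)
  invFun g := (g.1 - a, g.2 - c (g.1 - a))
  left_inv g := by simp
  right_inv g := by simp
  continuous_toFun := by fun_prop
  continuous_invFun := by fun_prop

lemma measurePreserving_shear (a : Fin n → ℝ × ℝ × ℝ × ℝ)
    (c : (Fin n → ℝ × ℝ × ℝ × ℝ) → ℝ × ℝ × ℝ) (hc : Continuous c) :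
    MeasurePreserving (shear a c hc) := by
  have h := (measurePreserving_add_left (volume : Measure (Fin n → ℝ × ℝ × ℝ × ℝ)) a).skew_product
    (μc := (volume : Measure (ℝ × ℝ × ℝ))) (μd := (volume : Measure (ℝ × ℝ × ℝ)))
    (g := fun q w => w + c q) (by fun_prop)
    (Filter.Eventually.of_forall fun q => (measurePreserving_add_right volume (c q)).map_eq)
  exact h

/-- Left translation. -/
def opL (a : QH n) : QH n ≃ₜ QH n :=
  shear a.1 (fun q => a.2 + imB a.1 q)
    (by fun_prop)

/-- Right translation. -/
def opR (h : QH n) : QH n ≃ₜ QH n :=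
  shear h.1 (fun q => h.2 + imB q h.1)
    (by fun_prop)

lemma opL_apply (a g : QH n) : opL a g = op n a g := by
  simp [opL, shear, op_eq, add_assoc]

lemma opR_apply (h g : QH n) : opR h g = op n g h := by
  refine Prod.ext (add_comm _ _) ?_
  change g.2 + (h.2 + imB g.1 h.1) = h.2 + g.2 + imB g.1 h.1
  abel

lemma measurePreserving_opL (a : QH n) : MeasurePreserving (opL a) :=
  measurePreserving_shear _ _ _

lemma measurePreserving_opR (a : QH n) : MeasurePreserving (opR a) :=
  measurePreserving_shear _ _ _

lemma integral_op_left (a : QH n) (f : QH n → ℝ) : ∫ g, f (op n a g) = ∫ g, f g := by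
  simp only [← opL_apply]
  exact (measurePreserving_opL a).integral_comp (opL a).measurableEmbedding f

lemma integral_dil {l : ℝ} (hl : 0 < l) (f : QH n → ℝ) :
    ∫ g, f (dil n l g) = (l ^ (4 * n + 6))⁻¹ * ∫ g, f g := by
  let e : QH n ≃ₜ QH n := (Homeomorph.smulOfNeZero l hl.ne').prodCongr
    (Homeomorph.smulOfNeZero (l ^ 2) (by positivity))
  have he : ∀ g, dil n l g = e g := fun g => rfl
  have hmap : Measure.map e (volume : Measure (QH n))
      = ENNReal.ofReal (l ^ (4 * n + 6))⁻¹ • volume := by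
    have h1 := Measure.map_addHaar_smul (volume : Measure (Fin n → ℝ × ℝ × ℝ × ℝ)) hl.ne'
    have h2 := Measure.map_addHaar_smul (volume : Measure (ℝ × ℝ × ℝ)) (r := l ^ 2)
      (by positivity)
    have h3 := Measure.map_prod_map (volume : Measure (Fin n → ℝ × ℝ × ℝ × ℝ))
      (volume : Measure (ℝ × ℝ × ℝ)) (f := (l • ·)) (g := (l ^ 2 • ·))
      (by fun_prop) (by fun_prop)
    rw [h1, h2, Measure.prod_smul_left, Measure.prod_smul_right, smul_smul] at h3
    refine h3.symm.trans ?_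
    rw [← Measure.volume_eq_prod, ← ENNReal.ofReal_mul (abs_nonneg _)]
    congr 2
    rw [abs_of_pos (by positivity), abs_of_pos (by positivity), ← mul_inv, ← pow_mul, ← pow_add]
    have h4 : Module.finrank ℝ (Fin n → ℝ × ℝ × ℝ × ℝ) = n * 4 := by
      rw [Module.finrank_pi_fintype]; simp
    rw [h4]
    simp
    congr 1; ring
  have := e.measurableEmbedding.integral_map (μ := volume) f
  rw [hmap, integral_smul_measure, ENNReal.toReal_ofReal (by positivity), smul_eq_mul] at this
  simp only [he, this]

lemma hd_eq_deriv {u : QH n → ℝ} {g : QH n} (hu : DifferentiableAt ℝ u g) (α : Fin n)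
    (e : ℝ × ℝ × ℝ × ℝ) : hd α e u g = deriv (fun t : ℝ => u (g + t • hvec α e g)) 0 :=
  hu.lineDeriv_eq_fderiv.symm

lemma add_smul_hvec (α : Fin n) (e : ℝ × ℝ × ℝ × ℝ) (g : QH n) (t : ℝ) :
    g + t • hvec α e g = op n g (t • Pi.single α e, 0) := by
  rw [hvec_eq_imB, op_eq, imB_smul_right, zero_add]; rfl

lemma hd_op {u : QH n → ℝ} (hu : Differentiable ℝ u) (a : QH n) (α : Fin n)
    (e : ℝ × ℝ × ℝ × ℝ) (g : QH n) : hd α e (fun x => u (op n a x)) g = hd α e u (op n a g) := by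
  have ho : Differentiable ℝ (fun x : QH n => op n a x) :=
    ((contDiff_op (k := 1)).comp (contDiff_const.prodMk contDiff_id)).differentiable (by norm_num)
  have hc := hu.comp ho g
  rw [Function.comp_def] at hc
  rw [hd_eq_deriv hc, hd_eq_deriv (hu _)]
  simp only [add_smul_hvec, ← op_assoc]

lemma hd_dil {u : QH n → ℝ} (hu : Differentiable ℝ u) (l : ℝ) (α : Fin n)
    (e : ℝ × ℝ × ℝ × ℝ) (g : QH n) :
    hd α e (fun x => u (dil n l x)) g = l * hd α e u (dil n l g) := by
  have ho : Differentiable ℝ (fun x : QH n => dil n l x) :=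
    ((contDiff_dil (k := 1)).comp (contDiff_const.prodMk contDiff_id)).differentiable (by norm_num)
  have hc := hu.comp ho g
  rw [Function.comp_def] at hc
  rw [hd_eq_deriv hc, hd_eq_deriv (hu _)]
  have : ∀ t : ℝ, dil n l (g + t • hvec α e g)
      = dil n l g + (l * t) • hvec α e (dil n l g) := by
    intro t
    rw [add_smul_hvec, add_smul_hvec, dil_op, dil_eq l (t • _, 0)]
    simp only [smul_zero, smul_smul]
  simp only [this]
  have := deriv_comp_mul_left l (fun t : ℝ => u (dil n l g + t • hvec α e (dil n l g))) 0
  simpa using this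

lemma hd_conf {u : QH n → ℝ} (hu : Differentiable ℝ u) (c l : ℝ) (a : QH n) (α : Fin n)
    (e : ℝ × ℝ × ℝ × ℝ) (g : QH n) :
    hd α e (fun x => c * u (op n a (dil n l x))) g = c * (l * hd α e u (op n a (dil n l g))) := by
  have ho : Differentiable ℝ (fun x : QH n => op n a x) :=
    ((contDiff_op (k := 1)).comp (contDiff_const.prodMk contDiff_id)).differentiable (by norm_num)
  have ho' : Differentiable ℝ (fun x : QH n => dil n l x) :=
    ((contDiff_dil (k := 1)).comp (contDiff_const.prodMk contDiff_id)).differentiable (by norm_num)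
  have h1 : Differentiable ℝ (fun x => u (op n a x)) := hu.comp ho
  have h2 : Differentiable ℝ (fun x => u (op n a (dil n l x))) := h1.comp ho'
  rw [hd_const_mul _ (h2 g), hd_dil h1, hd_op hu]

lemma hGradSq_conf {u : QH n → ℝ} (hu : Differentiable ℝ u) (c l : ℝ) (a : QH n) (g : QH n) :
    hGradSq n (fun x => c * u (op n a (dil n l x))) g
      = c ^ 2 * l ^ 2 * hGradSq n u (op n a (dil n l g)) := by
  simp only [hGradSq_eq, hGrad, hd_conf hu, Finset.mul_sum]
  refine Finset.sum_congr rfl fun α _ => Finset.sum_congr rfl fun i _ => by ring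

lemma lintegral_of_integral_pos {X : Type*} [MeasurableSpace X] {ν : Measure X} {f : X → ℝ}
    {c : ℝ} (hc : 0 < c) (hf : 0 ≤ᵐ[ν] f) (h : ∫ x, f x ∂ν = c) :
    ∫⁻ x, ENNReal.ofReal (f x) ∂ν = ENNReal.ofReal c := by
  rw [← ofReal_integral_eq_lintegral_ofReal (.of_integral_ne_zero (h ▸ hc.ne')) hf, h]

lemma lintegral_rpow_mul_exp {a r : ℝ} (ha : 0 < a) (hr : 0 < r) :
    ∫⁻ t in Set.Ioi (0 : ℝ), ENNReal.ofReal (t ^ (a - 1) * exp (-(r * t)))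
      = ENNReal.ofReal (r ^ (-a) * Gamma a) := by
  refine lintegral_of_integral_pos (mul_pos (by positivity) (Gamma_pos_of_pos ha)) ?_ ?_
  · refine (ae_restrict_iff' measurableSet_Ioi).2 (Filter.Eventually.of_forall fun t ht => ?_)
    exact mul_nonneg (rpow_nonneg (le_of_lt ht) _) (exp_pos _).le
  · rw [integral_rpow_mul_exp_neg_mul_Ioi ha hr, one_div, inv_rpow hr.le, rpow_neg hr.le]

lemma lintegral_rpow_neg_of_gaussian {X : Type*} [MeasurableSpace X] {ν : Measure X} [SFinite ν]
    {ρ : X → ℝ} (hρ : Measurable ρ) (h0 : ∀ x, 0 ≤ ρ x) {d : ℝ}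
    (hG : ∀ s, 0 < s → ∫ x, exp (-(s * ρ x)) ∂ν = (π / s) ^ d) {A b : ℝ} (hA : 0 < A)
    (hd : 0 ≤ d) (hb : d < b) :
    ∫⁻ x, ENNReal.ofReal ((A + ρ x) ^ (-b)) ∂ν
      = ENNReal.ofReal (π ^ d * Gamma (b - d) / Gamma b * A ^ (d - b)) := by
  have hb0 : 0 < b := hd.trans_lt hb
  have hΓ : 0 < Gamma b := Gamma_pos_of_pos hb0
  have h1 : ∀ x, ENNReal.ofReal ((A + ρ x) ^ (-b)) = ENNReal.ofReal (Gamma b)⁻¹ *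
      ∫⁻ t in Set.Ioi (0 : ℝ), ENNReal.ofReal (t ^ (b - 1) * exp (-((A + ρ x) * t))) := by
    intro x
    rw [lintegral_rpow_mul_exp hb0 (by linarith [h0 x]), ← ENNReal.ofReal_mul (by positivity)]
    congr 1
    field_simp
  have h2 : ∀ t ∈ Set.Ioi (0 : ℝ),
      ∫⁻ x, ENNReal.ofReal (t ^ (b - 1) * exp (-((A + ρ x) * t))) ∂ν
      = ENNReal.ofReal (π ^ d) * ENNReal.ofReal (t ^ (b - d - 1) * exp (-(A * t))) := by
    intro t ht
    have ht : 0 < t := ht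
    have e : ∀ x, t ^ (b - 1) * exp (-((A + ρ x) * t))
        = (t ^ (b - 1) * exp (-(A * t))) * exp (-(t * ρ x)) := by
      intro x; rw [mul_assoc, ← exp_add]; congr 2; ring
    simp only [e]
    simp_rw [ENNReal.ofReal_mul (show 0 ≤ t ^ (b - 1) * exp (-(A * t)) by positivity)]
    rw [lintegral_const_mul _ (by fun_prop), lintegral_of_integral_pos (by positivity)
      (Filter.Eventually.of_forall fun x => (exp_pos _).le) (hG t ht),
      ← ENNReal.ofReal_mul (by positivity), ← ENNReal.ofReal_mul (by positivity)]
    congr 1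
    rw [div_rpow pi_pos.le ht.le, show b - d - 1 = (b - 1) - d by ring, rpow_sub ht (b - 1) d]
    ring
  simp only [h1]
  rw [lintegral_const_mul' _ _ ENNReal.ofReal_ne_top, lintegral_lintegral_swap (by fun_prop),
    setLIntegral_congr_fun measurableSet_Ioi h2, lintegral_const_mul' _ _ ENNReal.ofReal_ne_top,
    lintegral_rpow_mul_exp (by linarith) hA, ← ENNReal.ofReal_mul (by positivity),
    ← ENNReal.ofReal_mul (by positivity)]
  congr 1
  rw [show -(b - d) = d - b by ring]
  field_simp

lemma gaussian_one (s : ℝ) : ∫ x : ℝ, exp (-(s * x ^ 2)) = (π / s) ^ (1 / 2 : ℝ) := by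
  have := integral_gaussian s
  simp only [neg_mul] at this
  rw [this, sqrt_eq_rpow]

lemma gaussian_prod {X Y : Type*} [MeasureSpace X] [MeasureSpace Y]
    [SFinite (volume : Measure X)] [SFinite (volume : Measure Y)] {ρ : X → ℝ} {σ : Y → ℝ}
    {d d' s : ℝ} (hs : 0 < s)
    (h1 : ∫ x, exp (-(s * ρ x)) = (π / s) ^ d) (h2 : ∫ x, exp (-(s * σ x)) = (π / s) ^ d') :
    ∫ x : X × Y, exp (-(s * (ρ x.1 + σ x.2))) = (π / s) ^ (d + d') := by
  have := integral_prod_mul (μ := (volume : Measure X)) (ν := (volume : Measure Y))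
    (fun x => exp (-(s * ρ x))) (fun x => exp (-(s * σ x)))
  rw [h1, h2, ← rpow_add (by positivity)] at this
  rw [← this]
  simp only [← exp_add, Measure.volume_eq_prod]
  congr 1; ext x; congr 1; ring

lemma gaussian_triple {s : ℝ} (hs : 0 < s) :
    ∫ x : ℝ × ℝ × ℝ, exp (-(s * (x.1 ^ 2 + (x.2.1 ^ 2 + x.2.2 ^ 2)))) = (π / s) ^ (3 / 2 : ℝ) := by
  have := gaussian_prod hs (gaussian_one s) (gaussian_prod hs (gaussian_one s) (gaussian_one s))
  rw [this]; norm_num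

lemma gaussian_quad {s : ℝ} (hs : 0 < s) :
    ∫ x : ℝ × ℝ × ℝ × ℝ, exp (-(s * (x.1 ^ 2 + (x.2.1 ^ 2 + (x.2.2.1 ^ 2 + x.2.2.2 ^ 2)))))
      = (π / s) ^ (2 : ℝ) := by
  have := gaussian_prod hs (gaussian_one s) (gaussian_prod hs (gaussian_one s)
    (gaussian_prod hs (gaussian_one s) (gaussian_one s)))
  rw [this]; norm_num

lemma gaussian_pi {s : ℝ} (hs : 0 < s) :
    ∫ q : Fin n → ℝ × ℝ × ℝ × ℝ, exp (-(s * qSq n (q, 0))) = (π / s) ^ (2 * n : ℝ) := by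
  have := integral_fintype_prod_volume_eq_pow (ι := Fin n) (fun x : ℝ × ℝ × ℝ × ℝ =>
    exp (-(s * (x.1 ^ 2 + (x.2.1 ^ 2 + (x.2.2.1 ^ 2 + x.2.2.2 ^ 2))))))
  rw [gaussian_quad hs, Fintype.card_fin, ← rpow_mul_natCast (by positivity)] at this
  rw [← this]
  congr 1; ext q
  rw [← exp_sum]
  congr 1
  simp only [qSq, tC, xC, yC, zC, Finset.mul_sum, Finset.sum_neg_distrib]
  congr 1
  exact Finset.sum_congr rfl fun α _ => by ring

lemma lintegral_FF_rpow {b : ℝ} (hb : (n : ℝ) + 3 / 2 < b) :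
    ∫⁻ g : QH n, ENNReal.ofReal (FF n g ^ (-b))
      = ENNReal.ofReal (π ^ (3 / 2 : ℝ) * Gamma (b - 3 / 2) / Gamma b
        * (π ^ (2 * n : ℝ) * Gamma (2 * b - 3 - 2 * n) / Gamma (2 * b - 3))) := by
  have hn : (0 : ℝ) ≤ n := Nat.cast_nonneg n
  have hm : Measurable fun g : QH n => ENNReal.ofReal (FF n g ^ (-b)) :=
    (continuous_FF.measurable.pow_const _).ennreal_ofReal
  rw [Measure.volume_eq_prod, lintegral_prod _ hm.aemeasurable]
  have h1 : ∀ q : Fin n → ℝ × ℝ × ℝ × ℝ, ∫⁻ w : ℝ × ℝ × ℝ, ENNReal.ofReal (FF n (q, w) ^ (-b))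
      = ENNReal.ofReal (π ^ (3 / 2 : ℝ) * Gamma (b - 3 / 2) / Gamma b) *
        ENNReal.ofReal ((1 + qSq n (q, 0)) ^ (-(2 * b - 3))) := by
    intro q
    have hq : 0 < 1 + qSq n (q, 0) := by linarith [qSq_nonneg (n := n) (q, 0)]
    have := lintegral_rpow_neg_of_gaussian (ν := (volume : Measure (ℝ × ℝ × ℝ)))
      (ρ := fun x => x.1 ^ 2 + (x.2.1 ^ 2 + x.2.2 ^ 2)) (by fun_prop) (fun x => by positivity)
      (fun s hs => gaussian_triple hs) (A := (1 + qSq n (q, 0)) ^ 2) (b := b) (by positivity)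
      (by norm_num) (by linarith)
    have e : ∀ w : ℝ × ℝ × ℝ, FF n (q, w)
        = (1 + qSq n (q, 0)) ^ 2 + (w.1 ^ 2 + (w.2.1 ^ 2 + w.2.2 ^ 2)) := by
      intro w; simp only [FF, wSq, qSq]; ring
    simp only [e, this]
    rw [← ENNReal.ofReal_mul (by
      have := Gamma_pos_of_pos (show 0 < b - 3 / 2 by linarith)
      have := Gamma_pos_of_pos (show 0 < b by linarith)
      positivity)]
    congr 2
    rw [← rpow_natCast, ← rpow_mul hq.le]
    congr 1; push_cast; ring
  simp only [h1]
  have hρ : Continuous fun q : Fin n → ℝ × ℝ × ℝ × ℝ => qSq n (q, 0) :=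
    continuous_qSq.comp (by fun_prop)
  rw [lintegral_const_mul' _ _ ENNReal.ofReal_ne_top, lintegral_rpow_neg_of_gaussian hρ.measurable
    (fun q => qSq_nonneg _) (fun s hs => gaussian_pi hs) zero_lt_one (by positivity)
    (by linarith), one_rpow, mul_one, ← ENNReal.ofReal_mul]
  have := Gamma_pos_of_pos (show 0 < b - 3 / 2 by linarith)
  have := Gamma_pos_of_pos (show 0 < b by linarith)
  positivity

lemma integrable_FF_rpow {b : ℝ} (hb : (n : ℝ) + 3 / 2 < b) :
    Integrable fun g : QH n => FF n g ^ (-b) := by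
  refine ⟨(continuous_FF.measurable.pow_const _).aestronglyMeasurable, ?_⟩
  rw [hasFiniteIntegral_iff_ofReal (Filter.Eventually.of_forall fun g =>
    rpow_nonneg (FF_pos g).le _), lintegral_FF_rpow hb]
  exact ENNReal.ofReal_lt_top

lemma integrable_inv_FF_pow {k : ℕ} (hk : n + 2 ≤ k) :
    Integrable fun g : QH n => ((FF n g)⁻¹) ^ k := by
  have hk' : (n : ℝ) + 2 ≤ k := by exact_mod_cast hk
  have := integrable_FF_rpow (n := n) (b := k) (by linarith)
  refine this.congr (Filter.Eventually.of_forall fun g => ?_)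
  change FF n g ^ (-(k : ℝ)) = (FF n g)⁻¹ ^ k
  rw [rpow_neg (FF_pos g).le, rpow_natCast, inv_pow]

lemma integral_inv_FF_pow : ∫ g : QH n, ((FF n g)⁻¹) ^ (2 * n + 3)
    = 2 * π ^ (2 * n + 2) / (2 * n + 1).factorial / 2 ^ (4 * n + 3) := by
  have hn : (0 : ℝ) ≤ n := Nat.cast_nonneg n
  have e : ∀ g : QH n, ((FF n g)⁻¹) ^ (2 * n + 3) = FF n g ^ (-(2 * n + 3 : ℝ)) := by
    intro g
    rw [rpow_neg (FF_pos g).le, inv_pow, ← rpow_natCast]; push_cast; rfl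
  simp only [e]
  rw [integral_eq_lintegral_of_nonneg_ae (Filter.Eventually.of_forall fun g =>
    rpow_nonneg (FF_pos g).le _) (continuous_FF.measurable.pow_const _).aestronglyMeasurable,
    lintegral_FF_rpow (by linarith)]
  have g1 : 0 < Gamma (2 * n + 3 / 2 : ℝ) := Gamma_pos_of_pos (by linarith)
  have g2 := Gamma_mul_Gamma_add_half (2 * n + 3 / 2 : ℝ)
  have e1 : (2 * n + 3 / 2 : ℝ) + 1 / 2 = ((2 * n + 1 : ℕ) : ℝ) + 1 := by push_cast; ring
  have e2 : 2 * (2 * n + 3 / 2 : ℝ) = ((4 * n + 2 : ℕ) : ℝ) + 1 := by push_cast; ring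
  have e3 : (2 * n + 3 : ℝ) = ((2 * n + 2 : ℕ) : ℝ) + 1 := by push_cast; ring
  have e4 : 2 * (2 * n + 3 : ℝ) - 3 - 2 * n = ((2 * n + 2 : ℕ) : ℝ) + 1 := by push_cast; ring
  have e5 : 2 * (2 * n + 3 : ℝ) - 3 = ((4 * n + 2 : ℕ) : ℝ) + 1 := by push_cast; ring
  have e6 : (2 * n + 3 : ℝ) - 3 / 2 = 2 * n + 3 / 2 := by ring
  have e7 : (2 : ℝ) ^ (1 - 2 * (2 * n + 3 / 2 : ℝ)) = (2 ^ (4 * n + 2))⁻¹ := by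
    rw [← rpow_natCast, ← rpow_neg zero_le_two]; congr 1; push_cast; ring
  rw [e1, e7, e2, Gamma_nat_eq_factorial, Gamma_nat_eq_factorial] at g2
  rw [e4, e5, e6, e3, Gamma_nat_eq_factorial, Gamma_nat_eq_factorial,
    ENNReal.toReal_ofReal (by positivity)]
  have f1 : (0 : ℝ) < (2 * n + 1).factorial := by positivity
  have f2 : (0 : ℝ) < (4 * n + 2).factorial := by positivity
  have f3 : (0 : ℝ) < (2 * n + 2).factorial := by positivity
  have p1 : π ^ (3 / 2 : ℝ) * √π = π ^ 2 := by
    rw [sqrt_eq_rpow, ← rpow_add pi_pos]; norm_num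
  have p2 : π ^ (2 * n : ℝ) = π ^ (2 * n) := by
    rw [← rpow_natCast]; push_cast; rfl
  rw [p2]
  have g3 : Gamma (2 * n + 3 / 2 : ℝ) = (4 * n + 2).factorial * (2 ^ (4 * n + 2))⁻¹ * √π
      / (2 * n + 1).factorial := by
    rw [eq_div_iff f1.ne']; exact g2
  rw [g3]
  calc _ = (π ^ (3 / 2 : ℝ) * √π) * π ^ (2 * n) * (2 ^ (4 * n + 2))⁻¹ / (2 * n + 1).factorial := by
        field_simp
    _ = _ := by rw [p1]; field_simp; ring

lemma qSq_dil (l : ℝ) (g : QH n) : qSq n (dil n l g) = l ^ 2 * qSq n g := by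
  simp only [qSq, dil, tC, xC, yC, zC, Finset.mul_sum]
  exact Finset.sum_congr rfl fun α _ => by ring

lemma wSq_dil (l : ℝ) (g : QH n) : wSq n (dil n l g) = l ^ 4 * wSq n g := by
  simp only [wSq, dil]; ring

lemma norm_le_FF (g : QH n) : ‖g‖ ≤ FF n g := by
  have hq := qSq_nonneg g
  have hw := wSq_nonneg g
  have key : ∀ x : ℝ, x ^ 2 ≤ FF n g → ‖x‖ ≤ FF n g := by
    intro x hx
    rw [Real.norm_eq_abs]
    have h1 := one_le_FF g
    exact abs_le_of_sq_le_sq (hx.trans (by nlinarith)) (by linarith)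
  have hqF : qSq n g ≤ FF n g := by unfold FF; nlinarith
  have hwF : wSq n g ≤ FF n g := by unfold FF; nlinarith
  have hα : ∀ α, (tC (g.1 α)) ^ 2 + (xC (g.1 α)) ^ 2 + (yC (g.1 α)) ^ 2 + (zC (g.1 α)) ^ 2
      ≤ FF n g := fun α => le_trans (Finset.single_le_sum (f := fun α => (tC (g.1 α)) ^ 2
        + (xC (g.1 α)) ^ 2 + (yC (g.1 α)) ^ 2 + (zC (g.1 α)) ^ 2)
        (fun i _ => by positivity) (Finset.mem_univ α)) hqF
  unfold wSq at hwF
  have p := fun x : ℝ => sq_nonneg x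
  refine max_le ((pi_norm_le_iff_of_nonneg (FF_pos g).le).2 fun α => ?_) ?_
  · have := hα α
    simp only [tC, xC, yC, zC] at this
    have := p (g.1 α).1; have := p (g.1 α).2.1; have := p (g.1 α).2.2.1
    have := p (g.1 α).2.2.2
    exact max_le (key _ (by linarith)) (max_le (key _ (by linarith))
      (max_le (key _ (by linarith)) (key _ (by linarith))))
  · have := p g.2.1; have := p g.2.2.1; have := p g.2.2.2
    exact max_le (key _ (by linarith)) (max_le (key _ (by linarith)) (key _ (by linarith)))

lemma isCompact_FF_le (R : ℝ) : IsCompact {g : QH n | FF n g ≤ R} :=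
  Metric.isCompact_of_isClosed_isBounded (isClosed_le continuous_FF continuous_const)
    ((Metric.isBounded_closedBall (x := 0) (r := R)).subset fun g hg => by
      simpa using (norm_le_FF g).trans hg)

/-- The pullback of `F` under the composition of the left translation by `b` with the dilation
of factor `e ^ s`, normalised by the conformal factor. -/
noncomputable def KK (b : QH n) (s : ℝ) (g : QH n) : ℝ :=
  exp (-2 * s) * FF n (dil n (exp s) (op n b g))

lemma KK_pos (b : QH n) (s : ℝ) (g : QH n) : 0 < KK b s g := mul_pos (exp_pos _) (FF_pos _)

lemma KK_eq (b : QH n) (s : ℝ) (g : QH n) : KK b s g = exp (-2 * s) + 2 * qSq n (op n b g)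
    + exp (2 * s) * (qSq n (op n b g) ^ 2 + wSq n (op n b g)) := by
  have h1 : exp (-2 * s) = (exp s ^ 2)⁻¹ := by
    rw [← exp_nat_mul, ← exp_neg]; congr 1; push_cast; ring
  have h2 : exp (2 * s) = exp s ^ 2 := by rw [← exp_nat_mul]; congr 1
  have := exp_pos s
  unfold KK FF
  rw [qSq_dil, wSq_dil, h1, h2]
  field_simp
  ring

lemma continuous_KK : Continuous fun x : (QH n × ℝ) × QH n => KK x.1.1 x.1.2 x.2 := by
  unfold KK; fun_prop

lemma continuous_log_KK : Continuous fun x : (QH n × ℝ) × QH n => log (KK x.1.1 x.1.2 x.2) :=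
  continuous_KK.log fun _ => (KK_pos _ _ _).ne'

lemma continuous_log_KK' (b : QH n) (s : ℝ) : Continuous fun g => log (KK b s g) :=
  continuous_log_KK.comp (f := fun g => ((b, s), g)) (by fun_prop)

lemma integral_inv_FF_pow_pos {k : ℕ} (hk : n + 2 ≤ k) :
    0 < ∫ g : QH n, ((FF n g)⁻¹) ^ k := by
  have hp : ∀ g : QH n, 0 < ((FF n g)⁻¹) ^ k := fun g => pow_pos (inv_pos.2 (FF_pos g)) _
  rw [integral_pos_iff_support_of_nonneg (fun g => (hp g).le) (integrable_inv_FF_pow hk)]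
  have : Function.support (fun g : QH n => ((FF n g)⁻¹) ^ k) = Set.univ :=
    Set.eq_univ_of_forall fun g => (hp g).ne'
  rw [this]
  exact isOpen_univ.measure_pos volume Set.univ_nonempty

lemma integral_KK_inv_pow (b : QH n) (s : ℝ) :
    ∫ g, ((KK b s g)⁻¹) ^ (2 * n + 2)
      = exp (-2 * s) * ∫ g : QH n, ((FF n g)⁻¹) ^ (2 * n + 2) := by
  have h1 : ∀ g, ((KK b s g)⁻¹) ^ (2 * n + 2) = exp (2 * s) ^ (2 * n + 2) *
      ((FF n (dil n (exp s) (op n b g)))⁻¹) ^ (2 * n + 2) := by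
    intro g
    rw [KK, mul_inv, mul_pow, ← exp_neg]; congr 3; ring
  simp only [h1]
  rw [integral_const_mul,
    integral_op_left b (fun g => ((FF n (dil n (exp s) g))⁻¹) ^ (2 * n + 2)),
    integral_dil (exp_pos s) (fun g => ((FF n g)⁻¹) ^ (2 * n + 2)), ← mul_assoc]
  congr 1
  rw [← exp_nat_mul, ← exp_nat_mul, ← exp_neg, ← exp_add]
  congr 1; push_cast; ring

lemma integrable_KK_inv_pow (b : QH n) (s : ℝ) :
    Integrable fun g => ((KK b s g)⁻¹) ^ (2 * n + 2) := by
  refine .of_integral_ne_zero ?_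
  rw [integral_KK_inv_pow]
  exact ne_of_gt (mul_pos (exp_pos _) (integral_inv_FF_pow_pos (by omega)))

/-- The averaged logarithm of the conformal factor attains its minimum. -/
lemma exists_min_log_KK {m : QH n → ℝ} (hm : Continuous m) (hc : HasCompactSupport m)
    (h0 : ∀ g, 0 ≤ m g) (h1 : ∫ g, m g = 1) :
    ∃ b s, ∀ b' s', ∫ g, log (KK b s g) * m g ≤ ∫ g, log (KK b' s' g) * m g := by
  have him : Integrable m := hm.integrable_of_hasCompactSupport hc
  have h_int : ∀ {f : QH n → ℝ}, Continuous f → Integrable fun g => f g * m g := fun hf =>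
    (hf.mul hm).integrable_of_hasCompactSupport hc.mul_left
  set Φ : QH n × ℝ → ℝ := fun x => ∫ g, log (KK x.1 x.2 g) * m g with hΦ
  have hΦc : Continuous Φ := by
    have hcont : Continuous (Function.uncurry fun (x : QH n × ℝ) g => log (KK x.1 x.2 g) * m g) :=
      continuous_log_KK.mul (hm.comp continuous_snd)
    have := continuous_parametric_integral_of_continuous (μ := volume) hcont hc.isCompact
    refine this.congr fun x => ?_
    exact setIntegral_eq_integral_of_forall_compl_eq_zero fun g hg => by
      rw [image_eq_zero_of_notMem_tsupport hg, mul_zero]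
  have hlow : ∀ (x : QH n × ℝ) (c : ℝ), (∀ g ∈ tsupport m, c ≤ log (KK x.1 x.2 g)) → c ≤ Φ x := by
    intro x c h
    rw [← mul_one c, ← h1, ← integral_const_mul]
    refine integral_mono (him.const_mul c) (h_int (continuous_log_KK' _ _)) fun g => ?_
    by_cases hg : g ∈ tsupport m
    · exact mul_le_mul_of_nonneg_right (h g hg) (h0 g)
    · simp [image_eq_zero_of_notMem_tsupport hg]
  have hs1 : ∀ x, -2 * x.2 ≤ Φ x := fun x => hlow x _ fun g _ => by
    rw [← log_exp (-2 * x.2)]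
    refine log_le_log (exp_pos _) ?_
    rw [KK_eq]
    have := qSq_nonneg (op n x.1 g)
    have := wSq_nonneg (op n x.1 g)
    have : 0 ≤ exp (2 * x.2) * (qSq n (op n x.1 g) ^ 2 + wSq n (op n x.1 g)) := by positivity
    linarith
  obtain ⟨M, hM⟩ := hc.exists_bound_of_continuous hm
  set I := ∫ g : QH n, ((FF n g)⁻¹) ^ (2 * n + 2)
  have hI : 0 < I := integral_inv_FF_pow_pos (by omega)
  set C := (max M 1) * I
  have hC : 0 < C := by positivity
  have hs2 : ∀ x, 2 * x.2 - log C ≤ (2 * n + 2 : ℝ) * Φ x := by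
    intro x
    have hpt : ∀ g, (1 + 2 * x.2 - log C) * m g
        - C⁻¹ * exp (2 * x.2) * (((KK x.1 x.2 g)⁻¹) ^ (2 * n + 2) * m g)
        ≤ (2 * n + 2 : ℝ) * (log (KK x.1 x.2 g) * m g) := by
      intro g
      have hK := KK_pos x.1 x.2 g
      have := one_sub_inv_le_log_of_pos (x := (KK x.1 x.2 g) ^ (2 * n + 2) * (C * exp (-2 * x.2)))
        (by positivity)
      rw [log_mul (by positivity) (by positivity), log_mul hC.ne' (exp_pos _).ne', log_exp,
        log_pow, mul_inv, mul_inv, ← exp_neg, ← inv_pow] at this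
      push_cast at this
      rw [show -(-2 * x.2) = 2 * x.2 by ring] at this
      have := mul_le_mul_of_nonneg_right this (h0 g)
      linarith
    have hK : Continuous fun g => ((KK x.1 x.2 g)⁻¹) ^ (2 * n + 2) :=
      ((continuous_KK.comp (f := fun g => (x, g)) (by fun_prop)).inv₀
        fun g => (KK_pos _ _ _).ne').pow _
    have hi1 := him.const_mul (1 + 2 * x.2 - log C)
    have hi2 := (h_int hK).const_mul (C⁻¹ * exp (2 * x.2))
    have := integral_mono (hi1.sub hi2)
      ((h_int (continuous_log_KK' x.1 x.2)).const_mul (2 * n + 2 : ℝ)) hpt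
    simp only [Pi.sub_apply] at this
    rw [integral_sub hi1 hi2, integral_const_mul, integral_const_mul, integral_const_mul, h1] at this
    have h3 : ∫ g, ((KK x.1 x.2 g)⁻¹) ^ (2 * n + 2) * m g ≤ exp (-2 * x.2) * C := by
      have : exp (-2 * x.2) * C = ∫ g, ((KK x.1 x.2 g)⁻¹) ^ (2 * n + 2) * max M 1 := by
        rw [integral_mul_const, integral_KK_inv_pow]; ring
      rw [this]
      refine integral_mono (h_int hK) ((integrable_KK_inv_pow _ _).mul_const _) fun g => ?_
      refine mul_le_mul_of_nonneg_left ?_ (pow_nonneg (inv_nonneg.2 (KK_pos _ _ _).le) _)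
      exact (le_abs_self _).trans ((hM g).trans (le_max_left _ _))
    have h4 : C⁻¹ * exp (2 * x.2) * ∫ g, ((KK x.1 x.2 g)⁻¹) ^ (2 * n + 2) * m g ≤ 1 := by
      calc _ ≤ C⁻¹ * exp (2 * x.2) * (exp (-2 * x.2) * C) := by gcongr
        _ = (exp (2 * x.2) * exp (-2 * x.2)) * (C⁻¹ * C) := by ring
        _ = 1 := by rw [← exp_add, inv_mul_cancel₀ hC.ne']; simp
    linarith
  set c₀ := Φ (0, 0)
  have hbdd : Bornology.IsBounded {x : QH n × ℝ | Φ x ≤ Φ (0, 0)} := by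
    set A := -c₀ / 2
    set B := ((2 * n + 2 : ℝ) * c₀ + log C) / 2
    set R := exp (2 * max |A| |B|) * exp (c₀ + 1)
    have hcomp : IsCompact (((fun x : QH n × QH n => op n x.1 (-x.2)) ''
        ({g : QH n | FF n g ≤ R} ×ˢ tsupport m)) ×ˢ Set.Icc A B) :=
      (((isCompact_FF_le R).prod hc.isCompact).image (by fun_prop)).prod isCompact_Icc
    refine hcomp.isBounded.subset fun x hx => ?_
    have hx : Φ x ≤ c₀ := hx
    have hA : A ≤ x.2 := by have := hs1 x; simp only [A]; linarith
    have hB : x.2 ≤ B := by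
      have := hs2 x
      have : (2 * n + 2 : ℝ) * Φ x ≤ (2 * n + 2 : ℝ) * c₀ := by gcongr
      simp only [B]; linarith
    refine ⟨?_, hA, hB⟩
    have : ∃ g ∈ tsupport m, log (KK x.1 x.2 g) < c₀ + 1 := by
      by_contra! hcon
      have := hlow x _ hcon
      linarith
    obtain ⟨g, hg, hlog⟩ := this
    refine ⟨(op n x.1 g, g), ⟨?_, hg⟩, ?_⟩
    · have hK : KK x.1 x.2 g ≤ exp (c₀ + 1) := by
        rw [← exp_log (KK_pos x.1 x.2 g)]; exact exp_le_exp.2 hlog.le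
      have habs : |x.2| ≤ max |A| |B| := abs_le_max_abs_abs hA hB
      have : FF n (op n x.1 g) ≤ exp (2 * max |A| |B|) * KK x.1 x.2 g := by
        rw [KK_eq]
        set E := exp (2 * max |A| |B|)
        have hq := qSq_nonneg (op n x.1 g)
        have hw := wSq_nonneg (op n x.1 g)
        have e0 : 1 ≤ E := one_le_exp (by positivity)
        have e1 : 1 ≤ E * exp (-2 * x.2) := by
          rw [← exp_add]; exact one_le_exp (by linarith [le_abs_self x.2])
        have e2 : 1 ≤ E * exp (2 * x.2) := by
          rw [← exp_add]; exact one_le_exp (by linarith [neg_abs_le x.2])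
        have f1 : 0 ≤ (E - 1) * (2 * qSq n (op n x.1 g)) := by
          apply mul_nonneg <;> linarith
        have f2 : 0 ≤ (E * exp (2 * x.2) - 1) * (qSq n (op n x.1 g) ^ 2 + wSq n (op n x.1 g)) := by
          apply mul_nonneg
          · linarith
          · positivity
        unfold FF
        linarith
      exact this.trans (mul_le_mul_of_nonneg_left hK (exp_pos _).le)
    · simp only [op_assoc, op_neg_self, op_zero]
  obtain ⟨x, hx⟩ := hΦc.exists_forall_le_of_isBounded (0, 0) hbdd
  exact ⟨x.1, x.2, fun b' s' => hx (b', s')⟩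

lemma qSq_op_single (α : Fin n) (e : ℝ × ℝ × ℝ × ℝ) (s : ℝ) (h : QH n) :
    qSq n (op n (s • Pi.single α e, 0) h)
      = qSq n h + 2 * s * qdot e (h.1 α) + s ^ 2 * qdot e e := by
  rw [qSq_eq, qSq_eq, add_assoc, ← sub_eq_iff_eq_add', ← Finset.sum_sub_distrib]
  rw [Finset.sum_eq_single α]
  · simp [op_eq, qdot, tC, xC, yC, zC]; ring
  · intro β _ hβ
    simp [op_eq, hβ]
  · simp

lemma wSq_op_single (α : Fin n) (e : ℝ × ℝ × ℝ × ℝ) (s : ℝ) (h : QH n) :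
    wSq n (op n (s • Pi.single α e, 0) h)
      = wSq n h - 4 * s * (h.2.1 * imI (h.1 α) e + h.2.2.1 * imJ (h.1 α) e
        + h.2.2.2 * imK (h.1 α) e)
        + 4 * s ^ 2 * (imI (h.1 α) e ^ 2 + imJ (h.1 α) e ^ 2 + imK (h.1 α) e ^ 2) := by
  rw [op_eq]
  simp only [imB_smul_left]
  rw [imB_comm, imB_single]
  simp [wSq]; ring

lemma FF_op_center (θ : ℝ × ℝ × ℝ) (h : QH n) :
    FF n (op n (0, θ) h) = FF n h
      + 2 * (h.2.1 * θ.1 + h.2.2.1 * θ.2.1 + h.2.2.2 * θ.2.2)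
      + (θ.1 ^ 2 + θ.2.1 ^ 2 + θ.2.2 ^ 2) := by
  have : imB 0 h.1 = 0 := by simpa using imB_smul_left 0 0 h.1
  simp only [op_eq, this, FF, qSq, wSq, zero_add, add_zero, Prod.fst_add, Prod.snd_add]
  ring

/-- First variation of `F` along one-parameter families of conformal transformations. -/
lemma exists_variation (j : (Fin n × Fin 4) ⊕ Fin 4) :
    ∃ c : ℝ, c ≠ 0 ∧ ∃ M : QH n → ℝ, Continuous M ∧ ∀ s : ℝ, |s| ≤ 1 / 2 →
      ∃ (b : QH n) (σ κ : ℝ), 0 < σ ∧ 0 < κ ∧ ∀ h,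
        κ * ((σ ^ 2)⁻¹ * FF n (dil n σ (op n b h)) - FF n h) ≤ s * (c * eta j h) + s ^ 2 * M h := by
  have hcen : ∀ (j : (Fin n × Fin 4) ⊕ Fin 4) (θ : ℝ × ℝ × ℝ),
      θ.1 ^ 2 + θ.2.1 ^ 2 + θ.2.2 ^ 2 = 1 →
      (∀ h : QH n, eta j h = 2 * (h.2.1 * θ.1 + h.2.2.1 * θ.2.1 + h.2.2.2 * θ.2.2)) →
      ∃ c : ℝ, c ≠ 0 ∧ ∃ M : QH n → ℝ, Continuous M ∧ ∀ s : ℝ, |s| ≤ 1 / 2 →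
      ∃ (b : QH n) (σ κ : ℝ), 0 < σ ∧ 0 < κ ∧ ∀ h,
        κ * ((σ ^ 2)⁻¹ * FF n (dil n σ (op n b h)) - FF n h)
          ≤ s * (c * eta j h) + s ^ 2 * M h := by
    intro j θ hθ he
    refine ⟨1, one_ne_zero, fun _ => 1, continuous_const, fun s _ =>
      ⟨(0, s • θ), 1, 1, one_pos, one_pos, fun h => le_of_eq ?_⟩⟩
    rw [dil_one, FF_op_center, he]
    simp only [Prod.smul_fst, Prod.smul_snd, smul_eq_mul]
    linear_combination s ^ 2 * hθ
  match j with
  | Sum.inl (α, i) =>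
    refine ⟨2, two_ne_zero, fun h => 2 * (1 + qSq n h) + 8 * qdot (qb i) (h.1 α) ^ 2 + 2
      + 4 * (imI (h.1 α) (qb i) ^ 2 + imJ (h.1 α) (qb i) ^ 2 + imK (h.1 α) (qb i) ^ 2), ?_,
      fun s hs => ⟨(s • Pi.single α (qb i), 0), 1, 1, one_pos, one_pos, fun h => ?_⟩⟩
    · unfold qdot imI imJ imK tC xC yC zC qSq tC xC yC zC; fun_prop
    have he : qdot (qb i) (qb i) = 1 := by fin_cases i <;> simp [qb, qdot, tC, xC, yC, zC]
    have hlin : 4 * (1 + qSq n h) * qdot (qb i) (h.1 α)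
        - 4 * (h.2.1 * imI (h.1 α) (qb i) + h.2.2.1 * imJ (h.1 α) (qb i)
        + h.2.2.2 * imK (h.1 α) (qb i)) = 2 * eta (Sum.inl (α, i)) h := by
      fin_cases i <;>
        simp [qb, qdot, tC, xC, yC, zC, imI, imJ, imK, eta, qmul] <;> ring
    rw [dil_one]
    unfold FF
    rw [qSq_op_single, wSq_op_single, he]
    set d := qdot (qb i) (h.1 α)
    have hs2 : s ^ 2 ≤ 1 := by
      rw [← sq_abs]; nlinarith [abs_nonneg s]
    have : s ^ 2 * (2 * d + s) ^ 2 ≤ s ^ 2 * (8 * d ^ 2 + 2) := by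
      refine mul_le_mul_of_nonneg_left ?_ (sq_nonneg s)
      nlinarith [sq_nonneg (2 * d - s)]
    linear_combination this + s * hlin
  | Sum.inr 0 =>
    refine ⟨-1, by norm_num, fun h => qSq n h ^ 2 + wSq n h, ?_,
      fun s hs => ⟨0, √(1 + s), 1 + s, ?_, ?_, fun h => le_of_eq ?_⟩⟩
    · unfold qSq wSq tC xC yC zC; fun_prop
    · exact sqrt_pos.2 (by linarith [neg_abs_le s])
    · linarith [neg_abs_le s]
    have h1 : 0 < 1 + s := by linarith [neg_abs_le s]
    rw [zero_op]
    unfold FF eta FF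
    rw [qSq_dil, wSq_dil, show √(1 + s) ^ 4 = (√(1 + s) ^ 2) ^ 2 by ring, sq_sqrt h1.le]
    field_simp
    ring
  | Sum.inr 1 => exact hcen _ (1, 0, 0) (by norm_num) fun h => by simp [eta]
  | Sum.inr 2 => exact hcen _ (0, 1, 0) (by norm_num) fun h => by simp [eta]
  | Sum.inr 3 => exact hcen _ (0, 0, 1) (by norm_num) fun h => by simp [eta]

lemma eq_zero_of_linear_add_sq_nonneg {a M : ℝ} (h : ∀ s : ℝ, |s| ≤ 1 / 2 → 0 ≤ s * a + s ^ 2 * M) :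
    a = 0 := by
  by_contra ha
  have hK : 0 < |a| + |M| + 1 := by positivity
  set K := |a| + |M| + 1
  have ha' := abs_pos.2 ha
  have h1 := h (-a / (2 * K)) (by
    rw [abs_div, abs_neg, abs_of_pos (by positivity : 0 < 2 * K), div_le_div_iff₀ (by positivity) two_pos]
    have := abs_nonneg M
    simp only [K]; linarith)
  have h2 : -a / (2 * K) * a + (-a / (2 * K)) ^ 2 * M = a ^ 2 / (4 * K ^ 2) * (M - 2 * K) := by
    field_simp
    ring
  rw [h2] at h1
  have h3 : M - 2 * K < 0 := by
    have := le_abs_self M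
    have := abs_nonneg M
    simp only [K]; linarith
  have h4 : 0 < a ^ 2 / (4 * K ^ 2) := by positivity
  nlinarith

lemma KK_comp (b₀ b' : QH n) (s₀ : ℝ) {σ : ℝ} (hσ : 0 < σ) (g : QH n) :
    KK (op n (dil n (exp (-s₀)) b') b₀) (s₀ + log σ) g
      = exp (-2 * s₀) * ((σ ^ 2)⁻¹ * FF n (dil n σ (op n b' (dil n (exp s₀) (op n b₀ g))))) := by
  have h1 : dil n (exp (s₀ + log σ)) (op n (op n (dil n (exp (-s₀)) b') b₀) g)
      = dil n σ (op n b' (dil n (exp s₀) (op n b₀ g))) := by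
    rw [op_assoc, dil_op, dil_op σ, dil_dil, dil_dil, exp_add, exp_log hσ]
    congr 2
    · rw [mul_right_comm, ← exp_add]; simp
    · rw [mul_comm]
  have h2 : exp (-2 * (s₀ + log σ)) = exp (-2 * s₀) * (σ ^ 2)⁻¹ := by
    rw [mul_add, exp_add]
    congr 1
    rw [neg_mul, exp_neg, show 2 * log σ = log (σ ^ 2) by rw [log_pow]; norm_num,
      exp_log (by positivity)]
  rw [KK, h1, h2, mul_assoc]

/-- Every probability density can be balanced by a conformal transformation. -/
lemma exists_balanced {m : QH n → ℝ} (hm : Continuous m) (hc : HasCompactSupport m)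
    (h0 : ∀ g, 0 ≤ m g) (h1 : ∫ g, m g = 1) :
    ∃ (b : QH n) (s : ℝ), ∀ j, ∫ g, xi j (dil n (exp s) (op n b g)) * m g = 0 := by
  obtain ⟨b₀, s₀, hmin⟩ := exists_min_log_KK hm hc h0 h1
  refine ⟨b₀, s₀, fun j => ?_⟩
  have h_int : ∀ {f : QH n → ℝ}, Continuous f → Integrable fun g => f g * m g := fun hf =>
    (hf.mul hm).integrable_of_hasCompactSupport hc.mul_left
  obtain ⟨c, hc0, M, hM, hvar⟩ := exists_variation j
  have hT : Continuous fun g : QH n => dil n (exp s₀) (op n b₀ g) := by fun_prop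
  set T := fun g : QH n => dil n (exp s₀) (op n b₀ g) with hTdef
  have hxi : Continuous fun g => xi j (T g) := (contDiff_xi (k := 0) j).continuous.comp hT
  have hMF : Continuous fun g => M (T g) * (FF n (T g))⁻¹ :=
    (hM.comp hT).mul (continuous_inv_FF.comp hT)
  suffices h : c * ∫ g, xi j (T g) * m g = 0 by
    exact (mul_eq_zero.1 h).resolve_left hc0
  refine eq_zero_of_linear_add_sq_nonneg (M := ∫ g, M (T g) * (FF n (T g))⁻¹ * m g) fun s hs => ?_
  obtain ⟨b', σ, κ, hσ, hκ, hle⟩ := hvar s hs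
  set b₁ := op n (dil n (exp (-s₀)) b') b₀
  set s₁ := s₀ + log σ
  have hpt : ∀ g, κ * (log (KK b₁ s₁ g) * m g - log (KK b₀ s₀ g) * m g)
      ≤ s * c * (xi j (T g) * m g) + s ^ 2 * (M (T g) * (FF n (T g))⁻¹ * m g) := by
    intro g
    have hF := FF_pos (T g)
    have hF' := FF_pos (dil n σ (op n b' (T g)))
    have hK1 : KK b₁ s₁ g = exp (-2 * s₀) * ((σ ^ 2)⁻¹ * FF n (dil n σ (op n b' (T g)))) :=
      KK_comp b₀ b' s₀ hσ g
    have hK0 : KK b₀ s₀ g = exp (-2 * s₀) * FF n (T g) := rfl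
    have hl : log (KK b₁ s₁ g) - log (KK b₀ s₀ g)
        ≤ ((σ ^ 2)⁻¹ * FF n (dil n σ (op n b' (T g))) - FF n (T g)) * (FF n (T g))⁻¹ := by
      rw [← log_div (KK_pos _ _ _).ne' (KK_pos _ _ _).ne', hK1, hK0,
        mul_div_mul_left _ _ (exp_pos _).ne']
      refine (log_le_sub_one_of_pos (by positivity)).trans (le_of_eq ?_)
      field_simp
    calc κ * (log (KK b₁ s₁ g) * m g - log (KK b₀ s₀ g) * m g)
        = κ * (log (KK b₁ s₁ g) - log (KK b₀ s₀ g)) * m g := by ring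
      _ ≤ κ * (((σ ^ 2)⁻¹ * FF n (dil n σ (op n b' (T g))) - FF n (T g)) * (FF n (T g))⁻¹) * m g :=
          mul_le_mul_of_nonneg_right (mul_le_mul_of_nonneg_left hl hκ.le) (h0 g)
      _ = κ * ((σ ^ 2)⁻¹ * FF n (dil n σ (op n b' (T g))) - FF n (T g))
          * ((FF n (T g))⁻¹ * m g) := by ring
      _ ≤ (s * (c * eta j (T g)) + s ^ 2 * M (T g)) * ((FF n (T g))⁻¹ * m g) :=
          mul_le_mul_of_nonneg_right (hle _) (mul_nonneg (inv_pos.2 hF).le (h0 g))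
      _ = _ := by unfold xi; ring
  have hi1 := h_int (continuous_log_KK' b₁ s₁)
  have hi0 := h_int (continuous_log_KK' b₀ s₀)
  have := integral_mono ((hi1.sub hi0).const_mul κ)
    (((h_int hxi).const_mul (s * c)).add ((h_int hMF).const_mul (s ^ 2))) hpt
  simp only [Pi.sub_apply, Pi.add_apply] at this
  rw [integral_const_mul, integral_sub hi1 hi0,
    integral_add ((h_int hxi).const_mul (s * c)) ((h_int hMF).const_mul (s ^ 2)),
    integral_const_mul, integral_const_mul] at this
  have h2 := mul_nonneg hκ.le (sub_nonneg.2 (hmin b₁ s₁))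
  linarith

/-- The critical Sobolev exponent `2Q / (Q - 2)`. -/
noncomputable def pe (n : ℕ) : ℝ := (2 * n + 3) / (n + 1)

lemma pe_mul (n : ℕ) : pe n * (n + 1) = 2 * n + 3 := by unfold pe; field_simp

lemma two_lt_pe (n : ℕ) : 2 < pe n := by unfold pe; rw [lt_div_iff₀] <;> [linarith; positivity]

lemma pe_pos (n : ℕ) : 0 < pe n := two_pos.trans (two_lt_pe n)

/-- Smooth nonnegative compactly supported functions. -/
structure Test (v : QH n → ℝ) : Prop where
  smooth : ContDiff ℝ (⊤ : ℕ∞) v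
  compact : HasCompactSupport v
  nonneg : ∀ g, 0 ≤ v g

lemma Test.continuous_rpow {v : QH n → ℝ} (hv : Test v) {r : ℝ} (hr : 0 ≤ r) :
    Continuous fun g => v g ^ r := hv.smooth.continuous.rpow_const fun _ => Or.inr hr

lemma Test.compact_rpow {v : QH n → ℝ} (hv : Test v) {r : ℝ} (hr : r ≠ 0) :
    HasCompactSupport fun g => v g ^ r :=
  hv.compact.comp_left (g := fun x : ℝ => x ^ r) (zero_rpow hr)

lemma Test.integrable_mul_rpow {v f : QH n → ℝ} (hv : Test v) (hf : Continuous f) {r : ℝ}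
    (hr : 0 < r) : Integrable fun g => f g * v g ^ r :=
  (hf.mul (hv.continuous_rpow hr.le)).integrable_of_hasCompactSupport
    (hv.compact_rpow hr.ne').mul_left

lemma Test.integrable_rpow {v : QH n → ℝ} (hv : Test v) {r : ℝ}
    (hr : 0 < r) : Integrable fun g => v g ^ r := by
  simpa using hv.integrable_mul_rpow (f := fun _ => 1) continuous_const hr

/-- The conformal action on test functions. -/
noncomputable def conf (a : QH n) (l : ℝ) (v : QH n → ℝ) (g : QH n) : ℝ :=
  l ^ (2 * n + 2) * v (op n a (dil n l g))

lemma test_conf {v : QH n → ℝ} (hv : Test v) (a : QH n) {l : ℝ} (hl : 0 < l) :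
    Test (conf a l v) := by
  have hT : ContDiff ℝ (⊤ : ℕ∞) fun g : QH n => op n a (dil n l g) := by
    have h1 : ContDiff ℝ (⊤ : ℕ∞) fun g : QH n => dil n l g :=
      contDiff_dil.comp (contDiff_const.prodMk contDiff_id)
    exact contDiff_op.comp (contDiff_const.prodMk h1)
  refine ⟨contDiff_const.mul (hv.smooth.comp hT), ?_, fun g => mul_nonneg (by positivity) (hv.nonneg _)⟩
  refine HasCompactSupport.mul_left ?_
  refine HasCompactSupport.intro (K := (fun g => dil n l⁻¹ (op n (-a) g)) '' tsupport v)
    (hv.compact.isCompact.image (by fun_prop)) fun g hg => ?_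
  refine image_eq_zero_of_notMem_tsupport fun hmem => hg ⟨_, hmem, ?_⟩
  simp only
  rw [neg_op_cancel, dil_dil, inv_mul_cancel₀ hl.ne', dil_one]

lemma integral_hGradSq_conf {v : QH n → ℝ} (hv : Test v) (a : QH n) {l : ℝ} (hl : 0 < l) :
    ∫ g, hGradSq n (conf a l v) g = ∫ g, hGradSq n v g := by
  have h := fun g => hGradSq_conf (hv.smooth.differentiable (by simp)) (l ^ (2 * n + 2)) l a g
  unfold conf
  simp only [h]
  rw [integral_const_mul, integral_dil hl (fun g => hGradSq n v (op n a g)),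
    integral_op_left a (hGradSq n v), ← mul_assoc]
  rw [show (l ^ (2 * n + 2)) ^ 2 * l ^ 2 = l ^ (4 * n + 6) by ring,
    mul_inv_cancel₀ (by positivity), one_mul]

lemma integral_mul_conf_rpow {v : QH n → ℝ} (hv : Test v) (f : QH n → ℝ) (b : QH n) (s : ℝ) :
    ∫ g, f g * conf (-b) (exp (-s)) v g ^ pe n
      = ∫ g, f (dil n (exp s) (op n b g)) * v g ^ pe n := by
  have hl := exp_pos (-s)
  set l := exp (-s)
  have hpt : ∀ g, f g * conf (-b) l v g ^ pe n = l ^ (4 * n + 6) *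
      (fun g => (fun h => f (dil n (exp s) (op n b h)) * v h ^ pe n) (op n (-b) g)) (dil n l g) := by
    intro g
    simp only [conf]
    rw [mul_rpow (by positivity) (hv.nonneg _), op_neg_cancel, dil_dil, ← exp_add, add_neg_cancel,
      exp_zero, dil_one, ← rpow_natCast, ← rpow_mul hl.le, ← rpow_natCast]
    have : ((2 * n + 2 : ℕ) : ℝ) * pe n = (4 * n + 6 : ℕ) := by
      push_cast; linear_combination 2 * pe_mul n
    rw [this]; ring
  simp only [hpt]
  rw [integral_const_mul, integral_dil hl fun g =>
    (fun h => f (dil n (exp s) (op n b h)) * v h ^ pe n) (op n (-b) g),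
    integral_op_left (-b) fun h => f (dil n (exp s) (op n b h)) * v h ^ pe n, ← mul_assoc,
    mul_inv_cancel₀ (by positivity), one_mul]

/-- A normalised test function is conformally equivalent to a balanced one. -/
lemma exists_balanced_test {v : QH n → ℝ} (hv : Test v) (h1 : ∫ g, v g ^ pe n = 1) :
    ∃ u : QH n → ℝ, Test u ∧ ∫ g, u g ^ pe n = 1 ∧
      ∫ g, hGradSq n u g = ∫ g, hGradSq n v g ∧ ∀ j, ∫ g, xi j g * u g ^ pe n = 0 := by
  obtain ⟨b, s, hb⟩ := exists_balanced (hv.continuous_rpow (pe_pos n).le)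
    (hv.compact_rpow (pe_pos n).ne') (fun g => rpow_nonneg (hv.nonneg g) _) h1
  refine ⟨conf (-b) (exp (-s)) v, test_conf hv _ (exp_pos _), ?_,
    integral_hGradSq_conf hv _ (exp_pos _), fun j => ?_⟩
  · simpa [h1] using integral_mul_conf_rpow hv (fun _ => 1) b s
  · rw [integral_mul_conf_rpow hv, hb]

lemma integral_fun_add {X : Type*} [MeasurableSpace X] {μ : Measure X} {f g : X → ℝ}
    (hf : Integrable f μ) (hg : Integrable g μ) :
    Integrable (fun x => f x + g x) μ ∧ ∫ x, (f x + g x) ∂μ = (∫ x, f x ∂μ) + ∫ x, g x ∂μ :=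
  integrable_add_and_integral ⟨hf, rfl⟩ ⟨hg, rfl⟩

lemma pe_le_three (n : ℕ) : pe n ≤ 3 := by
  unfold pe; rw [div_le_iff₀ (by positivity)]
  have : (0 : ℝ) ≤ n := n.cast_nonneg
  linarith

lemma one_add_rpow_ge {p t x : ℝ} (hp : 2 < p) (hp3 : p ≤ 3) (ht : t ≤ 1 / 2) (hx : |x| ≤ t) :
    1 + p * x + (1 - t) * (p * (p - 1) / 2) * x ^ 2 ≤ (1 + x) ^ p := by
  set f : ℝ → ℝ := fun x => (1 + x) ^ p - (1 + p * x + (1 - t) * (p * (p - 1) / 2) * x ^ 2)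
  have hder : ∀ y, HasDerivAt f
      (p * ((1 + y) ^ (p - 1) - (1 + (1 - t) * (p - 1) * y))) y := by
    intro y
    have h1 : HasDerivAt (fun y : ℝ => (1 + y) ^ p) (1 * p * (1 + y) ^ (p - 1)) y :=
      ((hasDerivAt_id y).const_add 1).rpow_const (Or.inr (by linarith))
    have h2 : HasDerivAt (fun y : ℝ => 1 + p * y + (1 - t) * (p * (p - 1) / 2) * y ^ 2)
        (p * 1 + (1 - t) * (p * (p - 1) / 2) * (2 * y)) y := by
      have := (((hasDerivAt_id y).const_mul p).const_add 1).add
        ((hasDerivAt_pow 2 y).const_mul ((1 - t) * (p * (p - 1) / 2)))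
      exact this.congr_deriv (by simp)
    refine (h1.sub h2).congr_deriv ?_
    ring
  have ht0 : 0 ≤ t := (abs_nonneg x).trans hx
  have hf0 : f 0 = 0 := by simp [f]
  have hfc : Continuous f := continuous_iff_continuousAt.2 fun y => (hder y).continuousAt
  suffices h : f 0 ≤ f x by
    rw [hf0] at h
    exact sub_nonneg.1 h
  obtain ⟨hx1, hx2⟩ := abs_le.1 hx
  rcases le_total 0 x with hx0 | hx0
  · have hmono : MonotoneOn f (Set.Icc 0 t) := by
      refine monotoneOn_of_hasDerivWithinAt_nonneg (convex_Icc _ _) hfc.continuousOn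
        (fun y _ => (hder y).hasDerivWithinAt) fun y hy => ?_
      rw [interior_Icc] at hy
      have hb := one_add_mul_self_le_rpow_one_add (s := y) (by linarith [hy.1]) (p := p - 1)
        (by linarith)
      refine mul_nonneg (by linarith) ?_
      have : 0 ≤ t * (p - 1) * y := mul_nonneg (mul_nonneg ht0 (by linarith)) hy.1.le
      linarith
    exact hmono ⟨le_rfl, ht0⟩ ⟨hx0, hx2⟩ hx0
  · have hanti : AntitoneOn f (Set.Icc (-t) 0) := by
      refine antitoneOn_of_hasDerivWithinAt_nonpos (convex_Icc _ _) hfc.continuousOn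
        (fun y _ => (hder y).hasDerivWithinAt) fun y hy => ?_
      rw [interior_Icc] at hy
      have hb := rpow_one_add_le_one_add_mul_self (s := y) (by linarith [hy.1]) (p := p - 2)
        (by linarith) (by linarith)
      have hy1 : 0 < 1 + y := by linarith [hy.1]
      refine mul_nonpos_of_nonneg_of_nonpos (by linarith) ?_
      have h1 : (1 + y) ^ (p - 1) = (1 + y) * (1 + y) ^ (p - 2) := by
        rw [show p - 1 = 1 + (p - 2) by ring, rpow_add hy1, rpow_one]
      rw [h1]
      have h2 := mul_le_mul_of_nonneg_left hb hy1.le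
      have h3 : (p - 2) * (-y) * (-y) ≤ (p - 1) * t * (-y) :=
        mul_le_mul_of_nonneg_right (mul_le_mul (by linarith) (by linarith [hy.1])
          (by linarith [hy.2]) (by linarith)) (by linarith [hy.2])
      nlinarith
    exact hanti ⟨hx1, hx0⟩ ⟨by linarith, le_rfl⟩ hx0

lemma one_add_rpow_ge_of_le_one {α y : ℝ} (h0 : 0 ≤ α) (h1 : α ≤ 1) (hy : 0 ≤ y) :
    1 + α * y - y ^ 2 ≤ (1 + y) ^ α := by
  have hb := rpow_one_add_le_one_add_mul_self (s := y) (by linarith) (p := 1 - α)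
    (by linarith) (by linarith)
  have h2 : (1 + y) ^ α * (1 + y) ^ (1 - α) = 1 + y := by
    rw [← rpow_add (by linarith)]; simp
  have h3 : (0:ℝ) ≤ (1 + y) ^ α := by positivity
  have h4 := mul_le_mul_of_nonneg_left hb h3
  rw [h2] at h4
  have h5 : 0 ≤ (1 - α) * y := mul_nonneg (by linarith) hy
  have h6 : (1 + α * y - y ^ 2) * (1 + (1 - α) * y) ≤ 1 + y := by
    have : 0 ≤ (1 - α) * y * y ^ 2 := by positivity
    nlinarith [mul_nonneg h0 (sq_nonneg y), sq_nonneg (α * y), mul_nonneg h0 h5,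
      mul_nonneg (mul_nonneg (sub_nonneg.2 h1) (sub_nonneg.2 h1)) (sq_nonneg y)]
  exact le_of_mul_le_mul_right (h6.trans h4) (by linarith)

lemma hGradSq_add_const_mul {v w : QH n → ℝ} (hv : Differentiable ℝ v) (hw : Differentiable ℝ w)
    (c : ℝ) (g : QH n) : hGradSq n (fun x => v x + c * w x) g
      = hGradSq n v g + 2 * c * hGrad v w g + c ^ 2 * hGradSq n w g := by
  have h : ∀ α i, hd α (qb i) (fun x => v x + c * w x) g
      = hd α (qb i) v g + c * hd α (qb i) w g := by
    intro α i
    rw [hd_add (hv g) ((hw g).const_mul c), hd_const_mul c (hw g)]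
  simp only [hGradSq_eq, hGrad, h, Finset.mul_sum, ← Finset.sum_add_distrib]
  refine Finset.sum_congr rfl fun α _ => Finset.sum_congr rfl fun i _ => ?_
  ring

lemma hasCompactSupport_xi_mul {v : QH n → ℝ} (hv : HasCompactSupport v)
    (j : (Fin n × Fin 4) ⊕ Fin 4) : HasCompactSupport fun x => xi j x * v x := hv.mul_left

/-- A functional Sobolev inequality with constant `S` on test functions. -/
def Sob (n : ℕ) (S : ℝ) : Prop :=
  ∀ v : QH n → ℝ, Test v → S * (∫ g, v g ^ pe n) ^ (2 / pe n) ≤ ∫ g, hGradSq n v g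

lemma second_variation_coordinate {S t : ℝ} (hS0 : 0 ≤ S) (hS : Sob n S) {v : QH n → ℝ}
    (hv : Test v) (h1 : ∫ g, v g ^ pe n = 1) (hbal : ∀ j, ∫ g, xi j g * v g ^ pe n = 0)
    (ht0 : 0 < t) (ht : t ≤ 1 / 2) (hE : ∫ g, hGradSq n v g ≤ S + t ^ 3)
    (j : (Fin n × Fin 4) ⊕ Fin 4) :
    S * ((1 - t) * (pe n - 1) * (∫ g, xi j g ^ 2 * v g ^ pe n) - 9 * t ^ 2)
      ≤ (∫ g, hGradSq n (fun x => xi j x * v x) g) + t := by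
  have hp := two_lt_pe n
  have hp3 := pe_le_three n
  set p := pe n with hpdef
  set a := ∫ g, xi j g ^ 2 * v g ^ p
  have hxc : Continuous (xi (n := n) j) := (contDiff_xi (k := 0) j).continuous
  have hi0 := hv.integrable_rpow (r := p) (by linarith)
  have hi1 := hv.integrable_mul_rpow hxc (r := p) (by linarith)
  have hi2 := hv.integrable_mul_rpow (f := fun g => xi j g ^ 2) (hxc.pow 2) (r := p) (by linarith)
  have ha0 : 0 ≤ a := integral_nonneg fun g =>
    mul_nonneg (sq_nonneg _) (rpow_nonneg (hv.nonneg g) _)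
  have ha1 : a ≤ 1 := by
    rw [← h1]
    refine integral_mono hi2 hi0 fun g => ?_
    refine mul_le_of_le_one_left (rpow_nonneg (hv.nonneg g) _) ?_
    rw [sq_le_one_iff_abs_le_one]; exact abs_xi_le j g
  set y := (1 - t) * (p * (p - 1) / 2) * t ^ 2 * a with hy
  have hpp : 0 ≤ p * (p - 1) / 2 := by nlinarith
  have hpp3 : p * (p - 1) / 2 ≤ 3 := by nlinarith
  have hy0 : 0 ≤ y := by
    have : 0 ≤ 1 - t := by linarith
    positivity
  have hy3 : y ≤ 3 * t ^ 2 := by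
    have h1 : (1 - t) * (p * (p - 1) / 2) ≤ 1 * 3 :=
      mul_le_mul (by linarith) hpp3 hpp zero_le_one
    have h2 : (1 - t) * (p * (p - 1) / 2) * t ^ 2 ≤ 3 * t ^ 2 :=
      mul_le_mul_of_nonneg_right (by linarith) (sq_nonneg t)
    have h3 : 0 ≤ 3 * t ^ 2 := by positivity
    calc y ≤ 3 * t ^ 2 * 1 := mul_le_mul h2 ha1 ha0 h3
      _ = _ := mul_one _
  have hvd : Differentiable ℝ v := hv.smooth.differentiable (by simp)
  have hws : ContDiff ℝ (⊤ : ℕ∞) fun x => xi j x * v x := (contDiff_xi j).mul hv.smooth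
  have hwc := hasCompactSupport_xi_mul hv.compact j
  have hwd : Differentiable ℝ fun x => xi j x * v x := hws.differentiable (by simp)
  have hkey : ∀ τ, |τ| = t → S * (1 + 2 / p * y - y ^ 2)
      ≤ ∫ g, hGradSq n (fun x => v x + τ * (xi j x * v x)) g := by
    intro τ hτ
    have htx : ∀ g, |τ * xi j g| ≤ t := fun g => by
      rw [abs_mul, hτ]; exact mul_le_of_le_one_right ht0.le (abs_xi_le j g)
    have hu : Test fun x => v x + τ * (xi j x * v x) := by
      refine ⟨hv.smooth.add (contDiff_const.mul hws), hv.compact.add hwc.mul_left, fun g => ?_⟩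
      have : v g + τ * (xi j g * v g) = (1 + τ * xi j g) * v g := by ring
      rw [this]
      exact mul_nonneg (by linarith [neg_le_of_abs_le (htx g)]) (hv.nonneg g)
    have hN : 1 + y ≤ ∫ g, (v g + τ * (xi j g * v g)) ^ p := by
      have e1 : 1 + y = ∫ g, (v g ^ p + (p * τ * (xi j g * v g ^ p)
          + (1 - t) * (p * (p - 1) / 2) * t ^ 2 * (xi j g ^ 2 * v g ^ p))) := by
        rw [(integral_fun_add hi0 (integral_fun_add (hi1.const_mul (p * τ))
            (hi2.const_mul ((1 - t) * (p * (p - 1) / 2) * t ^ 2))).1).2,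
          (integral_fun_add (hi1.const_mul (p * τ))
            (hi2.const_mul ((1 - t) * (p * (p - 1) / 2) * t ^ 2))).2,
          integral_const_mul, integral_const_mul, h1, hbal j]
        simp [hy, a]
      rw [e1]
      refine integral_mono (integral_fun_add hi0
        (integral_fun_add (hi1.const_mul (p * τ))
            (hi2.const_mul ((1 - t) * (p * (p - 1) / 2) * t ^ 2))).1).1
        (hu.integrable_rpow (by linarith)) fun g => ?_
      have e2 : v g + τ * (xi j g * v g) = (1 + τ * xi j g) * v g := by ring
      simp only [e2]
      rw [mul_rpow (by linarith [neg_le_of_abs_le (htx g)]) (hv.nonneg g)]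
      refine le_trans (le_of_eq ?_) (mul_le_mul_of_nonneg_right (one_add_rpow_ge hp hp3 ht (htx g))
        (rpow_nonneg (hv.nonneg g) p))
      rw [mul_pow, ← sq_abs τ, hτ]; ring
    refine le_trans (mul_le_mul_of_nonneg_left ?_ hS0) (hS _ hu)
    refine (one_add_rpow_ge_of_le_one (by positivity) ?_ hy0).trans
      (rpow_le_rpow (by linarith) hN (by positivity))
    rw [div_le_one (by linarith)]; exact hp.le
  have hiE := integrable_hGradSq (hv.smooth.of_le (by simp)) hv.compact
  have hiw := integrable_hGradSq (hws.of_le (by simp)) hwc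
  have hsum : (∫ g, hGradSq n (fun x => v x + t * (xi j x * v x)) g)
      + ∫ g, hGradSq n (fun x => v x + (-t) * (xi j x * v x)) g
      = 2 * (∫ g, hGradSq n v g) + 2 * t ^ 2 * ∫ g, hGradSq n (fun x => xi j x * v x) g := by
    have h_int : ∀ τ : ℝ, Integrable (hGradSq n fun x => v x + τ * (xi j x * v x)) := fun τ =>
      integrable_hGradSq ((hv.smooth.add (contDiff_const.mul hws)).of_le (by simp))
        (hv.compact.add hwc.mul_left)
    rw [← integral_const_mul, ← integral_const_mul,
      ← (integral_fun_add (hiE.const_mul 2) (hiw.const_mul (2 * t ^ 2))).2,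
      ← (integral_fun_add (h_int t) (h_int (-t))).2]
    refine integral_congr_ae (.of_forall fun g => ?_)
    simp only [hGradSq_add_const_mul hvd hwd]
    ring
  have k1 := hkey t (abs_of_pos ht0)
  have k2 := hkey (-t) (by rw [abs_neg, abs_of_pos ht0])
  have hyy : S * y ^ 2 ≤ S * (9 * t ^ 4) :=
    mul_le_mul_of_nonneg_left (by nlinarith) hS0
  have h2y : 2 / p * y = (1 - t) * (p - 1) * a * t ^ 2 := by
    rw [hy]; field_simp
  rw [h2y] at k1 k2
  have hfin : t ^ 2 * (S * ((1 - t) * (p - 1) * a - 9 * t ^ 2))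
      ≤ t ^ 2 * ((∫ g, hGradSq n (fun x => xi j x * v x) g) + t) := by
    linarith
  exact le_of_mul_le_mul_left hfin (by positivity)

/-- Almost minimisers that are balanced have a small remainder. -/
lemma integral_rem_le {S t : ℝ} (hS0 : 0 ≤ S) (hS : Sob n S) {v : QH n → ℝ}
    (hv : Test v) (h1 : ∫ g, v g ^ pe n = 1) (hbal : ∀ j, ∫ g, xi j g * v g ^ pe n = 0)
    (ht0 : 0 < t) (ht : t ≤ 1 / 2) (hE : ∫ g, hGradSq n v g ≤ S + t ^ 3) :
    ∫ g, rem v g ≤ (n + 1) * ((4 * n + 4) * (9 * S + 1) + 2 * S + 2) * t := by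
  have hsum := Finset.sum_le_sum fun j (_ : j ∈ Finset.univ) =>
    second_variation_coordinate hS0 hS hv h1 hbal ht0 ht hE j
  have hp := two_lt_pe n
  have hp3 := pe_le_three n
  have hpm := pe_mul n
  have hvd : Differentiable ℝ v := hv.smooth.differentiable (by simp)
  have hv1 : ContDiff ℝ 1 v := hv.smooth.of_le (by simp)
  have hxc : ∀ j, Continuous (xi (n := n) j) := fun j => (contDiff_xi (k := 0) j).continuous
  have hA : ∑ j, ∫ g, xi j g ^ 2 * v g ^ pe n = 1 := by
    rw [← integral_finsetSum _ fun j _ => hv.integrable_mul_rpow (f := fun g => xi j g ^ 2)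
      ((hxc j).pow 2) (pe_pos n), ← h1]
    refine integral_congr_ae (.of_forall fun g => ?_)
    simp only [← Finset.sum_mul, sum_xi_sq, one_mul]
  have hEj : ∑ j, ∫ g, hGradSq n (fun x => xi j x * v x) g
      = (∫ g, hGradSq n v g) + 16 * n * ∫ g, v g ^ 2 * (FF n g)⁻¹ := by
    rw [← integral_finsetSum _ fun j _ => integrable_hGradSq
      (((contDiff_xi j).mul hv.smooth).of_le (by simp)) (hasCompactSupport_xi_mul hv.compact j),
      ← integral_const_mul, ← (integral_fun_add (integrable_hGradSq hv1 hv.compact)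
        ((integrable_sq_inv_FF hv1.continuous hv.compact).const_mul (16 * n : ℝ))).2]
    refine integral_congr_ae (.of_forall fun g => ?_)
    exact sum_hGradSq_xi_mul hvd g
  rw [← Finset.mul_sum, Finset.sum_sub_distrib, ← Finset.mul_sum, hA, Finset.sum_add_distrib, hEj]
    at hsum
  have hD := integral_hGradSq hv1 hv.compact
  set D := ∫ g, rem v g
  set A := ∫ g, v g ^ 2 * (FF n g)⁻¹
  set E := ∫ g, hGradSq n v g
  simp only [Finset.sum_const, Finset.card_univ, Fintype.card_sum, Fintype.card_prod,
    Fintype.card_fin, nsmul_eq_mul] at hsum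
  push_cast at hsum
  have hn : (0 : ℝ) ≤ n := n.cast_nonneg
  have hp1 : (n + 1 : ℝ) * (pe n - 2) = 1 := by linarith
  have ht2 : t ^ 2 ≤ t := by nlinarith
  have ht3 : t ^ 3 ≤ t := by nlinarith
  set p := pe n
  have hA' : 16 * n * A = (p - 2) * (E - D) := by
    rw [hD]; linear_combination (-16 * n * A) * hp1
  have hmul : (p - 2) * D ≤ ((4 * n + 4) * (9 * S + 1) + 2 * S + 2) * t := by
    have i1 : (p - 1) * E ≤ (p - 1) * (S + t ^ 3) := mul_le_mul_of_nonneg_left hE (by linarith)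
    have i2 : (p - 1) * t ^ 3 ≤ 2 * t := mul_le_mul (by linarith) ht3 (by positivity) (by norm_num)
    have i3 : S * t * (p - 1) ≤ S * t * 2 := mul_le_mul_of_nonneg_left (by linarith) (by positivity)
    have i4 : (4 * n + 4) * S * t ^ 2 ≤ (4 * n + 4) * S * t :=
      mul_le_mul_of_nonneg_left ht2 (by positivity)
    nlinarith
  calc D = (n + 1) * ((p - 2) * D) := by rw [← mul_assoc, hp1, one_mul]
    _ ≤ (n + 1) * (((4 * n + 4) * (9 * S + 1) + 2 * S + 2) * t) :=
        mul_le_mul_of_nonneg_left hmul (by positivity)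
    _ = _ := by ring

instance instSigmaFinite (n : ℕ) : SigmaFinite (volume : Measure (QH n)) :=
  Measure.IsAddHaarMeasure.sigmaFinite _

lemma setLIntegral_op_right_le {A A' : Set (QH n)} {h : QH n} (hA : ∀ g ∈ A, op n g h ∈ A')
    (f : QH n → ENNReal) : ∫⁻ g in A, f (op n g h) ≤ ∫⁻ g in A', f g := by
  have h1 := (measurePreserving_opR h).setLIntegral_comp_preimage_emb
    (opR h).measurableEmbedding f A'
  rw [← h1]
  simp only [opR_apply]
  refine lintegral_mono_set fun g hg => ?_
  rw [Set.mem_preimage, opR_apply]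
  exact hA g hg

lemma fderiv_horizontal (u : QH n → ℝ) (e : Fin n → ℝ × ℝ × ℝ × ℝ) (x : QH n) :
    fderiv ℝ u x (e, imB x.1 e) = ∑ α, ∑ i, qc i (e α) * hd α (qb i) u x := by
  have h1 : (e, imB x.1 e) = ∑ α : Fin n, ∑ i : Fin 4, qc i (e α) • hvec α (qb i) x := by
    have h2 : ∀ α, ∑ i : Fin 4, qc i (e α) • hvec α (qb i) x = hvec α (e α) x := by
      intro α
      simp only [Fin.sum_univ_four, hvec, qc, qb, Prod.smul_mk, Prod.mk_add_mk, ← Pi.single_smul,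
        ← Pi.single_add]
      congr 1
      · congr 1
        simp [tC, xC, yC, zC]
      · simp [imI, imJ, imK, tC, xC, yC, zC]
        refine ⟨?_, ?_, ?_⟩ <;> ring
    rw [Finset.sum_congr rfl fun α _ => h2 α]
    simp only [hvec]
    refine Prod.ext ?_ ?_
    · rw [Prod.fst_sum]; simp only [Finset.univ_sum_single]
    · rw [Prod.snd_sum]
      simp only [imB, Finset.mul_sum]
      refine Prod.ext ?_ (Prod.ext ?_ ?_) <;> simp [Prod.fst_sum, Prod.snd_sum]
  rw [h1, map_sum]
  refine Finset.sum_congr rfl fun α _ => ?_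
  rw [map_sum]
  refine Finset.sum_congr rfl fun i _ => ?_
  rw [map_smul, smul_eq_mul]; rfl

lemma abs_qc_le (i : Fin 4) (a : ℝ × ℝ × ℝ × ℝ) : |qc i a| ≤ ‖a‖ := by
  have h1 := norm_fst_le a
  have h2 := (norm_fst_le a.2).trans (norm_snd_le a)
  have h3 := (norm_fst_le a.2.2).trans ((norm_snd_le a.2).trans (norm_snd_le a))
  have h4 := (norm_snd_le a.2.2).trans ((norm_snd_le a.2).trans (norm_snd_le a))
  fin_cases i
  · exact h1
  · exact h2
  · exact h3
  · exact h4

lemma sq_fderiv_horizontal_le (u : QH n → ℝ) {e : Fin n → ℝ × ℝ × ℝ × ℝ} {r : ℝ} (he : ‖e‖ ≤ r)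
    (x : QH n) : (fderiv ℝ u x (e, imB x.1 e)) ^ 2 ≤ 4 * n * r ^ 2 * hGradSq n u x := by
  rw [fderiv_horizontal, hGradSq_eq, hGrad]
  simp only [← Fintype.sum_prod_type']
  refine (Finset.sum_mul_sq_le_sq_mul_sq _ _ _).trans ?_
  simp only [← pow_two]
  refine mul_le_mul_of_nonneg_right ?_ (by positivity)
  have : ∀ x : Fin n × Fin 4, qc x.2 (e x.1) ^ 2 ≤ r ^ 2 := fun x =>
    sq_le_sq' (by linarith [neg_le_of_abs_le ((abs_qc_le x.2 (e x.1)).trans ((norm_le_pi_norm e x.1).trans he))])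
      ((le_abs_self _).trans ((abs_qc_le x.2 (e x.1)).trans ((norm_le_pi_norm e x.1).trans he)))
  refine (Finset.sum_le_sum fun x _ => this x).trans (le_of_eq ?_)
  rw [Finset.sum_const, Finset.card_univ, Fintype.card_prod, Fintype.card_fin, Fintype.card_fin,
    nsmul_eq_mul]
  push_cast; ring

/-- Points reachable from `A` by horizontal right translations of size at most `r`. -/
def thick (r : ℝ) (A : Set (QH n)) : Set (QH n) :=
  (fun x : QH n × (Fin n → ℝ × ℝ × ℝ × ℝ) => op n x.1 (x.2, 0)) '' (A ×ˢ Metric.closedBall 0 r)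

lemma op_mem_thick {r : ℝ} {A : Set (QH n)} {g : QH n} (hg : g ∈ A) {e : Fin n → ℝ × ℝ × ℝ × ℝ}
    (he : ‖e‖ ≤ r) : op n g (e, 0) ∈ thick r A := ⟨(g, e), ⟨hg, by simpa using he⟩, rfl⟩

lemma subset_thick {r : ℝ} (hr : 0 ≤ r) (A : Set (QH n)) : A ⊆ thick r A := fun g hg => by
  have h := op_mem_thick hg (e := 0) (r := r) (by simpa using hr)
  rwa [show op n g ((0 : Fin n → ℝ × ℝ × ℝ × ℝ), (0 : ℝ × ℝ × ℝ)) = g from op_zero g] at h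

lemma isCompact_thick {r : ℝ} {A : Set (QH n)} (hA : IsCompact A) : IsCompact (thick r A) :=
  (hA.prod (isCompact_closedBall _ _)).image (by fun_prop)

lemma sq_sub_le_integral {f f' : ℝ → ℝ} (hf : ∀ s, HasDerivAt f (f' s) s) (hc : Continuous f') :
    (f 1 - f 0) ^ 2 ≤ ∫ s in (0 : ℝ)..1, f' s ^ 2 := by
  have h1 := intervalIntegral.integral_eq_sub_of_hasDerivAt (a := 0) (b := 1) (fun s _ => hf s)
    (hc.intervalIntegrable _ _)
  set c := f 1 - f 0
  have h2 : 0 ≤ ∫ s in (0 : ℝ)..1, (f' s - c) ^ 2 :=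
    intervalIntegral.integral_nonneg zero_le_one fun s _ => sq_nonneg _
  have h3 : ∫ s in (0 : ℝ)..1, (f' s - c) ^ 2 = (∫ s in (0 : ℝ)..1, f' s ^ 2) - c ^ 2 := by
    have : ∀ s, (f' s - c) ^ 2 = f' s ^ 2 - (2 * c * f' s - c ^ 2) := fun s => by ring
    simp only [this]
    have c1 : Continuous fun s => f' s ^ 2 := hc.pow 2
    have c2 : Continuous fun s => 2 * c * f' s := hc.const_mul (2 * c)
    have c3 : Continuous fun s => 2 * c * f' s - c ^ 2 := c2.sub continuous_const
    rw [intervalIntegral.integral_sub (c1.intervalIntegrable _ _) (c3.intervalIntegrable _ _),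
      intervalIntegral.integral_sub (c2.intervalIntegrable _ _)
      (continuous_const.intervalIntegrable _ _), intervalIntegral.integral_const_mul, h1]
    simp; ring
  linarith

lemma lintegral_translate_horizontal_le {u : QH n → ℝ} (hu : ContDiff ℝ 1 u) (A : Set (QH n))
    {e : Fin n → ℝ × ℝ × ℝ × ℝ} {r : ℝ} (he : ‖e‖ ≤ r) :
    ∫⁻ g in A, ENNReal.ofReal ((u (op n g (e, 0)) - u g) ^ 2)
      ≤ ENNReal.ofReal (4 * n * r ^ 2) * ∫⁻ g in thick r A, ENNReal.ofReal (hGradSq n u g) := by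
  have hr : 0 ≤ r := (norm_nonneg e).trans he
  have hgc : Continuous (hGradSq n u) := continuous_hGradSq hu
  have hpt : ∀ g, ENNReal.ofReal ((u (op n g (e, 0)) - u g) ^ 2)
      ≤ ∫⁻ s in Set.Ioc (0 : ℝ) 1,
        ENNReal.ofReal (4 * n * r ^ 2 * hGradSq n u (op n g (s • e, 0))) := by
    intro g
    have hpath : ∀ s : ℝ, op n g (s • e, 0) = g + s • (e, imB g.1 e) := by
      intro s
      refine Prod.ext ?_ ?_
      · simp [op_eq]
      · simp [op_eq, imB_smul_right]
    have himB : ∀ s : ℝ, imB (op n g (s • e, 0)).1 e = imB g.1 e := by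
      intro s
      simp [op_eq, imB_add_left, imB_smul_left, imB_self]
    have hder : ∀ s : ℝ, HasDerivAt (fun s : ℝ => u (op n g (s • e, 0)))
        (fderiv ℝ u (op n g (s • e, 0)) (e, imB (op n g (s • e, 0)).1 e)) s := by
      intro s
      have h1 : HasDerivAt (fun s : ℝ => op n g (s • e, 0)) (e, imB g.1 e) s := by
        simp only [hpath]
        simpa using ((hasDerivAt_id s).smul_const (e, imB g.1 e)).const_add g
      have h2 := (hu.differentiable one_ne_zero (op n g (s • e, 0))).hasFDerivAt.comp_hasDerivAt s h1
      rw [himB]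
      exact h2
    have hcont : Continuous fun s : ℝ =>
        fderiv ℝ u (op n g (s • e, 0)) (e, imB (op n g (s • e, 0)).1 e) := by
      simp only [himB]
      simp only [hpath]
      exact ((hu.continuous_fderiv one_ne_zero).comp (by fun_prop)).clm_apply continuous_const
    have h3 := sq_sub_le_integral hder hcont
    simp only [one_smul, zero_smul] at h3
    rw [show op n g ((0 : Fin n → ℝ × ℝ × ℝ × ℝ), (0 : ℝ × ℝ × ℝ)) = g from op_zero g] at h3
    have hcg : Continuous fun s : ℝ => 4 * n * r ^ 2 * hGradSq n u (op n g (s • e, 0)) := by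
      simp only [hpath]
      exact continuous_const.mul (hgc.comp (by fun_prop))
    have h4 : ∫ s in (0 : ℝ)..1,
          (fderiv ℝ u (op n g (s • e, 0)) (e, imB (op n g (s • e, 0)).1 e)) ^ 2
        ≤ ∫ s in (0 : ℝ)..1, 4 * n * r ^ 2 * hGradSq n u (op n g (s • e, 0)) :=
      intervalIntegral.integral_mono zero_le_one ((hcont.pow 2).intervalIntegrable _ _)
        (hcg.intervalIntegrable _ _) fun s => sq_fderiv_horizontal_le u he _
    refine (ENNReal.ofReal_le_ofReal (h3.trans h4)).trans ?_
    rw [intervalIntegral.integral_of_le zero_le_one,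
      ofReal_integral_eq_lintegral_ofReal (hcg.integrableOn_Ioc)
        (.of_forall fun s => mul_nonneg (by positivity) (hGradSq_nonneg _ _))]
  have hjc : Continuous fun x : QH n × ℝ => op n x.1 (x.2 • e, 0) := by fun_prop
  calc _ ≤ ∫⁻ g in A, ∫⁻ s in Set.Ioc (0 : ℝ) 1,
        ENNReal.ofReal (4 * n * r ^ 2 * hGradSq n u (op n g (s • e, 0))) := lintegral_mono hpt
    _ = ∫⁻ s in Set.Ioc (0 : ℝ) 1, ∫⁻ g in A,
        ENNReal.ofReal (4 * n * r ^ 2 * hGradSq n u (op n g (s • e, 0))) := by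
      refine lintegral_lintegral_swap (Measurable.aemeasurable ?_)
      exact (ENNReal.continuous_ofReal.comp
        (continuous_const.mul (hgc.comp hjc))).measurable
    _ ≤ ∫⁻ s in Set.Ioc (0 : ℝ) 1,
        ENNReal.ofReal (4 * n * r ^ 2) * ∫⁻ g in thick r A, ENNReal.ofReal (hGradSq n u g) := by
      refine setLIntegral_mono' measurableSet_Ioc fun s hs => ?_
      simp only [ENNReal.ofReal_mul (show 0 ≤ 4 * n * r ^ 2 by positivity)]
      rw [lintegral_const_mul' _ _ ENNReal.ofReal_ne_top]
      refine mul_le_mul_right ?_ _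
      refine setLIntegral_op_right_le (fun g hg => op_mem_thick hg ?_)
        (fun g => ENNReal.ofReal (hGradSq n u g))
      rw [norm_smul, Real.norm_eq_abs, abs_of_pos hs.1]
      exact (mul_le_of_le_one_left (norm_nonneg e) hs.2).trans he
    _ = _ := by simp

lemma lintegral_translate_op_le {u : QH n → ℝ} (hu : Continuous u) {A A' : Set (QH n)}
    (h₁ h₂ : QH n) (hA : ∀ g ∈ A, op n g h₁ ∈ A') :
    ∫⁻ g in A, ENNReal.ofReal ((u (op n g (op n h₁ h₂)) - u g) ^ 2)
      ≤ 2 * (∫⁻ g in A, ENNReal.ofReal ((u (op n g h₁) - u g) ^ 2))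
        + 2 * ∫⁻ g in A', ENNReal.ofReal ((u (op n g h₂) - u g) ^ 2) := by
  have hm : ∀ h : QH n, Measurable fun g => ENNReal.ofReal ((u (op n g h) - u g) ^ 2) := fun h =>
    (ENNReal.continuous_ofReal.comp (((hu.comp (by fun_prop)).sub hu).pow 2)).measurable
  have h2 : ∫⁻ g in A, ENNReal.ofReal ((u (op n (op n g h₁) h₂) - u (op n g h₁)) ^ 2)
      ≤ ∫⁻ g in A', ENNReal.ofReal ((u (op n g h₂) - u g) ^ 2) :=
    setLIntegral_op_right_le hA fun g => ENNReal.ofReal ((u (op n g h₂) - u g) ^ 2)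
  calc _ ≤ ∫⁻ g in A, (2 * ENNReal.ofReal ((u (op n g h₁) - u g) ^ 2)
        + 2 * ENNReal.ofReal ((u (op n (op n g h₁) h₂) - u (op n g h₁)) ^ 2)) := by
        refine lintegral_mono fun g => ?_
        rw [show (2 : ENNReal) = ENNReal.ofReal 2 by simp, ← ENNReal.ofReal_mul two_pos.le,
          ← ENNReal.ofReal_mul two_pos.le, ← ENNReal.ofReal_add (by positivity) (by positivity)]
        refine ENNReal.ofReal_le_ofReal ?_
        rw [← op_assoc]
        nlinarith [sq_nonneg (u (op n g h₁) - u g - (u (op n (op n g h₁) h₂) - u (op n g h₁)))]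
    _ = 2 * (∫⁻ g in A, ENNReal.ofReal ((u (op n g h₁) - u g) ^ 2))
        + 2 * ∫⁻ g in A, ENNReal.ofReal ((u (op n (op n g h₁) h₂) - u (op n g h₁)) ^ 2) := by
        rw [lintegral_add_left ((hm h₁).const_mul 2), lintegral_const_mul 2 (hm h₁),
          lintegral_const_mul' 2 _ (by simp)]
    _ ≤ _ := by gcongr

/-- The endpoint of a horizontal path. -/
def path : List (Fin n → ℝ × ℝ × ℝ × ℝ) → QH n
  | [] => 0
  | e :: l => op n (e, 0) (path l)

lemma lintegral_translate_path_le {u : QH n → ℝ} (hu : ContDiff ℝ 1 u) {r : ℝ} (hr : 0 ≤ r)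
    (l : List (Fin n → ℝ × ℝ × ℝ × ℝ)) (hl : ∀ e ∈ l, ‖e‖ ≤ r) (A : Set (QH n)) :
    ∫⁻ g in A, ENNReal.ofReal ((u (op n g (path l)) - u g) ^ 2)
      ≤ 4 ^ l.length * (ENNReal.ofReal (4 * n * r ^ 2)
        * ∫⁻ g in (thick r)^[l.length] A, ENNReal.ofReal (hGradSq n u g)) := by
  induction l generalizing A with
  | nil => simp [path, op_zero]
  | cons e l ih =>
    have he : ‖e‖ ≤ r := hl e (by simp)
    refine (lintegral_translate_op_le hu.continuous (e, 0) (path l)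
      (A' := thick r A) fun g hg => op_mem_thick hg he).trans ?_
    have h1 := lintegral_translate_horizontal_le hu A he
    have h2 := ih (fun e' he' => hl e' (by simp [he'])) (thick r A)
    have hsub : ∀ (k : ℕ) (B : Set (QH n)), B ⊆ (thick r)^[k] B := by
      intro k
      induction k with
      | zero => intro B; exact subset_rfl
      | succ k ihk => intro B; exact (subset_thick hr B).trans (ihk _)
    have h3 : ∫⁻ g in thick r A, ENNReal.ofReal (hGradSq n u g)
        ≤ ∫⁻ g in (thick r)^[l.length] (thick r A), ENNReal.ofReal (hGradSq n u g) :=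
      lintegral_mono_set (hsub _ _)
    rw [List.length_cons, Function.iterate_succ_apply]
    set G := ENNReal.ofReal (4 * n * r ^ 2)
        * ∫⁻ g in (thick r)^[l.length] (thick r A), ENNReal.ofReal (hGradSq n u g) with hG
    have h4 : ENNReal.ofReal (4 * n * r ^ 2) * ∫⁻ g in thick r A, ENNReal.ofReal (hGradSq n u g)
        ≤ G := by rw [hG]; gcongr
    calc _ ≤ 2 * G + 2 * (4 ^ l.length * G) := by gcongr; exact h1.trans h4
      _ ≤ 2 * (4 ^ l.length * G) + 2 * (4 ^ l.length * G) := by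
        gcongr
        exact le_mul_of_one_le_left' (one_le_pow₀ (by norm_num))
      _ = 4 ^ (l.length + 1) * G := by ring

lemma exists_path (hn : 1 ≤ n) {r : ℝ} (hr : 0 < r) {h : QH n} (h1 : ‖h.1‖ ≤ r)
    (h2 : ‖h.2‖ ≤ r ^ 2) : ∃ l : List (Fin n → ℝ × ℝ × ℝ × ℝ), l.length = 5 ∧ (∀ e ∈ l, ‖e‖ ≤ r)
      ∧ path l = h := by
  let α : Fin n := ⟨0, hn⟩
  set a : Fin n → ℝ × ℝ × ℝ × ℝ := Pi.single α (0, (4 * r)⁻¹ • h.2)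
  set b : Fin n → ℝ × ℝ × ℝ × ℝ := Pi.single α (r, 0)
  have ha : ‖a‖ ≤ r := by
    rw [Pi.norm_single, Prod.norm_mk, norm_zero, max_eq_right (norm_nonneg _), norm_smul,
      norm_inv, Real.norm_eq_abs, abs_of_pos (by positivity), inv_mul_le_iff₀ (by positivity)]
    nlinarith
  have hb : ‖b‖ ≤ r := by
    rw [Pi.norm_single, Prod.norm_mk, norm_zero, max_eq_left (norm_nonneg _), Real.norm_eq_abs,
      abs_of_pos hr]
  have hab : imB a b = (2⁻¹ : ℝ) • h.2 := by
    rw [imB_single]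
    refine Prod.ext ?_ (Prod.ext ?_ ?_) <;>
      simp [a, imI, imJ, imK, tC, xC, yC, zC] <;> field_simp <;> ring
  refine ⟨[h.1, a, b, -a, -b], rfl, by simp [h1, ha, hb], ?_⟩
  have hba : imB b a = -((2⁻¹ : ℝ) • h.2) := by rw [imB_comm, hab]
  refine Prod.ext ?_ ?_
  · simp [path, op_eq]
  · simp only [path, op_eq]
    simp [imB_add_right, imB_neg_right, imB_self, hab, hba, imB_neg_left]
    have h0 : ∀ c : Fin n → ℝ × ℝ × ℝ × ℝ, imB c 0 = 0 := fun c => by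
      simpa using imB_smul_right 0 c 0
    rw [h0, h0, neg_zero, zero_add, add_zero, ← add_smul]; norm_num

/-- Right translations are controlled by the horizontal gradient. -/
lemma lintegral_translate_le (hn : 1 ≤ n) {u : QH n → ℝ} (hu : ContDiff ℝ 1 u) {r : ℝ}
    (hr : 0 < r) {h : QH n} (h1 : ‖h.1‖ ≤ r) (h2 : ‖h.2‖ ≤ r ^ 2) (A : Set (QH n)) :
    ∫⁻ g in A, ENNReal.ofReal ((u (op n g h) - u g) ^ 2)
      ≤ ENNReal.ofReal (4 ^ 6 * n * r ^ 2)
        * ∫⁻ g in (thick r)^[5] A, ENNReal.ofReal (hGradSq n u g) := by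
  obtain ⟨l, hl5, hl, rfl⟩ := exists_path hn hr h1 h2
  have := lintegral_translate_path_le hu hr.le l hl A
  rw [hl5, ← mul_assoc] at this
  refine this.trans (le_of_eq ?_)
  congr 1
  rw [show (4 : ENNReal) ^ 5 = ENNReal.ofReal (4 ^ 5) by simp, ← ENNReal.ofReal_mul (by positivity)]
  congr 1; ring

instance instOpensMeasurableSpaceProd (n : ℕ) : OpensMeasurableSpace (QH n × QH n) := by
  have : OpensMeasurableSpace (QH n) := inferInstance
  have : SecondCountableTopology (QH n) := inferInstance
  exact Prod.opensMeasurableSpace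

lemma exists_cutoff : ∃ ψ : ℝ → ℝ, ∃ L : ℝ, 0 ≤ L ∧ ContDiff ℝ (⊤ : ℕ∞) ψ ∧
    (∀ s, 0 ≤ ψ s ∧ ψ s ≤ 1) ∧ (∀ s, |s| ≤ 1 → ψ s = 0) ∧ (∀ s, 2 ≤ |s| → ψ s = 1) ∧
    (∀ s, |deriv ψ s| ≤ L) ∧ ∀ s, |s| < 1 ∨ 2 ≤ |s| → deriv ψ s = 0 := by
  set ψ : ℝ → ℝ := fun s => smoothTransition (s ^ 2 - 1)
  have hs : ContDiff ℝ (⊤ : ℕ∞) ψ :=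
    smoothTransition.contDiff.comp ((contDiff_id.pow 2).sub contDiff_const)
  have h0 : ∀ s, |s| ≤ 1 → ψ s = 0 := fun s hs => smoothTransition.zero_of_nonpos (by
    have := (sq_le_one_iff_abs_le_one s).2 hs; linarith)
  have h1 : ∀ s, √2 ≤ |s| → ψ s = 1 := fun s hs => smoothTransition.one_of_one_le (by
    have := Real.sqrt_le_iff.1 hs |>.2; rw [sq_abs] at this; linarith)
  have hd : ∀ s, |s| < 1 ∨ 2 ≤ |s| → deriv ψ s = 0 := by
    rintro s (hs | hs)
    · have : ψ =ᶠ[nhds s] fun _ => 0 := by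
        filter_upwards [(isOpen_lt continuous_abs continuous_const).mem_nhds hs] with y hy
        exact h0 y (le_of_lt hy)
      rw [this.deriv_eq, deriv_const]
    · have h2 : √2 < |s| := lt_of_lt_of_le (by
        rw [Real.sqrt_lt' two_pos]; norm_num) hs
      have : ψ =ᶠ[nhds s] fun _ => 1 := by
        filter_upwards [(isOpen_lt continuous_const continuous_abs).mem_nhds h2] with y hy
        exact h1 y (le_of_lt hy)
      rw [this.deriv_eq, deriv_const]
  have hc : Continuous fun s => |deriv ψ s| := (hs.continuous_deriv (by simp)).abs
  obtain ⟨L, hL⟩ := (isCompact_Icc (a := (-2 : ℝ)) (b := 2)).bddAbove_image hc.continuousOn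
  refine ⟨ψ, |L|, abs_nonneg _, hs, fun s => ⟨smoothTransition.nonneg _, smoothTransition.le_one _⟩,
    h0, fun s hs => h1 s ((Real.sqrt_le_iff.2 ⟨two_pos.le, by norm_num⟩).trans hs), fun s => ?_, hd⟩
  rcases le_or_gt 2 |s| with h | h
  · rw [hd s (Or.inr h), abs_zero]; exact abs_nonneg _
  · exact (hL ⟨s, abs_le.1 h.le, rfl⟩).trans (le_abs_self L)

lemma hGradSq_comp {f : ℝ → ℝ} {v : QH n → ℝ} {f' : ℝ} {g : QH n} (hf : HasDerivAt f f' (v g))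
    (hv : DifferentiableAt ℝ v g) : hGradSq n (fun x => f (v x)) g = f' ^ 2 * hGradSq n v g := by
  simp only [hGradSq_eq, hGrad, hd_comp hf hv, Finset.mul_sum]
  exact Finset.sum_congr rfl fun _ _ => Finset.sum_congr rfl fun _ _ => by ring

/-- A compact neighbourhood of the identity of homogeneous radius `r`. -/
def box (n : ℕ) (r : ℝ) : Set (QH n) := Metric.closedBall 0 r ×ˢ Metric.closedBall 0 (r ^ 2)

lemma mem_box {r : ℝ} {h : QH n} : h ∈ box n r ↔ ‖h.1‖ ≤ r ∧ ‖h.2‖ ≤ r ^ 2 := by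
  simp [box]

lemma isCompact_box (r : ℝ) : IsCompact (box n r) :=
  (isCompact_closedBall _ _).prod (isCompact_closedBall _ _)

lemma exists_volume_box : ∃ c : ℝ, 0 < c ∧ ∀ r, 0 ≤ r →
    volume (box n r) = ENNReal.ofReal (c * (r ^ 2) ^ (2 * n + 3)) := by
  set a := volume (Metric.ball (0 : Fin n → ℝ × ℝ × ℝ × ℝ) 1) with ha
  set b := volume (Metric.ball (0 : ℝ × ℝ × ℝ) 1) with hb
  have ha0 : 0 < a := Metric.measure_ball_pos _ _ one_pos
  have hb0 : 0 < b := Metric.measure_ball_pos _ _ one_pos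
  have ha1 : a ≠ ⊤ := measure_ball_lt_top.ne
  have hb1 : b ≠ ⊤ := measure_ball_lt_top.ne
  refine ⟨a.toReal * b.toReal, mul_pos (ENNReal.toReal_pos ha0.ne' ha1)
    (ENNReal.toReal_pos hb0.ne' hb1), fun r hr => ?_⟩
  rw [box, Measure.volume_eq_prod, Measure.prod_prod, Measure.addHaar_closedBall _ _ hr,
    Measure.addHaar_closedBall _ _ (sq_nonneg r), ← ha, ← hb]
  have e1 : Module.finrank ℝ (Fin n → ℝ × ℝ × ℝ × ℝ) = n * 4 := by
    rw [Module.finrank_pi_fintype]; simp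
  have e2 : Module.finrank ℝ (ℝ × ℝ × ℝ) = 3 := by simp
  rw [e1, e2, ← ENNReal.ofReal_toReal ha1, ← ENNReal.ofReal_toReal hb1,
    ← ENNReal.ofReal_mul (by positivity), ← ENNReal.ofReal_mul (by positivity),
    ← ENNReal.ofReal_mul (by positivity)]
  simp only [ENNReal.toReal_ofReal ENNReal.toReal_nonneg]
  congr 1
  ring

lemma exists_weak_sobolev (hn : 1 ≤ n) : ∃ C : ℝ, 0 < C ∧ ∀ u : QH n → ℝ, ContDiff ℝ 1 u →
    ∀ (A B : Set (QH n)) (m : ℝ), MeasurableSet A → MeasurableSet B → volume A ≠ ⊤ →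
    (∀ g, g ∉ A → u g = 0) → (∀ g ∈ B, u g = m) →
    ENNReal.ofReal (m ^ 2) * volume B
      ≤ ENNReal.ofReal (C * (volume A).toReal ^ (1 / (2 * n + 3) : ℝ))
        * ∫⁻ g, ENNReal.ofReal (hGradSq n u g) := by
  obtain ⟨c, hc, hvol⟩ := exists_volume_box (n := n)
  have hn0 : (0 : ℝ) < n := by exact_mod_cast hn
  refine ⟨2 * (4 ^ 6 * n) * (2 / c) ^ (1 / (2 * n + 3) : ℝ), by positivity, ?_⟩
  intro u hu A B m hA hB hAt hu0 hum
  by_cases hA0 : volume A = 0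
  · by_cases hB0 : volume B = 0
    · simp [hB0]
    · obtain ⟨g, hgB, hgA⟩ : ∃ g, g ∈ B ∧ g ∉ A := by
        by_contra! h
        exact hB0 (measure_mono_null h hA0)
      have : m = 0 := by rw [← hum g hgB, hu0 g hgA]
      simp [this]
  set a := (volume A).toReal
  have ha : 0 < a := ENNReal.toReal_pos hA0 hAt
  have hAa : volume A = ENNReal.ofReal a := (ENNReal.ofReal_toReal hAt).symm
  set ρ := (2 * a / c) ^ (1 / (2 * n + 3) : ℝ)
  have hρ : 0 < ρ := by positivity
  have hr2 : √ρ ^ 2 = ρ := Real.sq_sqrt hρ.le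
  have hV : volume (box n √ρ) = 2 * volume A := by
    rw [hvol _ (Real.sqrt_nonneg _), hr2, hAa, show (2 : ENNReal) = ENNReal.ofReal 2 by simp,
      ← ENNReal.ofReal_mul two_pos.le]
    congr 1
    rw [← rpow_natCast ρ, ← rpow_mul (by positivity)]
    push_cast
    rw [one_div_mul_cancel (by positivity), rpow_one]
    field_simp
  set E := ∫⁻ g, ENNReal.ofReal (hGradSq n u g)
  have huc := hu.continuous
  have key : ENNReal.ofReal (m ^ 2) * volume B * volume A
      ≤ volume (box n √ρ) * (ENNReal.ofReal (4 ^ 6 * n * ρ) * E) := by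
    calc ENNReal.ofReal (m ^ 2) * volume B * volume A
        = ∫⁻ g in B, ENNReal.ofReal (m ^ 2) * volume A := by
          rw [setLIntegral_const]; ring
      _ ≤ ∫⁻ g in B, ∫⁻ h in box n √ρ, ENNReal.ofReal ((u (op n g h) - u g) ^ 2) := by
          refine setLIntegral_mono' hB fun g hg => ?_
          set A' := (fun h => opL g h) ⁻¹' A
          have hA' : MeasurableSet A' := (opL g).continuous.measurable hA
          have hA'v : volume A' = volume A :=
            (measurePreserving_opL g).measure_preimage hA.nullMeasurableSet
          calc ENNReal.ofReal (m ^ 2) * volume A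
              ≤ ENNReal.ofReal (m ^ 2) * volume (box n √ρ \ A') := by
                refine mul_le_mul_right ?_ _
                refine le_trans ?_ le_measure_sdiff
                rw [hV, hA'v, two_mul, ENNReal.add_sub_cancel_right hAt]
            _ = ∫⁻ h in box n √ρ \ A', ENNReal.ofReal (m ^ 2) := by rw [setLIntegral_const]
            _ = ∫⁻ h in box n √ρ \ A', ENNReal.ofReal ((u (op n g h) - u g) ^ 2) := by
                refine setLIntegral_congr_fun ((isCompact_box _).measurableSet.diff hA')
                  fun h hh => ?_
                have h1 : op n g h ∉ A := fun hc => hh.2 (by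
                  rw [Set.mem_preimage, opL_apply]; exact hc)
                simp only [hum g hg, hu0 _ h1]; congr 1; ring
            _ ≤ _ := lintegral_mono_set Set.sdiff_subset
      _ = ∫⁻ h in box n √ρ, ∫⁻ g in B, ENNReal.ofReal ((u (op n g h) - u g) ^ 2) := by
          refine lintegral_lintegral_swap (Measurable.aemeasurable ?_)
          have c1 : Continuous fun x : QH n × QH n => (u (op n x.1 x.2) - u x.1) ^ 2 := by
            fun_prop
          exact (ENNReal.continuous_ofReal.comp c1).measurable
      _ ≤ ∫⁻ h in box n √ρ, ENNReal.ofReal (4 ^ 6 * n * ρ) * E := by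
          refine setLIntegral_mono' (isCompact_box _).measurableSet fun h hh => ?_
          obtain ⟨h1, h2⟩ := mem_box.1 hh
          have := lintegral_translate_le hn hu (Real.sqrt_pos.2 hρ) h1 h2 B
          rw [hr2] at this
          refine this.trans (mul_le_mul_right ?_ _)
          exact setLIntegral_le_lintegral _ _
      _ = _ := by rw [setLIntegral_const, mul_comm]
  rw [hV] at key
  have h3 : ENNReal.ofReal (m ^ 2) * volume B ≤ 2 * (ENNReal.ofReal (4 ^ 6 * n * ρ) * E) := by
    refine (ENNReal.mul_le_mul_iff_left hA0 hAt).1 (key.trans (le_of_eq ?_))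
    ring
  refine h3.trans (le_of_eq ?_)
  rw [← mul_assoc, show (2 : ENNReal) = ENNReal.ofReal 2 by simp, ← ENNReal.ofReal_mul two_pos.le]
  congr 2
  rw [mul_assoc (2 * _), ← mul_rpow (by positivity) ha.le, div_mul_eq_mul_div]
  ring

lemma pe_mul_inv (n : ℕ) : pe n * (1 / (2 * n + 3)) = pe n - 2 := by
  unfold pe; field_simp; ring

lemma two_div_pe (n : ℕ) : 2 / pe n = 1 - 1 / (2 * n + 3) := by
  unfold pe; field_simp; ring

/-- Dyadic level sets. -/
def lev (v : QH n → ℝ) (k : ℤ) : Set (QH n) := {g | (2 : ℝ) ^ k ≤ |v g| ∧ |v g| < 2 ^ (k + 1)}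

lemma measurableSet_lev {v : QH n → ℝ} (hv : Continuous v) (k : ℤ) : MeasurableSet (lev v k) :=
  (measurableSet_le measurable_const hv.abs.measurable).inter
    (measurableSet_lt hv.abs.measurable measurable_const)

lemma pairwise_disjoint_lev (v : QH n → ℝ) : Pairwise (Function.onFun Disjoint (lev v)) := by
  have key : ∀ i j : ℤ, i < j → Disjoint (lev v i) (lev v j) := fun i j hij =>
    Set.disjoint_left.2 fun g hi hj => by
      have := zpow_le_zpow_right₀ (one_le_two (α := ℝ)) (show i + 1 ≤ j by omega)
      linarith [hi.2, hj.1]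
  intro i j hij
  rcases lt_or_gt_of_ne hij with h | h
  · exact key i j h
  · exact (key j i h).symm

lemma exists_lintegral_sobolev (hn : 1 ≤ n) : ∃ K : ℝ, 0 < K ∧ ∀ v : QH n → ℝ, ContDiff ℝ 1 v →
    HasCompactSupport v →
    ∫⁻ g, ENNReal.ofReal (|v g| ^ pe n)
      ≤ ENNReal.ofReal (K * (∫ g, |v g| ^ pe n) ^ (1 / (2 * n + 3) : ℝ))
        * ∫⁻ g, ENNReal.ofReal (hGradSq n v g) := by
  obtain ⟨C, hC, hw⟩ := exists_weak_sobolev hn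
  obtain ⟨ψ, L, hL, hψ, -, hψ0, hψ1, hψL, hψd⟩ := exists_cutoff
  refine ⟨4 ^ pe n * C * (L ^ 2 + 1), by positivity, fun v hv hvc => ?_⟩
  have hp := pe_pos n
  have hvcont := hv.continuous
  set I := ∫ g, |v g| ^ pe n with hI
  set γ : ℝ := 1 / (2 * n + 3) with hγ
  have hγ0 : 0 < γ := by positivity
  have hcp : Continuous fun g => |v g| ^ pe n :=
    hvcont.abs.rpow_const fun _ => Or.inr hp.le
  have h_int : Integrable fun g => |v g| ^ pe n := by
    refine hcp.integrable_of_hasCompactSupport ?_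
    exact hvc.comp_left (g := fun s => |s| ^ pe n) (by simp [hp.ne'])
  have hI0 : 0 ≤ I := integral_nonneg fun g => by positivity
  set M : ℝ := 4 ^ pe n * C * (L ^ 2 + 1) * I ^ γ with hM
  have hstep : ∀ k : ℤ, ∫⁻ g in lev v (k + 1), ENNReal.ofReal (|v g| ^ pe n)
      ≤ ENNReal.ofReal M * ∫⁻ g in lev v k, ENNReal.ofReal (hGradSq n v g) := by
    intro k
    set T : ℝ := 2 ^ k with hT
    have hT0 : 0 < T := by positivity
    have hT1 : (2 : ℝ) ^ (k + 1) = 2 * T := by rw [zpow_add_one₀ two_ne_zero]; ring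
    have hT2 : (2 : ℝ) ^ (k + 1 + 1) = 4 * T := by rw [zpow_add_one₀ two_ne_zero, hT1]; ring
    have hmeas : ∀ s : ℝ, MeasurableSet {g : QH n | s ≤ |v g|} := fun s =>
      measurableSet_le measurable_const hvcont.abs.measurable
    set A : Set (QH n) := {g | T ≤ |v g|}
    set B : Set (QH n) := {g | 2 * T ≤ |v g|}
    have hAc : volume A ≠ ⊤ := by
      refine (lt_of_le_of_lt (measure_mono fun g hg => ?_) hvc.isCompact.measure_lt_top).ne
      refine subset_tsupport v fun h0 => ?_
      have : T ≤ |v g| := hg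
      rw [h0, abs_zero] at this; linarith
    set a := (volume A).toReal
    have hmark : T ^ pe n * a ≤ I := by
      have h1 := mul_meas_ge_le_integral_of_nonneg (μ := volume)
        (f := fun g => |v g| ^ pe n) (.of_forall fun g => by positivity) h_int (T ^ pe n)
      refine le_trans (le_of_eq ?_) h1
      congr 1
      simp only [a, Measure.real]
      congr 2
      ext g
      exact (rpow_le_rpow_iff hT0.le (abs_nonneg _) hp).symm
    have hag : T ^ (pe n - 2) * a ^ γ ≤ I ^ γ := by
      have := rpow_le_rpow (by positivity) hmark hγ0.le
      rwa [mul_rpow (by positivity) (by positivity), ← rpow_mul hT0.le, hγ, pe_mul_inv] at this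
    have hdiff : ∀ g, HasDerivAt (fun s => T * ψ (T⁻¹ * s)) (deriv ψ (T⁻¹ * v g)) (v g) := by
      intro g
      have h1 : HasDerivAt ψ (deriv ψ (T⁻¹ * v g)) (T⁻¹ * v g) :=
        (hψ.differentiable (by simp) _).hasDerivAt
      have h2 := (h1.comp (v g) ((hasDerivAt_id (v g)).const_mul T⁻¹)).const_mul T
      exact h2.congr_deriv (by field_simp)
    have habs : ∀ g, |T⁻¹ * v g| = |v g| / T := fun g => by
      rw [abs_mul, abs_of_pos (inv_pos.2 hT0)]; ring
    have hu : ContDiff ℝ 1 fun g => T * ψ (T⁻¹ * v g) :=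
      contDiff_const.mul ((hψ.of_le (by exact_mod_cast le_top)).comp (contDiff_const.mul hv))
    have hweak := hw _ hu A B T (hmeas _) (hmeas _) hAc
      (fun g hg => by
        have hg' : |v g| < T := not_le.1 hg
        rw [hψ0 _ (by rw [habs, div_le_one hT0]; exact hg'.le), mul_zero])
      (fun g hg => by
        have hg' : 2 * T ≤ |v g| := hg
        rw [hψ1 _ (by rw [habs, le_div_iff₀ hT0]; exact hg'), mul_one])
    have hgrad : ∫⁻ g, ENNReal.ofReal (hGradSq n (fun g => T * ψ (T⁻¹ * v g)) g)
        ≤ ENNReal.ofReal (L ^ 2 + 1) * ∫⁻ g in lev v k, ENNReal.ofReal (hGradSq n v g) := by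
      rw [← lintegral_const_mul' _ _ ENNReal.ofReal_ne_top,
        ← lintegral_indicator (measurableSet_lev hvcont k)]
      refine lintegral_mono fun g => ?_
      rw [hGradSq_comp (f := fun s => T * ψ (T⁻¹ * s)) (hdiff g)
        (hv.differentiable one_ne_zero g)]
      by_cases hg : g ∈ lev v k
      · rw [Set.indicator_of_mem hg, ← ENNReal.ofReal_mul (by positivity)]
        refine ENNReal.ofReal_le_ofReal (mul_le_mul_of_nonneg_right ?_ (hGradSq_nonneg _ _))
        have := sq_le_sq' (by linarith [neg_abs_le (deriv ψ (T⁻¹ * v g)), hψL (T⁻¹ * v g)])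
          ((le_abs_self _).trans (hψL (T⁻¹ * v g)))
        linarith
      · rw [hψd]
        · simp
        · rw [habs, div_lt_one hT0, le_div_iff₀ hT0]
          by_contra! h
          exact hg ⟨h.1, by rw [hT1]; exact h.2⟩
    calc ∫⁻ g in lev v (k + 1), ENNReal.ofReal (|v g| ^ pe n)
        ≤ ∫⁻ g in lev v (k + 1), ENNReal.ofReal ((4 * T) ^ pe n) := by
          refine setLIntegral_mono' (measurableSet_lev hvcont _) fun g hg => ?_
          refine ENNReal.ofReal_le_ofReal (rpow_le_rpow (abs_nonneg _) ?_ hp.le)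
          rw [← hT2]; exact hg.2.le
      _ = ENNReal.ofReal ((4 * T) ^ pe n) * volume (lev v (k + 1)) := by rw [setLIntegral_const]
      _ ≤ ENNReal.ofReal ((4 * T) ^ pe n) * volume B := by
          refine mul_le_mul_right (measure_mono fun g hg => ?_) _
          have := hg.1
          rw [hT1] at this
          exact this
      _ = ENNReal.ofReal (4 ^ pe n * T ^ (pe n - 2)) * (ENNReal.ofReal (T ^ 2) * volume B) := by
          rw [← mul_assoc, ← ENNReal.ofReal_mul (by positivity)]
          congr 2
          rw [mul_rpow (by norm_num) hT0.le, mul_assoc, ← rpow_natCast T 2, ← rpow_add hT0]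
          congr 2; push_cast; ring
      _ ≤ ENNReal.ofReal (4 ^ pe n * T ^ (pe n - 2)) * (ENNReal.ofReal (C * a ^ γ)
            * (ENNReal.ofReal (L ^ 2 + 1) * ∫⁻ g in lev v k, ENNReal.ofReal (hGradSq n v g))) :=
          mul_le_mul_right (hweak.trans (mul_le_mul_right hgrad _)) _
      _ ≤ ENNReal.ofReal M * ∫⁻ g in lev v k, ENNReal.ofReal (hGradSq n v g) := by
          rw [← mul_assoc, ← mul_assoc, ← ENNReal.ofReal_mul (by positivity),
            ← ENNReal.ofReal_mul (by positivity)]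
          refine mul_le_mul_left (ENNReal.ofReal_le_ofReal ?_) _
          rw [hM]
          have : 0 ≤ 4 ^ pe n * C * (L ^ 2 + 1) := by positivity
          calc _ = 4 ^ pe n * C * (L ^ 2 + 1) * (T ^ (pe n - 2) * a ^ γ) := by ring
            _ ≤ _ := mul_le_mul_of_nonneg_left hag this
  calc ∫⁻ g, ENNReal.ofReal (|v g| ^ pe n)
      = ∫⁻ g in ⋃ k : ℤ, lev v (k + 1), ENNReal.ofReal (|v g| ^ pe n) := by
        refine (setLIntegral_eq_of_support_subset fun g hg => ?_).symm
        have hg0 : 0 < |v g| := abs_pos.2 fun h => hg (by simp [h, hp.ne'])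
        obtain ⟨k, hk1, hk2⟩ := exists_mem_Ico_zpow hg0 (one_lt_two (α := ℝ))
        refine Set.mem_iUnion.2 ⟨k - 1, ?_⟩
        rw [sub_add_cancel]
        exact ⟨hk1, hk2⟩
    _ ≤ ∑' k : ℤ, ∫⁻ g in lev v (k + 1), ENNReal.ofReal (|v g| ^ pe n) := lintegral_iUnion_le _ _
    _ ≤ ∑' k : ℤ, ENNReal.ofReal M * ∫⁻ g in lev v k, ENNReal.ofReal (hGradSq n v g) :=
        ENNReal.tsum_le_tsum hstep
    _ = ENNReal.ofReal M * ∫⁻ g in ⋃ k, lev v k, ENNReal.ofReal (hGradSq n v g) := by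
        rw [ENNReal.tsum_mul_left, lintegral_iUnion (measurableSet_lev hvcont)
          (pairwise_disjoint_lev v)]
    _ ≤ _ := mul_le_mul_right (setLIntegral_le_lintegral _ _) _

/-- A Sobolev inequality with a non-optimal constant. -/
lemma exists_sobolev (hn : 1 ≤ n) : ∃ C : ℝ, 0 < C ∧ ∀ v : QH n → ℝ, ContDiff ℝ 1 v →
    HasCompactSupport v →
    C * (∫ g, |v g| ^ pe n) ^ (2 / pe n) ≤ ∫ g, hGradSq n v g := by
  obtain ⟨K, hK, h⟩ := exists_lintegral_sobolev hn
  refine ⟨K⁻¹, inv_pos.2 hK, fun v hv hvc => ?_⟩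
  have hp := pe_pos n
  have h1 := h v hv hvc
  have hcp : Continuous fun g => |v g| ^ pe n :=
    hv.continuous.abs.rpow_const fun _ => Or.inr hp.le
  have h_int : Integrable fun g => |v g| ^ pe n := by
    refine hcp.integrable_of_hasCompactSupport ?_
    exact hvc.comp_left (g := fun s => |s| ^ pe n) (by simp [hp.ne'])
  rw [← ofReal_integral_eq_lintegral_ofReal h_int (.of_forall fun g => by positivity),
    ← ofReal_integral_eq_lintegral_ofReal (integrable_hGradSq hv hvc)
      (.of_forall fun g => hGradSq_nonneg _ _)] at h1
  set I := ∫ g, |v g| ^ pe n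
  have hI0 : 0 ≤ I := integral_nonneg fun g => by positivity
  have hE0 : 0 ≤ ∫ g, hGradSq n v g := integral_nonneg fun g => hGradSq_nonneg _ _
  rw [← ENNReal.ofReal_mul (by positivity), ENNReal.ofReal_le_ofReal_iff (by positivity)] at h1
  rcases hI0.eq_or_lt with h0 | h0
  · rw [← h0, zero_rpow (div_pos two_pos hp).ne', mul_zero]; exact hE0
  · rw [two_div_pe, inv_mul_le_iff₀ hK, rpow_sub h0, rpow_one, div_le_iff₀ (by positivity)]
    linarith

lemma inv_FF_pos (g : QH n) : 0 < (FF n g)⁻¹ := inv_pos.2 (FF_pos g)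

lemma bubble_rpow (g : QH n) : (((FF n g)⁻¹) ^ (n + 1)) ^ pe n = ((FF n g)⁻¹) ^ (2 * n + 3) := by
  have h0 := (inv_FF_pos g).le
  rw [← rpow_natCast _ (n + 1), ← rpow_mul h0, mul_comm]
  push_cast
  rw [pe_mul, ← rpow_natCast _ (2 * n + 3)]
  push_cast; rfl

lemma hd_bubble (α : Fin n) (e : ℝ × ℝ × ℝ × ℝ) (g : QH n) :
    hd α e (fun x => ((FF n x)⁻¹) ^ (n + 1)) g
      = -((n + 1) * (((FF n g)⁻¹) ^ (n + 1) * ((FF n g)⁻¹ * dFF α e g))) := by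
  have hF : FF n g ≠ 0 := (FF_pos g).ne'
  have d1 : DifferentiableAt ℝ (fun x => (FF n x)⁻¹) g := (differentiable_FF g).inv hF
  rw [hd_pow _ d1, hd_inv (by fun_prop) hF, hd_FF]
  rw [Nat.add_sub_cancel, ← inv_pow]
  push_cast; ring

lemma rem_mul_bubble {u : QH n → ℝ} (hu : Differentiable ℝ u) (g : QH n) :
    rem (fun x => u x * ((FF n x)⁻¹) ^ (n + 1)) g
      = hGradSq n u g * ((FF n g)⁻¹) ^ (2 * n + 2) := by
  have hF : FF n g ≠ 0 := (FF_pos g).ne'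
  have d2 : DifferentiableAt ℝ (fun x => ((FF n x)⁻¹) ^ (n + 1)) g :=
    ((differentiable_FF g).inv hF).pow _
  rw [rem, hGradSq_eq, hGrad, Finset.sum_mul]
  refine Finset.sum_congr rfl fun α _ => ?_
  rw [Finset.sum_mul]
  refine Finset.sum_congr rfl fun i _ => ?_
  rw [hd_mul (hu g) d2, hd_bubble]
  ring

lemma rem_sub_mul_le {v b : QH n → ℝ} (hv : Differentiable ℝ v) (hb : Differentiable ℝ b) (c : ℝ)
    (g : QH n) : rem (fun x => v x - c * b x) g ≤ 2 * rem v g + 2 * c ^ 2 * rem b g := by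
  simp only [rem, Finset.mul_sum, ← Finset.sum_add_distrib]
  refine Finset.sum_le_sum fun α _ => Finset.sum_le_sum fun i _ => ?_
  rw [hd_sub (hv g) ((hb g).const_mul c), hd_const_mul c (hb g)]
  set x := hd α (qb i) v g + (n + 1) * (v g * ((FF n g)⁻¹ * dFF α (qb i) g))
  set y := hd α (qb i) b g + (n + 1) * (b g * ((FF n g)⁻¹ * dFF α (qb i) g))
  have : hd α (qb i) v g - c * hd α (qb i) b g
      + (n + 1) * ((v g - c * b g) * ((FF n g)⁻¹ * dFF α (qb i) g)) = x - c * y := by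
    simp only [x, y]; ring
  rw [this]
  nlinarith [sq_nonneg (x + c * y)]

lemma hGradSq_FF_le (g : QH n) : hGradSq n (FF n) g ≤ 16 * FF n g ^ 2 := by
  rw [hGradSq_eq, hGrad]
  simp only [hd_FF]
  rw [sum_dFF_sq]
  have h1 : qSq n g ≤ FF n g := by unfold FF; nlinarith [qSq_nonneg g, wSq_nonneg g]
  nlinarith [FF_pos g]

/-- The volume `∫ F^{-(2n+3)}`. -/
noncomputable def Vol (n : ℕ) : ℝ := ∫ g : QH n, ((FF n g)⁻¹) ^ (2 * n + 3)

lemma Vol_pos : 0 < Vol n := integral_inv_FF_pow_pos (by omega)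

lemma Vol_tail_le {T : QH n → ℝ} (hT : Continuous T) (h0 : ∀ g, 0 ≤ T g)
    (h1 : ∀ g, T g ≤ ((FF n g)⁻¹) ^ (2 * n + 3)) {k : ℝ} (hk : 0 < k)
    (h2 : ∀ g, FF n g ≤ k → T g = ((FF n g)⁻¹) ^ (2 * n + 3)) :
    Vol n - (∫ g : QH n, ((FF n g)⁻¹) ^ (2 * n + 2)) / k ≤ ∫ g, T g ∧ ∫ g, T g ≤ Vol n := by
  have i1 : Integrable fun g : QH n => ((FF n g)⁻¹) ^ (2 * n + 3) :=
    integrable_inv_FF_pow (by omega)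
  have i2 : Integrable fun g : QH n => ((FF n g)⁻¹) ^ (2 * n + 2) :=
    integrable_inv_FF_pow (by omega)
  have iT : Integrable T := i1.mono' hT.aestronglyMeasurable (.of_forall fun g => by
    rw [norm_of_nonneg (h0 g)]; exact h1 g)
  refine ⟨?_, integral_mono iT i1 h1⟩
  rw [Vol, ← integral_div, ← integral_sub i1 (i2.div_const k)]
  refine integral_mono (i1.sub (i2.div_const k)) iT fun g => ?_
  have hF := inv_FF_pos g
  rcases le_or_gt (FF n g) k with h | h
  · simp only [h2 g h]
    have : 0 ≤ ((FF n g)⁻¹) ^ (2 * n + 2) / k := by positivity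
    linarith
  · refine le_trans ?_ (h0 g)
    have : (FF n g)⁻¹ ≤ k⁻¹ := inv_anti₀ hk h.le
    simp only [sub_nonpos]
    rw [pow_succ, div_eq_mul_inv]
    exact mul_le_mul_of_nonneg_left this (by positivity)

/-- Truncations of the extremal function `F^{-(n+1)}`. -/
lemma exists_truncations (hn : 1 ≤ n) : ∃ A : ℝ, 0 ≤ A ∧ ∀ k : ℝ, 1 ≤ k → ∃ b : QH n → ℝ, Test b ∧
    (∀ g, FF n g ≤ k → b g = ((FF n g)⁻¹) ^ (n + 1)) ∧ ∫ g, rem b g ≤ A / k ∧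
    (Vol n - A / k ≤ ∫ g, b g ^ pe n) ∧ ∫ g, b g ^ pe n ≤ Vol n ∧
    (Vol n - A / k ≤ ∫ g, b g ^ 2 * (FF n g)⁻¹) ∧ ∫ g, b g ^ 2 * (FF n g)⁻¹ ≤ Vol n := by
  obtain ⟨ψ, L, hL, hψ, hψ01, hψ0, hψ1, hψL, hψd⟩ := exists_cutoff
  set J : ℝ := ∫ g : QH n, ((FF n g)⁻¹) ^ (2 * n + 1)
  set J' : ℝ := ∫ g : QH n, ((FF n g)⁻¹) ^ (2 * n + 2)
  have hJ : 0 ≤ J := integral_nonneg fun g => pow_nonneg (inv_FF_pos g).le _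
  have hJ' : 0 ≤ J' := integral_nonneg fun g => pow_nonneg (inv_FF_pos g).le _
  have iJ : Integrable fun g : QH n => ((FF n g)⁻¹) ^ (2 * n + 1) :=
    integrable_inv_FF_pow (by omega)
  refine ⟨32 * L ^ 2 * J + J', by positivity, fun k hk => ?_⟩
  have hk0 : 0 < k := zero_lt_one.trans_le hk
  set χ : QH n → ℝ := fun g => 1 - ψ (k⁻¹ * FF n g) with hχ
  set b : QH n → ℝ := fun g => χ g * ((FF n g)⁻¹) ^ (n + 1) with hb
  have hs : ContDiff ℝ (⊤ : ℕ∞) χ :=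
    contDiff_const.sub (hψ.comp (contDiff_const.mul contDiff_FF))
  have hbs : ContDiff ℝ (⊤ : ℕ∞) b := hs.mul (contDiff_inv_FF.pow _)
  have harg : ∀ g, |k⁻¹ * FF n g| = FF n g / k := fun g => by
    rw [abs_of_pos (mul_pos (inv_pos.2 hk0) (FF_pos g))]; ring
  have hχ01 : ∀ g, 0 ≤ χ g ∧ χ g ≤ 1 := fun g => by
    have := hψ01 (k⁻¹ * FF n g); simp only [hχ]; constructor <;> linarith
  have hχ1 : ∀ g, FF n g ≤ k → χ g = 1 := fun g hg => by
    simp only [hχ]; rw [hψ0 _ (by rw [harg, div_le_one hk0]; exact hg), sub_zero]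
  have hχc : HasCompactSupport χ := by
    refine HasCompactSupport.intro (isCompact_FF_le (2 * k)) fun g hg => ?_
    have hg' : 2 * k < FF n g := not_le.1 hg
    simp only [hχ]
    rw [hψ1 _ (by rw [harg, le_div_iff₀ hk0]; exact hg'.le), sub_self]
  have hbt : Test b := ⟨hbs, hχc.mul_right, fun g =>
    mul_nonneg (hχ01 g).1 (pow_nonneg (inv_FF_pos g).le _)⟩
  have hb1 : ∀ g, FF n g ≤ k → b g = ((FF n g)⁻¹) ^ (n + 1) := fun g hg => by
    simp only [hb, hχ1 g hg, one_mul]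
  have hble : ∀ g, b g ≤ ((FF n g)⁻¹) ^ (n + 1) := fun g =>
    mul_le_of_le_one_left (pow_nonneg (inv_FF_pos g).le _) (hχ01 g).2
  have hAk : J' / k ≤ (32 * L ^ 2 * J + J') / k := by
    refine div_le_div_of_nonneg_right ?_ hk0.le
    have : 0 ≤ 32 * L ^ 2 * J := by positivity
    linarith
  have hp := Vol_tail_le (hbt.continuous_rpow (pe_pos n).le)
    (fun g => rpow_nonneg (hbt.nonneg g) _)
    (fun g => by rw [← bubble_rpow]; exact rpow_le_rpow (hbt.nonneg g) (hble g) (pe_pos n).le) hk0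
    (fun g hg => by rw [hb1 g hg, bubble_rpow])
  have hsq : ∀ x : ℝ, (x ^ (n + 1)) ^ 2 * x = x ^ (2 * n + 3) := fun x => by ring
  have h2 := Vol_tail_le (T := fun g => b g ^ 2 * (FF n g)⁻¹)
    ((hbs.continuous.pow 2).mul continuous_inv_FF)
    (fun g => mul_nonneg (sq_nonneg _) (inv_FF_pos g).le)
    (fun g => by
      rw [← hsq]
      exact mul_le_mul_of_nonneg_right (pow_le_pow_left₀ (hbt.nonneg g) (hble g) 2)
        (inv_FF_pos g).le) hk0
    (fun g hg => by simp only [hb1 g hg, hsq])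
  refine ⟨b, hbt, hb1, ?_, by linarith [hp.1], hp.2, by linarith [h2.1], h2.2⟩
  have hrem : ∀ g, rem b g ≤ 32 * L ^ 2 / k * ((FF n g)⁻¹) ^ (2 * n + 1) := by
    intro g
    have hF := FF_pos g
    have hder : HasDerivAt (fun s => 1 - ψ (k⁻¹ * s)) (-(deriv ψ (k⁻¹ * FF n g) * k⁻¹)) (FF n g) := by
      have h1 : HasDerivAt ψ (deriv ψ (k⁻¹ * FF n g)) (k⁻¹ * FF n g) :=
        (hψ.differentiable (by simp) _).hasDerivAt
      have h2 := (h1.comp (FF n g) ((hasDerivAt_id (FF n g)).const_mul k⁻¹)).const_sub 1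
      exact h2.congr_deriv (by simp)
    rw [hb, rem_mul_bubble (hs.differentiable (by simp)), hχ,
      hGradSq_comp (f := fun s => 1 - ψ (k⁻¹ * s)) hder (differentiable_FF g)]
    rcases lt_or_ge (FF n g) (2 * k) with h | h
    · have h3 : (-(deriv ψ (k⁻¹ * FF n g) * k⁻¹)) ^ 2 ≤ L ^ 2 * (k⁻¹) ^ 2 := by
        rw [neg_sq, mul_pow]
        refine mul_le_mul_of_nonneg_right ?_ (sq_nonneg _)
        exact sq_le_sq' (by linarith [neg_abs_le (deriv ψ (k⁻¹ * FF n g)), hψL (k⁻¹ * FF n g)])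
          ((le_abs_self _).trans (hψL _))
      have h4 : hGradSq n (FF n) g ≤ 32 * k * FF n g := by
        refine (hGradSq_FF_le g).trans ?_
        nlinarith
      have h5 := mul_le_mul h3 h4 (hGradSq_nonneg _ _) (by positivity)
      have h6 := mul_le_mul_of_nonneg_right h5 (pow_nonneg (inv_FF_pos g).le (2 * n + 2))
      refine h6.trans (le_of_eq ?_)
      rw [show 2 * n + 2 = 2 * n + 1 + 1 from rfl, pow_succ (FF n g)⁻¹]
      generalize ((FF n g)⁻¹) ^ (2 * n + 1) = y
      field_simp
    · rw [hψd _ (Or.inr (by rw [harg, le_div_iff₀ hk0]; exact h))]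
      have := inv_FF_pos g
      simp only [zero_mul, neg_zero, ne_eq, OfNat.ofNat_ne_zero, not_false_eq_true, zero_pow]
      positivity
  have h7 := integral_mono (integrable_rem (hbs.of_le (by exact_mod_cast le_top)) hbt.compact)
    (iJ.const_mul (32 * L ^ 2 / k)) hrem
  rw [integral_const_mul] at h7
  refine h7.trans ?_
  rw [div_mul_eq_mul_div]
  refine div_le_div_of_nonneg_right ?_ hk0.le
  change 32 * L ^ 2 * J ≤ _
  linarith

lemma isCompact_iterate_thick {r : ℝ} {A : Set (QH n)} (hA : IsCompact A) (k : ℕ) :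
    IsCompact ((thick r)^[k] A) := by
  induction k generalizing A with
  | zero => exact hA
  | succ k ih => exact ih (isCompact_thick hA)

/-- A Poincaré inequality on the sublevel sets of `F`, in terms of the energy remainder. -/
lemma exists_local_poincare (hn : 1 ≤ n) {R : ℝ} (hR : 1 < R) : ∃ K : ℝ, 0 < K ∧
    ∀ v : QH n → ℝ, ContDiff ℝ 1 v → HasCompactSupport v → ∃ g₀ : QH n,
      ∫⁻ g in {g | FF n g ≤ R}, ENNReal.ofReal
        ((v g * FF n g ^ (n + 1) - v g₀ * FF n g₀ ^ (n + 1)) ^ 2)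
        ≤ ENNReal.ofReal (K * ∫ g, rem v g) := by
  set B : Set (QH n) := {g | FF n g ≤ R} with hB
  have hBc : IsCompact B := isCompact_FF_le R
  have hBm : MeasurableSet B := hBc.measurableSet
  have hB0 : volume B ≠ 0 := by
    have ho : IsOpen {g : QH n | FF n g < R} := isOpen_lt continuous_FF continuous_const
    have hne : ({g : QH n | FF n g < R}).Nonempty := ⟨0, by
      simpa [FF, qSq, wSq, tC, xC, yC, zC] using hR⟩
    exact ((ho.measure_pos volume hne).trans_le (measure_mono fun g hg => le_of_lt (show FF n g < R from hg))).ne'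
  have hB1 : volume B ≠ ⊤ := hBc.measure_lt_top.ne
  have hIc : IsCompact ((fun x : QH n × QH n => op n (-x.1) x.2) '' (B ×ˢ B)) :=
    (hBc.prod hBc).image (by fun_prop)
  obtain ⟨ρ, hρ⟩ := hIc.isBounded.exists_norm_le
  set r := max ρ 1
  have hr1 : 1 ≤ r := le_max_right _ _
  have hr0 : 0 < r := zero_lt_one.trans_le hr1
  have hbox : ∀ g ∈ B, ∀ g' ∈ B, op n (-g) g' ∈ box n r := fun g hg g' hg' => by
    have h1 : ‖op n (-g) g'‖ ≤ r :=
      (hρ _ ⟨(g, g'), ⟨hg, hg'⟩, rfl⟩).trans (le_max_left _ _)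
    exact mem_box.2 ⟨(norm_fst_le _).trans h1, ((norm_snd_le _).trans h1).trans (by nlinarith)⟩
  set B' := (thick r)^[5] B
  have hB' : IsCompact B' := isCompact_iterate_thick hBc 5
  obtain ⟨M, hM⟩ := (hB'.bddAbove_image (f := fun g => FF n g ^ (2 * n + 2))
    (continuous_FF.pow _).continuousOn)
  have hM' : ∀ g ∈ B', FF n g ^ (2 * n + 2) ≤ |M| + 1 := fun g hg =>
    (hM ⟨g, hg, rfl⟩).trans (by linarith [le_abs_self M])
  set V := volume (box n r)
  have hV : V ≠ ⊤ := (isCompact_box r).measure_lt_top.ne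
  have hBp : 0 < (volume B).toReal := ENNReal.toReal_pos hB0 hB1
  have hn0 : (0 : ℝ) < n := by exact_mod_cast hn
  refine ⟨((V.toReal + 1) * (4 ^ 6 * n * r ^ 2 * (|M| + 1))) / (volume B).toReal, by positivity,
    fun v hv hvc => ?_⟩
  set u : QH n → ℝ := fun g => v g * FF n g ^ (n + 1) with hu
  have hu1 : ContDiff ℝ 1 u := hv.mul (contDiff_FF.pow _)
  have huc := hu1.continuous
  set D := ∫ g, rem v g
  have hD0 : 0 ≤ D := integral_nonneg fun g => rem_nonneg _ _
  have hgrad : ∀ g, hGradSq n u g = rem v g * FF n g ^ (2 * n + 2) := by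
    intro g
    have h1 := rem_mul_bubble (hu1.differentiable one_ne_zero) g
    have h2 : (fun x => u x * ((FF n x)⁻¹) ^ (n + 1)) = v := by
      funext x
      have := (FF_pos x).ne'
      simp only [hu, inv_pow]
      rw [mul_inv_cancel_right₀ (pow_ne_zero _ this)]
    rw [h2] at h1
    rw [h1, inv_pow, inv_mul_cancel_right₀ (pow_ne_zero _ (FF_pos g).ne')]
  have hgi : ∫⁻ g in B', ENNReal.ofReal (hGradSq n u g) ≤ ENNReal.ofReal ((|M| + 1) * D) := by
    calc ∫⁻ g in B', ENNReal.ofReal (hGradSq n u g)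
        ≤ ∫⁻ g in B', ENNReal.ofReal (|M| + 1) * ENNReal.ofReal (rem v g) := by
          refine setLIntegral_mono' hB'.measurableSet fun g hg => ?_
          rw [← ENNReal.ofReal_mul (by positivity), hgrad, mul_comm]
          exact ENNReal.ofReal_le_ofReal (mul_le_mul_of_nonneg_right (hM' g hg) (rem_nonneg _ _))
      _ ≤ ∫⁻ g, ENNReal.ofReal (|M| + 1) * ENNReal.ofReal (rem v g) :=
          setLIntegral_le_lintegral _ _
      _ = _ := by
          rw [lintegral_const_mul' _ _ ENNReal.ofReal_ne_top,
            ← ofReal_integral_eq_lintegral_ofReal (integrable_rem hv hvc)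
              (.of_forall fun g => rem_nonneg _ _), ← ENNReal.ofReal_mul (by positivity)]
  have hjc : Continuous fun x : QH n × QH n => ENNReal.ofReal ((u x.2 - u x.1) ^ 2) :=
    ENNReal.continuous_ofReal.comp (by fun_prop)
  have hjc' : Continuous fun x : QH n × QH n => ENNReal.ofReal ((u (op n x.1 x.2) - u x.1) ^ 2) :=
    ENNReal.continuous_ofReal.comp (by fun_prop)
  set f : QH n → ENNReal := fun g₀ => ∫⁻ g in B, ENNReal.ofReal ((u g - u g₀) ^ 2)
  have hfm : Measurable f := hjc.measurable.lintegral_prod_right'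
  have htot : ∫⁻ g in B, f g ≤ V * (ENNReal.ofReal (4 ^ 6 * n * r ^ 2)
      * ENNReal.ofReal ((|M| + 1) * D)) := by
    calc ∫⁻ g in B, f g ≤ ∫⁻ g in B, ∫⁻ h in box n r,
          ENNReal.ofReal ((u (op n g h) - u g) ^ 2) := by
          refine setLIntegral_mono' hBm fun g hg => ?_
          have h1 := (measurePreserving_opL g).setLIntegral_comp_preimage_emb
            (opL g).measurableEmbedding (fun x => ENNReal.ofReal ((u x - u g) ^ 2)) B
          simp only [f]
          rw [← h1]
          simp only [opL_apply]
          refine lintegral_mono_set fun h hh => ?_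
          have hh' : op n g h ∈ B := by rwa [Set.mem_preimage, opL_apply] at hh
          have := hbox g hg _ hh'
          rwa [neg_op_cancel] at this
      _ = ∫⁻ h in box n r, ∫⁻ g in B, ENNReal.ofReal ((u (op n g h) - u g) ^ 2) :=
          lintegral_lintegral_swap hjc'.measurable.aemeasurable
      _ ≤ ∫⁻ h in box n r, ENNReal.ofReal (4 ^ 6 * n * r ^ 2)
            * ENNReal.ofReal ((|M| + 1) * D) := by
          refine setLIntegral_mono' (isCompact_box _).measurableSet fun h hh => ?_
          obtain ⟨h1, h2⟩ := mem_box.1 hh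
          exact (lintegral_translate_le hn hu1 hr0 h1 h2 B).trans (mul_le_mul_right hgi _)
      _ = _ := by rw [setLIntegral_const, mul_comm]
  obtain ⟨g₀, -, hg₀⟩ := exists_le_setLAverage hB0 hB1 hfm.aemeasurable
  refine ⟨g₀, ?_⟩
  change f g₀ ≤ _
  refine hg₀.trans ?_
  rw [setLAverage_eq]
  refine ENNReal.div_le_of_le_mul (htot.trans ?_)
  rw [← ENNReal.ofReal_toReal hV, ← ENNReal.ofReal_toReal hB1, ← ENNReal.ofReal_mul (by positivity),
    ← ENNReal.ofReal_mul (by positivity), ← ENNReal.ofReal_mul (by positivity),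
    ENNReal.toReal_ofReal ENNReal.toReal_nonneg, ENNReal.toReal_ofReal ENNReal.toReal_nonneg]
  refine ENNReal.ofReal_le_ofReal ?_
  rw [div_mul_eq_mul_div, div_mul_cancel₀ _ hBp.ne']
  have h9 : 0 ≤ 4 ^ 6 * n * r ^ 2 * ((|M| + 1) * D) := by positivity
  nlinarith

lemma integral_mul_le_rpow_mul_rpow {α : Type*} [MeasurableSpace α] {μ : Measure α} {p q : ℝ}
    (hpq : p.HolderConjugate q) {a b : α → ℝ} (ha : ∀ x, 0 ≤ a x) (hb : ∀ x, 0 ≤ b x)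
    (ham : AEStronglyMeasurable a μ) (hbm : AEStronglyMeasurable b μ)
    (hai : Integrable (fun x => a x ^ p) μ) (hbi : Integrable (fun x => b x ^ q) μ) {A B : ℝ}
    (hA : ∫ x, a x ^ p ∂μ ≤ A) (hB : ∫ x, b x ^ q ∂μ ≤ B) :
    ∫ x, a x * b x ∂μ ≤ A ^ (1 / p) * B ^ (1 / q) := by
  have hp := hpq.pos
  have hq := hpq.symm.pos
  have h1 : MemLp a (ENNReal.ofReal p) μ := by
    refine (integrable_norm_rpow_iff ham (by simpa using hp) ENNReal.ofReal_ne_top).1 ?_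
    rw [ENNReal.toReal_ofReal hp.le]
    simpa only [norm_of_nonneg (ha _)] using hai
  have h2 : MemLp b (ENNReal.ofReal q) μ := by
    refine (integrable_norm_rpow_iff hbm (by simpa using hq) ENNReal.ofReal_ne_top).1 ?_
    rw [ENNReal.toReal_ofReal hq.le]
    simpa only [norm_of_nonneg (hb _)] using hbi
  refine (integral_mul_le_Lp_mul_Lq_of_nonneg hpq (.of_forall ha) (.of_forall hb) h1 h2).trans ?_
  have n1 : 0 ≤ ∫ x, a x ^ p ∂μ := integral_nonneg fun x => rpow_nonneg (ha x) _
  have n2 : 0 ≤ ∫ x, b x ^ q ∂μ := integral_nonneg fun x => rpow_nonneg (hb x) _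
  exact mul_le_mul (rpow_le_rpow n1 hA (by positivity)) (rpow_le_rpow n2 hB (by positivity))
    (rpow_nonneg n2 _) (rpow_nonneg (n1.trans hA) _)

lemma setIntegral_sq_inv_FF_le {w : QH n → ℝ} (hw : Continuous w) (hwc : HasCompactSupport w)
    {R : ℝ} (hR : 0 < R) :
    ∫ g in {g | R < FF n g}, w g ^ 2 * (FF n g)⁻¹
      ≤ (∫ g, |w g| ^ pe n) ^ (2 / pe n)
        * ((∫ g : QH n, ((FF n g)⁻¹) ^ (2 * n + 2)) / R) ^ (1 / (2 * n + 3) : ℝ) := by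
  have hp := pe_pos n
  set S : Set (QH n) := {g | R < FF n g}
  have hS : MeasurableSet S := measurableSet_lt measurable_const continuous_FF.measurable
  have hconj : (pe n / 2).HolderConjugate (2 * n + 3) := by
    refine Real.holderConjugate_iff.2 ⟨by linarith [two_lt_pe n], ?_⟩
    rw [inv_div, two_div_pe]; ring
  have hi : Integrable fun g : QH n => ((FF n g)⁻¹) ^ (2 * n + 3) :=
    integrable_inv_FF_pow (by omega)
  have hi2 : Integrable fun g : QH n => ((FF n g)⁻¹) ^ (2 * n + 2) :=
    integrable_inv_FF_pow (by omega)
  have hpw : ∀ g : QH n, ((FF n g)⁻¹) ^ (2 * (n : ℝ) + 3) = ((FF n g)⁻¹) ^ (2 * n + 3) := fun g => by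
    rw [← rpow_natCast _ (2 * n + 3)]; push_cast; rfl
  have e1 : ∀ g, (w g ^ 2) ^ (pe n / 2) = |w g| ^ pe n := fun g => by
    rw [← sq_abs, ← rpow_natCast, ← rpow_mul (abs_nonneg _)]; congr 1; push_cast; ring
  have iw : Integrable fun g => |w g| ^ pe n := by
    have hc : Continuous fun g => |w g| ^ pe n := hw.abs.rpow_const fun _ => Or.inr hp.le
    refine hc.integrable_of_hasCompactSupport ?_
    exact hwc.comp_left (g := fun s => |s| ^ pe n) (by simp [hp.ne'])
  have e2 : ∫ g in S, |w g| ^ pe n ≤ ∫ g, |w g| ^ pe n :=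
    setIntegral_le_integral iw (.of_forall fun g => by positivity)
  have e3 : ∫ g in S, ((FF n g)⁻¹) ^ (2 * n + 3) ≤ (∫ g : QH n, ((FF n g)⁻¹) ^ (2 * n + 2)) / R := by
    rw [← integral_div]
    refine le_trans ?_ (setIntegral_le_integral (s := S) (hi2.div_const R)
      (.of_forall fun g => div_nonneg (pow_nonneg (inv_FF_pos g).le _) hR.le))
    refine setIntegral_mono_on hi.integrableOn (hi2.div_const R).integrableOn hS fun g hg => ?_
    have hF := inv_FF_pos g
    rw [pow_succ, div_eq_mul_inv]
    exact mul_le_mul_of_nonneg_left (inv_anti₀ hR (le_of_lt hg)) (by positivity)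
  have h := integral_mul_le_rpow_mul_rpow (μ := volume.restrict S) hconj
    (a := fun g => w g ^ 2) (b := fun g => (FF n g)⁻¹)
    (fun g => sq_nonneg (w g)) (fun g => (inv_FF_pos g).le)
    (hw.pow 2).aestronglyMeasurable continuous_inv_FF.aestronglyMeasurable
    (by simp only [e1]; exact iw.integrableOn) (by simp only [hpw]; exact hi.integrableOn)
    (by simp only [e1]; exact e2) (by simp only [hpw]; exact e3)
  rwa [one_div_div] at h

lemma setIntegral_sq_inv_FF_le_of_poincare {v w : QH n → ℝ} (hw : Continuous w)
    (hwc : HasCompactSupport w) {R κ M : ℝ} (hM : 0 ≤ M)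
    (hwb : ∀ g, FF n g ≤ R → w g = v g - κ * ((FF n g)⁻¹) ^ (n + 1))
    (h : ∫⁻ g in {g | FF n g ≤ R}, ENNReal.ofReal ((v g * FF n g ^ (n + 1) - κ) ^ 2)
      ≤ ENNReal.ofReal M) :
    ∫ g in {g | FF n g ≤ R}, w g ^ 2 * (FF n g)⁻¹ ≤ M := by
  have hS : MeasurableSet {g : QH n | FF n g ≤ R} :=
    measurableSet_le continuous_FF.measurable measurable_const
  rw [← ENNReal.ofReal_le_ofReal_iff hM, ofReal_integral_eq_lintegral_ofReal
    (integrable_sq_inv_FF hw hwc).integrableOn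
    (.of_forall fun g => mul_nonneg (sq_nonneg _) (inv_FF_pos g).le)]
  refine (setLIntegral_mono' hS fun g hg => ENNReal.ofReal_le_ofReal ?_).trans h
  have hF := FF_pos g
  have e : v g - κ * ((FF n g)⁻¹) ^ (n + 1)
      = (v g * FF n g ^ (n + 1) - κ) * ((FF n g)⁻¹) ^ (n + 1) := by
    rw [inv_pow]; field_simp
  have h1 : (FF n g)⁻¹ ≤ 1 := inv_le_one_of_one_le₀ (one_le_FF g)
  rw [hwb g hg, e, mul_pow, mul_assoc]
  exact mul_le_of_le_one_right (sq_nonneg _)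
    (mul_le_one₀ (pow_le_one₀ (by positivity) (pow_le_one₀ (inv_FF_pos g).le h1))
      (inv_FF_pos g).le h1)

lemma exists_near_bubble (hn : 1 ≤ n) : ∃ K > 0, ∀ v : QH n → ℝ, Test v → ∀ η > 0,
    ∃ κ ≥ 0, ∃ b : QH n → ℝ, Test b ∧ Vol n - η ≤ ∫ g, b g ^ 2 * (FF n g)⁻¹ ∧
      ∫ g, b g ^ pe n ≤ Vol n ∧
      ∫ g, hGradSq n (fun x => v x - κ * b x) g ≤ K * (∫ g, rem v g) + η := by
  obtain ⟨C, hC, hSob⟩ := exists_sobolev hn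
  obtain ⟨A, hA, htr⟩ := exists_truncations hn
  have hc : (0 : ℝ) < 16 * n * (n + 1) := by
    have : (1 : ℝ) ≤ n := by exact_mod_cast hn
    positivity
  set c : ℝ := 16 * n * (n + 1) with hcdef
  set J : ℝ := ∫ g : QH n, ((FF n g)⁻¹) ^ (2 * n + 2) with hJ
  have hlim : Filter.Tendsto (fun R : ℝ => c * (J / R) ^ (1 / (2 * n + 3) : ℝ)) Filter.atTop
      (nhds 0) := by
    have h1 : Filter.Tendsto (fun R : ℝ => J / R) Filter.atTop (nhds 0) :=
      Filter.Tendsto.div_atTop tendsto_const_nhds Filter.tendsto_id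
    have h2 := (h1.rpow_const (p := (1 / (2 * n + 3) : ℝ)) (Or.inr (by positivity))).const_mul c
    rwa [zero_rpow (by positivity), mul_zero] at h2
  obtain ⟨R, hR1, hRc⟩ := ((Filter.eventually_gt_atTop (1 : ℝ)).and
    (hlim.eventually (gt_mem_nhds (half_pos hC)))).exists
  obtain ⟨K, hK, hP⟩ := exists_local_poincare (n := n) hn hR1
  refine ⟨2 * (2 + c * K), by positivity, fun v hv η hη => ?_⟩
  have hv1 : ContDiff ℝ 1 v := hv.smooth.of_le (by exact_mod_cast le_top)
  obtain ⟨g₀, hg₀⟩ := hP v hv1 hv.compact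
  set κ := v g₀ * FF n g₀ ^ (n + 1) with hκ
  have hκ0 : 0 ≤ κ := mul_nonneg (hv.nonneg g₀) (pow_nonneg (FF_pos g₀).le _)
  obtain ⟨k, hk⟩ : ∃ k : ℝ, max R (max 1 ((A + 4 * κ ^ 2 * A) / η)) ≤ k := ⟨_, le_rfl⟩
  have hkR : R ≤ k := (le_max_left _ _).trans hk
  have hk1 : (1 : ℝ) ≤ k := (le_max_left _ _).trans ((le_max_right _ _).trans hk)
  have hkA : (A + 4 * κ ^ 2 * A) / η ≤ k := (le_max_right _ _).trans ((le_max_right _ _).trans hk)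
  have hkA' : A / k + 4 * κ ^ 2 * (A / k) ≤ η := by
    rw [div_le_iff₀ hη] at hkA
    have : A / k + 4 * κ ^ 2 * (A / k) = (A + 4 * κ ^ 2 * A) / k := by ring
    rw [this, div_le_iff₀ (by linarith)]; linarith
  have hAk : 0 ≤ A / k := by positivity
  obtain ⟨b, hb, hbF, hbr, -, hbV, hbq, -⟩ := htr k hk1
  have hb1 : ContDiff ℝ 1 b := hb.smooth.of_le (by exact_mod_cast le_top)
  have h4 : 0 ≤ 4 * κ ^ 2 * (A / k) := by positivity
  refine ⟨κ, hκ0, b, hb, by linarith, hbV, ?_⟩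
  have hw1 : ContDiff ℝ 1 (fun x => v x - κ * b x) := hv1.sub (contDiff_const.mul hb1)
  have hwc : HasCompactSupport (fun x => v x - κ * b x) :=
    hv.compact.sub (hb.compact.mul_left)
  set w : QH n → ℝ := fun x => v x - κ * b x with hw
  have hD : 0 ≤ ∫ g, rem v g := integral_nonneg fun g => rem_nonneg v g
  have hin := setIntegral_sq_inv_FF_le_of_poincare hw1.continuous hwc (v := v) (κ := κ)
    (mul_nonneg hK.le hD) (fun g hg => by simp only [hw, hbF g (hg.trans hkR)]) hg₀
  have hout := setIntegral_sq_inv_FF_le hw1.continuous hwc (zero_lt_one.trans hR1)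
  have hS : MeasurableSet {g : QH n | FF n g ≤ R} :=
    measurableSet_le continuous_FF.measurable measurable_const
  have hsplit := integral_add_compl hS (integrable_sq_inv_FF hw1.continuous hwc)
  have hcompl : {g : QH n | FF n g ≤ R}ᶜ = {g | R < FF n g} := by ext; simp
  rw [hcompl] at hsplit
  have hE := integral_hGradSq hw1 hwc
  rw [← hcdef] at hE
  have hso := hSob w hw1 hwc
  have hrem : ∫ g, rem w g ≤ 2 * (∫ g, rem v g) + 2 * κ ^ 2 * (A / k) := by
    have i1 := integrable_rem hv1 hv.compact
    have i2 := integrable_rem hb1 hb.compact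
    have h1 : ∫ g, rem w g ≤ ∫ g, (2 * rem v g + 2 * κ ^ 2 * rem b g) :=
      integral_mono (integrable_rem hw1 hwc) ((i1.const_mul 2).add (i2.const_mul _)) fun g =>
        rem_sub_mul_le (hv1.differentiable one_ne_zero) (hb1.differentiable one_ne_zero) κ g
    rw [integral_add (i1.const_mul 2) (i2.const_mul _), integral_const_mul,
      integral_const_mul] at h1
    exact h1.trans (by gcongr)
  have hN : 0 ≤ (∫ g, |w g| ^ pe n) ^ (2 / pe n) :=
    rpow_nonneg (integral_nonneg fun g => by positivity) _
  have hhalf : c * ∫ g in {g | R < FF n g}, w g ^ 2 * (FF n g)⁻¹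
      ≤ (∫ g, hGradSq n w g) / 2 := by
    calc _ ≤ c * ((∫ g, |w g| ^ pe n) ^ (2 / pe n) * (J / R) ^ (1 / (2 * n + 3) : ℝ)) :=
          mul_le_mul_of_nonneg_left hout hc.le
      _ = (∫ g, |w g| ^ pe n) ^ (2 / pe n) * (c * (J / R) ^ (1 / (2 * n + 3) : ℝ)) := by ring
      _ ≤ (∫ g, |w g| ^ pe n) ^ (2 / pe n) * (C / 2) := mul_le_mul_of_nonneg_left hRc.le hN
      _ ≤ _ := by linarith
  have hin' := mul_le_mul_of_nonneg_left hin hc.le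
  rw [← hsplit, mul_add] at hE
  linarith [mul_assoc c K (∫ g, rem v g)]

lemma add_rpow_le_mul_add_mul {a b s p : ℝ} (ha : 0 ≤ a) (hb : 0 ≤ b) (hs : 0 < s) (hp : 1 ≤ p) :
    (a + b) ^ p ≤ 1 / (1 + s) * (1 + s) ^ p * a ^ p
      + s / (1 + s) * ((1 + s) / s) ^ p * b ^ p := by
  have h := (convexOn_rpow hp).2 (x := (1 + s) * a) (y := (1 + s) / s * b)
    (Set.mem_Ici.2 (by positivity)) (Set.mem_Ici.2 (by positivity))
    (by positivity : 0 ≤ 1 / (1 + s)) (by positivity : 0 ≤ s / (1 + s)) (by field_simp)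
  simp only [smul_eq_mul] at h
  rw [mul_rpow (by positivity) ha, mul_rpow (by positivity) hb] at h
  have e : 1 / (1 + s) * ((1 + s) * a) + s / (1 + s) * ((1 + s) / s * b) = a + b := by
    field_simp
  rw [e] at h
  linarith

lemma mul_integral_sq_inv_FF_le {v : QH n → ℝ} (hv : ContDiff ℝ 1 v) (hvc : HasCompactSupport v) :
    16 * n * (n + 1) * ∫ g, v g ^ 2 * (FF n g)⁻¹ ≤ ∫ g, hGradSq n v g := by
  rw [integral_hGradSq hv hvc]
  have : 0 ≤ ∫ g, rem v g := integral_nonneg fun g => rem_nonneg v g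
  linarith

lemma sq_mul_integral_sq_inv_FF_le {u b : QH n → ℝ} (hu : Continuous u)
    (huc : HasCompactSupport u) (hb : Continuous b) (hbc : HasCompactSupport b) (κ : ℝ) {s : ℝ}
    (hs : 0 < s) :
    κ ^ 2 * ∫ g, b g ^ 2 * (FF n g)⁻¹ ≤ (1 + s) * (∫ g, u g ^ 2 * (FF n g)⁻¹)
      + (1 + 1 / s) * ∫ g, (u g - κ * b g) ^ 2 * (FF n g)⁻¹ := by
  have hwc : HasCompactSupport (fun x => u x - κ * b x) := huc.sub hbc.mul_left
  have hw : Continuous (fun x => u x - κ * b x) := hu.sub (continuous_const.mul hb)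
  have i1 := integrable_sq_inv_FF hb hbc
  have i2 := integrable_sq_inv_FF hu huc
  have i3 := integrable_sq_inv_FF hw hwc
  rw [← integral_const_mul, ← integral_const_mul, ← integral_const_mul,
    ← integral_add (i2.const_mul _) (i3.const_mul _)]
  refine integral_mono (i1.const_mul _) ((i2.const_mul _).add (i3.const_mul _)) fun g => ?_
  show κ ^ 2 * (b g ^ 2 * (FF n g)⁻¹) ≤ (1 + s) * (u g ^ 2 * (FF n g)⁻¹)
    + (1 + 1 / s) * ((u g - κ * b g) ^ 2 * (FF n g)⁻¹)
  have h : (κ * b g) ^ 2 ≤ (1 + s) * u g ^ 2 + (1 + 1 / s) * (u g - κ * b g) ^ 2 := by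
    have e : (1 + s) * u g ^ 2 + (1 + 1 / s) * (u g - κ * b g) ^ 2 - (κ * b g) ^ 2
        = (s * u g + (u g - κ * b g)) ^ 2 / s := by field_simp; ring
    have : 0 ≤ (s * u g + (u g - κ * b g)) ^ 2 / s := by positivity
    linarith
  have := mul_le_mul_of_nonneg_right h (inv_FF_pos g).le
  nlinarith

lemma integral_rpow_le_of_sub {u b : QH n → ℝ} (hu : Test u) (hb : Test b) {κ : ℝ} (hκ : 0 ≤ κ)
    {s : ℝ} (hs : 0 < s) :
    ∫ g, u g ^ pe n ≤ 1 / (1 + s) * (1 + s) ^ pe n * (κ ^ pe n * ∫ g, b g ^ pe n)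
      + s / (1 + s) * ((1 + s) / s) ^ pe n * ∫ g, |u g - κ * b g| ^ pe n := by
  have hp := pe_pos n
  have hwc : HasCompactSupport (fun x => u x - κ * b x) := hu.compact.sub hb.compact.mul_left
  have hw : Continuous (fun x => u x - κ * b x) :=
    hu.smooth.continuous.sub (continuous_const.mul hb.smooth.continuous)
  have i1 := hu.integrable_rpow hp
  have i2 := hb.integrable_rpow hp
  have i3 : Integrable fun g => |u g - κ * b g| ^ pe n := by
    have hc : Continuous fun g => |u g - κ * b g| ^ pe n := hw.abs.rpow_const fun _ => Or.inr hp.le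
    refine hc.integrable_of_hasCompactSupport ?_
    exact hwc.comp_left (g := fun s => |s| ^ pe n) (by simp [hp.ne'])
  rw [← mul_assoc, ← integral_const_mul, ← integral_const_mul,
    ← integral_add (i2.const_mul _) (i3.const_mul _)]
  refine integral_mono i1 ((i2.const_mul _).add (i3.const_mul _)) fun g => ?_
  show u g ^ pe n ≤ 1 / (1 + s) * (1 + s) ^ pe n * κ ^ pe n * b g ^ pe n
    + s / (1 + s) * ((1 + s) / s) ^ pe n * |u g - κ * b g| ^ pe n
  have hbg := hb.nonneg g
  have h1 : u g ^ pe n ≤ (κ * b g + |u g - κ * b g|) ^ pe n :=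
    rpow_le_rpow (hu.nonneg g) (by linarith [le_abs_self (u g - κ * b g)]) hp.le
  have h2 := add_rpow_le_mul_add_mul (mul_nonneg hκ hbg) (abs_nonneg (u g - κ * b g)) hs
    (by linarith [two_lt_pe n] : 1 ≤ pe n)
  rw [mul_rpow hκ hbg] at h2
  linarith [h1.trans h2]

lemma le_rpow_half_pe {C I δ : ℝ} (hC : 0 < C) (hI : 0 ≤ I) (h : C * I ^ (2 / pe n) ≤ δ) :
    I ≤ (δ / C) ^ (pe n / 2) := by
  have hp := pe_pos n
  have h1 : I ^ (2 / pe n) ≤ δ / C := by rw [le_div_iff₀ hC]; linarith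
  have h2 := rpow_le_rpow (rpow_nonneg hI _) h1 (by positivity : 0 ≤ pe n / 2)
  rwa [← rpow_mul hI, div_mul_div_comm, mul_comm (2 : ℝ), div_self (by positivity), rpow_one] at h2

lemma one_le_of_almost_minimizers (hn : 1 ≤ n) {S : ℝ} (hS0 : 0 ≤ S) (hS : Sob n S)
    (hmin : ∀ ε > 0, ∃ v : QH n → ℝ, Test v ∧ ∫ g, v g ^ pe n = 1 ∧ ∫ g, hGradSq n v g ≤ S + ε)
    {s : ℝ} (hs : 0 < s) (hs1 : s < 1) :
    1 ≤ 1 / (1 + s) * (1 + s) ^ pe n *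
      ((((1 + s) * (S + s) / (16 * n * (n + 1)) + s) / ((1 - s) * Vol n)) ^ (pe n / 2) * Vol n)
      + s := by
  obtain ⟨C, hC, hSob⟩ := exists_sobolev hn
  obtain ⟨K, hK, hnear⟩ := exists_near_bubble hn
  have hp := pe_pos n
  have hV := Vol_pos (n := n)
  have hc : (0 : ℝ) < 16 * n * (n + 1) := by
    have : (1 : ℝ) ≤ n := by exact_mod_cast hn
    positivity
  set c : ℝ := 16 * n * (n + 1) with hcdef
  set k2 : ℝ := s / (1 + s) * ((1 + s) / s) ^ pe n with hk2
  have hk2' : 0 ≤ k2 := by positivity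
  obtain ⟨δ, hδ, hδ1, hδ2⟩ : ∃ δ > 0, (1 + 1 / s) * (δ / c) ≤ s ∧
      k2 * (δ / C) ^ (pe n / 2) ≤ s := by
    have c1 : ContinuousAt (fun δ : ℝ => (1 + 1 / s) * (δ / c)) 0 := by fun_prop
    have c2 : ContinuousAt (fun δ : ℝ => k2 * (δ / C) ^ (pe n / 2)) 0 :=
      continuousAt_const.mul ((continuousAt_id.div_const C).rpow_const (Or.inr (by positivity)))
    have e1 := c1.eventually (gt_mem_nhds (by simpa using hs : (1 + 1 / s) * (0 / c) < s))
    have e2 := c2.eventually (gt_mem_nhds (by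
      rw [zero_div, zero_rpow (by positivity), mul_zero]; exact hs :
        k2 * (0 / C) ^ (pe n / 2) < s))
    obtain ⟨δ, ⟨h1, h2⟩, h3⟩ := (((e1.and e2).filter_mono nhdsWithin_le_nhds).and
      (self_mem_nhdsWithin (s := Set.Ioi (0 : ℝ)))).exists
    exact ⟨δ, h3, h1.le, h2.le⟩
  set M : ℝ := K * ((n + 1) * ((4 * n + 4) * (9 * S + 1) + 2 * S + 2)) with hM
  obtain ⟨t, ht0, ht1, ht2, ht3⟩ : ∃ t : ℝ, 0 < t ∧ t ≤ 1 / 2 ∧ t ^ 3 ≤ s ∧ M * t ≤ δ / 2 := by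
    have c1 : ContinuousAt (fun t : ℝ => t) 0 := by fun_prop
    have c2 : ContinuousAt (fun t : ℝ => t ^ 3) 0 := by fun_prop
    have c3 : ContinuousAt (fun t : ℝ => M * t) 0 := by fun_prop
    have e1 := c1.eventually (gt_mem_nhds (by norm_num : (0 : ℝ) < 1 / 2))
    have e2 := c2.eventually (gt_mem_nhds (by simpa using hs : (0 : ℝ) ^ 3 < s))
    have e3 := c3.eventually (gt_mem_nhds (by simpa using hδ : M * 0 < δ / 2))
    obtain ⟨t, ⟨h1, h2, h3⟩, h4⟩ := (((e1.and (e2.and e3)).filter_mono nhdsWithin_le_nhds).and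
      (self_mem_nhdsWithin (s := Set.Ioi (0 : ℝ)))).exists
    exact ⟨t, h4, h1.le, h2.le, h3.le⟩
  obtain ⟨v, hv, hv1, hvE⟩ := hmin (t ^ 3) (by positivity)
  obtain ⟨u, hu, hu1, huE, hbal⟩ := exists_balanced_test hv hv1
  rw [← huE] at hvE
  have hrem := integral_rem_le hS0 hS hu hu1 hbal ht0 ht1 hvE
  obtain ⟨κ, hκ, b, hb, hb2, hbp, hwE⟩ := hnear u hu (min (δ / 2) (s * Vol n)) (by positivity)
  have hu' : ContDiff ℝ 1 u := hu.smooth.of_le (by exact_mod_cast le_top)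
  have hb' : ContDiff ℝ 1 b := hb.smooth.of_le (by exact_mod_cast le_top)
  have hw' : ContDiff ℝ 1 (fun x => u x - κ * b x) := hu'.sub (contDiff_const.mul hb')
  have hwc : HasCompactSupport (fun x => u x - κ * b x) := hu.compact.sub hb.compact.mul_left
  have hwδ : ∫ g, hGradSq n (fun x => u x - κ * b x) g ≤ δ := by
    have h1 := mul_le_mul_of_nonneg_left hrem hK.le
    have h2 := min_le_left (δ / 2) (s * Vol n)
    have h3 : K * ((n + 1) * ((4 * n + 4) * (9 * S + 1) + 2 * S + 2) * t) = M * t := by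
      rw [hM]; ring
    linarith
  have hb3 : (1 - s) * Vol n ≤ ∫ g, b g ^ 2 * (FF n g)⁻¹ := by
    have h2 := min_le_right (δ / 2) (s * Vol n)
    linarith
  have q1 := mul_integral_sq_inv_FF_le hu' hu.compact
  have q2 := mul_integral_sq_inv_FF_le hw' hwc
  rw [← hcdef] at q1 q2
  have q3 := sq_mul_integral_sq_inv_FF_le hu'.continuous hu.compact hb'.continuous hb.compact κ hs
  have q1' : ∫ g, u g ^ 2 * (FF n g)⁻¹ ≤ (S + s) / c := by rw [le_div_iff₀ hc]; linarith
  have q2' : ∫ g, (u g - κ * b g) ^ 2 * (FF n g)⁻¹ ≤ δ / c := by rw [le_div_iff₀ hc]; linarith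
  have hs1' : 0 < 1 - s := by linarith
  have hκ2 : κ ^ 2 ≤ ((1 + s) * (S + s) / c + s) / ((1 - s) * Vol n) := by
    rw [le_div_iff₀ (by positivity)]
    have r1 := mul_le_mul_of_nonneg_left hb3 (sq_nonneg κ)
    have r2 := mul_le_mul_of_nonneg_left q1' (by positivity : 0 ≤ 1 + s)
    have r3 := mul_le_mul_of_nonneg_left q2' (by positivity : 0 ≤ 1 + 1 / s)
    rw [mul_div_assoc]
    linarith
  have hκp : κ ^ pe n
      ≤ (((1 + s) * (S + s) / c + s) / ((1 - s) * Vol n)) ^ (pe n / 2) := by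
    have r := rpow_le_rpow (sq_nonneg κ) hκ2 (by positivity : 0 ≤ pe n / 2)
    rwa [← rpow_natCast, ← rpow_mul hκ, Nat.cast_ofNat, mul_div_cancel₀ _ two_ne_zero] at r
  have hwp : ∫ g, |u g - κ * b g| ^ pe n ≤ (δ / C) ^ (pe n / 2) :=
    le_rpow_half_pe hC (integral_nonneg fun g => by positivity) ((hSob _ hw' hwc).trans hwδ)
  have hfin := integral_rpow_le_of_sub hu hb hκ hs
  rw [hu1, ← hk2] at hfin
  refine hfin.trans (add_le_add (mul_le_mul_of_nonneg_left ?_ (by positivity)) ?_)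
  · exact mul_le_mul hκp hbp (integral_nonneg fun g => rpow_nonneg (hb.nonneg g) _)
      ((rpow_nonneg hκ _).trans hκp)
  · exact (mul_le_mul_of_nonneg_left hwp hk2').trans hδ2

lemma le_of_almost_minimizers (hn : 1 ≤ n) {S : ℝ} (hS0 : 0 ≤ S) (hS : Sob n S)
    (hmin : ∀ ε > 0, ∃ v : QH n → ℝ, Test v ∧ ∫ g, v g ^ pe n = 1 ∧ ∫ g, hGradSq n v g ≤ S + ε) :
    16 * n * (n + 1) * Vol n ^ (1 / (2 * n + 3) : ℝ) ≤ S := by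
  have hp := pe_pos n
  have hV := Vol_pos (n := n)
  have hc : (0 : ℝ) < 16 * n * (n + 1) := by
    have : (1 : ℝ) ≤ n := by exact_mod_cast hn
    positivity
  set c : ℝ := 16 * n * (n + 1) with hcdef
  have hcont : ContinuousAt (fun s : ℝ => 1 / (1 + s) * (1 + s) ^ pe n *
      ((((1 + s) * (S + s) / c + s) / ((1 - s) * Vol n)) ^ (pe n / 2) * Vol n) + s) 0 := by
    have c1 : ContinuousAt (fun s : ℝ => 1 / (1 + s)) 0 :=
      continuousAt_const.div (by fun_prop) (by norm_num)
    have c2 : ContinuousAt (fun s : ℝ => (1 + s) ^ pe n) 0 :=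
      ContinuousAt.rpow_const (by fun_prop) (Or.inr hp.le)
    have c3 : ContinuousAt (fun s : ℝ =>
        (((1 + s) * (S + s) / c + s) / ((1 - s) * Vol n)) ^ (pe n / 2)) 0 := by
      refine ContinuousAt.rpow_const (ContinuousAt.div (by fun_prop) (by fun_prop) ?_)
        (Or.inr (by positivity))
      simpa using hV.ne'
    exact ((c1.mul c2).mul (c3.mul continuousAt_const)).add continuousAt_id
  have hlim := ge_of_tendsto (hcont.tendsto.mono_left (nhdsWithin_le_nhds (s := Set.Ioi (0 : ℝ))))
    (b := 1) (by
      filter_upwards [Ioo_mem_nhdsGT (zero_lt_one (α := ℝ))] with s hs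
      exact one_le_of_almost_minimizers hn hS0 hS hmin hs.1 hs.2)
  simp only [add_zero, sub_zero, one_mul, div_one, one_rpow] at hlim
  have h0 : 0 ≤ S / c / Vol n := by positivity
  have h1 : (Vol n)⁻¹ ≤ (S / c / Vol n) ^ (pe n / 2) := by
    rw [inv_le_iff_one_le_mul₀ hV]; exact hlim
  have h2 := rpow_le_rpow (by positivity) h1 (by positivity : 0 ≤ 2 / pe n)
  rw [← rpow_mul h0, div_mul_div_comm, mul_comm (2 : ℝ), div_self (by positivity), rpow_one,
    le_div_iff₀ hV, le_div_iff₀ hc, two_div_pe, inv_rpow hV.le, rpow_sub hV, rpow_one] at h2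
  have hVg := rpow_pos_of_pos hV (1 / (2 * n + 3))
  have e : (Vol n / Vol n ^ (1 / (2 * (n : ℝ) + 3)))⁻¹ * Vol n * c
      = c * Vol n ^ (1 / (2 * (n : ℝ) + 3)) := by field_simp
  rwa [e] at h2

lemma hGradSq_const_mul (c : ℝ) {v : QH n → ℝ} (hv : Differentiable ℝ v) (g : QH n) :
    hGradSq n (fun x => c * v x) g = c ^ 2 * hGradSq n v g := by
  simp only [hGradSq_eq, hGrad, hd_const_mul c (hv g), Finset.mul_sum]
  exact Finset.sum_congr rfl fun α _ => Finset.sum_congr rfl fun i _ => by ring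

lemma Test.differentiable {v : QH n → ℝ} (hv : Test v) : Differentiable ℝ v :=
  hv.smooth.differentiable (by simp)

lemma Test.const_mul {v : QH n → ℝ} (hv : Test v) {c : ℝ} (hc : 0 ≤ c) :
    Test fun x => c * v x :=
  ⟨contDiff_const.mul hv.smooth, hv.compact.mul_left, fun g => mul_nonneg hc (hv.nonneg g)⟩

lemma Test.integral_const_mul_rpow {v : QH n → ℝ} (hv : Test v) {I : ℝ} (hI : 0 ≤ I) :
    ∫ g, (I ^ (1 / pe n) * v g) ^ pe n = I * ∫ g, v g ^ pe n := by
  rw [← integral_const_mul]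
  refine integral_congr_ae (.of_forall fun g => ?_)
  simp only
  rw [mul_rpow (rpow_nonneg hI _) (hv.nonneg g), ← rpow_mul hI,
    one_div_mul_cancel (pe_pos n).ne', rpow_one]

lemma Test.integral_hGradSq_const_mul {v : QH n → ℝ} (hv : Test v) {I : ℝ} (hI : 0 ≤ I) :
    ∫ g, hGradSq n (fun x => I ^ (1 / pe n) * v x) g = I ^ (2 / pe n) * ∫ g, hGradSq n v g := by
  rw [← integral_const_mul]
  refine integral_congr_ae (.of_forall fun g => ?_)
  simp only
  rw [hGradSq_const_mul _ hv.differentiable, ← rpow_natCast, ← rpow_mul hI]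
  congr 2; push_cast; ring

lemma sob_of_le {S : ℝ} (h : ∀ v : QH n → ℝ, Test v → ∫ g, v g ^ pe n = 1 →
    S ≤ ∫ g, hGradSq n v g) : Sob n S := by
  intro v hv
  have hp := pe_pos n
  have hI : 0 ≤ ∫ g, v g ^ pe n := integral_nonneg fun g => rpow_nonneg (hv.nonneg g) _
  have hE : 0 ≤ ∫ g, hGradSq n v g := integral_nonneg fun g => hGradSq_nonneg v g
  rcases hI.eq_or_lt with h0 | h0
  · rwa [← h0, zero_rpow (by positivity), mul_zero]
  · set I := ∫ g, v g ^ pe n with hIdef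
    have hI' : 0 ≤ I⁻¹ := by positivity
    have h1 := h _ (hv.const_mul (rpow_nonneg hI' (1 / pe n)))
      (by rw [hv.integral_const_mul_rpow hI', ← hIdef, inv_mul_cancel₀ h0.ne'])
    rw [hv.integral_hGradSq_const_mul hI', inv_rpow hI, inv_mul_eq_div,
      le_div_iff₀ (rpow_pos_of_pos h0 _)] at h1
    exact h1

lemma Sob.le_sharp (hn : 1 ≤ n) {S : ℝ} (hS : Sob n S) :
    S ≤ 16 * n * (n + 1) * Vol n ^ (1 / (2 * n + 3) : ℝ) := by
  obtain ⟨A, hA, htr⟩ := exists_truncations hn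
  have hp := pe_pos n
  have hV := Vol_pos (n := n)
  have hdiv : Filter.Tendsto (fun k : ℝ => A / k) Filter.atTop (nhds 0) :=
    tendsto_const_nhds.div_atTop Filter.tendsto_id
  by_contra! hlt
  have hS0 : 0 ≤ S := le_trans (by positivity) hlt.le
  have hl : Filter.Tendsto (fun k : ℝ => S * (Vol n - A / k) ^ (2 / pe n)) Filter.atTop
      (nhds (S * (Vol n - 0) ^ (2 / pe n))) :=
    ((tendsto_const_nhds.sub hdiv).rpow_const (Or.inr (by positivity))).const_mul S
  have hr : Filter.Tendsto (fun k : ℝ => A / k + 16 * n * (n + 1) * Vol n) Filter.atTop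
      (nhds (0 + 16 * n * (n + 1) * Vol n)) := hdiv.add_const _
  have hle := le_of_tendsto_of_tendsto hl hr (by
    filter_upwards [Filter.eventually_ge_atTop 1, hdiv.eventually (gt_mem_nhds hV)] with k hk hkV
    obtain ⟨b, hb, -, hbr, hbp, -, -, hb2⟩ := htr k hk
    have h1 := hS b hb
    rw [integral_hGradSq (hb.smooth.of_le (by exact_mod_cast le_top)) hb.compact] at h1
    have h2 : (Vol n - A / k) ^ (2 / pe n) ≤ (∫ g, b g ^ pe n) ^ (2 / pe n) :=
      rpow_le_rpow (by linarith) hbp (by positivity)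
    calc _ ≤ _ := mul_le_mul_of_nonneg_left h2 hS0
      _ ≤ _ := h1
      _ ≤ _ := by gcongr)
  rw [sub_zero, zero_add, two_div_pe, rpow_sub hV, rpow_one, mul_div_assoc',
    div_le_iff₀ (rpow_pos_of_pos hV _)] at hle
  nlinarith

lemma exists_test_integral_eq_one (hn : 1 ≤ n) :
    ∃ v : QH n → ℝ, Test v ∧ ∫ g, v g ^ pe n = 1 := by
  obtain ⟨A, hA, htr⟩ := exists_truncations hn
  have hV := Vol_pos (n := n)
  have hdiv : Filter.Tendsto (fun k : ℝ => A / k) Filter.atTop (nhds 0) :=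
    tendsto_const_nhds.div_atTop Filter.tendsto_id
  obtain ⟨k, hk, hkV⟩ := ((Filter.eventually_ge_atTop 1).and
    (hdiv.eventually (gt_mem_nhds hV))).exists
  obtain ⟨b, hb, -, -, hbp, -⟩ := htr k hk
  have h0 : 0 < ∫ g, b g ^ pe n := by linarith
  have hI : 0 ≤ (∫ g, b g ^ pe n)⁻¹ := by positivity
  exact ⟨_, hb.const_mul (rpow_nonneg hI (1 / pe n)), by
    rw [hb.integral_const_mul_rpow hI, inv_mul_cancel₀ h0.ne']⟩

lemma exists_sharp_minimizing_sequence (hn : 1 ≤ n) :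
    Sob n (16 * n * (n + 1) * Vol n ^ (1 / (2 * n + 3) : ℝ)) ∧
    ∀ ε > 0, ∃ v : QH n → ℝ, Test v ∧ ∫ g, v g ^ pe n = 1 ∧
      ∫ g, hGradSq n v g ≤ 16 * n * (n + 1) * Vol n ^ (1 / (2 * n + 3) : ℝ) + ε := by
  set T : Set ℝ := {E | ∃ v : QH n → ℝ, Test v ∧ ∫ g, v g ^ pe n = 1 ∧ E = ∫ g, hGradSq n v g}
    with hT
  have hne : T.Nonempty := by
    obtain ⟨v, hv, h1⟩ := exists_test_integral_eq_one hn
    exact ⟨_, v, hv, h1, rfl⟩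
  have hpos : ∀ E ∈ T, 0 ≤ E := by
    rintro E ⟨v, -, -, rfl⟩
    exact integral_nonneg fun g => hGradSq_nonneg v g
  have hbdd : BddBelow T := ⟨0, hpos⟩
  have hS0 : 0 ≤ sInf T := le_csInf hne hpos
  have hS : Sob n (sInf T) := sob_of_le fun v hv h1 => csInf_le hbdd ⟨v, hv, h1, rfl⟩
  have hmin : ∀ ε > 0, ∃ v : QH n → ℝ, Test v ∧ ∫ g, v g ^ pe n = 1 ∧
      ∫ g, hGradSq n v g ≤ sInf T + ε := by
    intro ε hε
    obtain ⟨E, ⟨v, hv, h1, rfl⟩, hE⟩ := exists_lt_of_csInf_lt hne (lt_add_of_pos_right (sInf T) hε)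
    exact ⟨v, hv, h1, hE.le⟩
  have heq := le_antisymm (hS.le_sharp hn) (le_of_almost_minimizers hn hS0 hS hmin)
  rw [← heq]
  exact ⟨hS, hmin⟩

lemma sInf_energy_const_smul (hn : 1 ≤ n) {m : ℝ} (hm : 0 < m) :
    sInf {E : ℝ | ∃ v : QH n → ℝ, ContDiff ℝ (⊤ : ℕ∞) v ∧ HasCompactSupport v ∧ (∀ g, 0 ≤ v g) ∧
        m * ∫ g, v g ^ pe n = 1 ∧ E = m * ∫ g, hGradSq n v g}
      = 16 * n * (n + 1) * (m * Vol n) ^ (1 / (2 * n + 3) : ℝ) := by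
  obtain ⟨hS, hmin⟩ := exists_sharp_minimizing_sequence hn
  have hV := Vol_pos (n := n)
  rw [mul_rpow hm.le hV.le]
  set S := 16 * n * (n + 1) * Vol n ^ (1 / (2 * n + 3) : ℝ) with hSdef
  have hmi : 0 ≤ m⁻¹ := by positivity
  have hmγ : m * m⁻¹ ^ (2 / pe n) = m ^ (1 / (2 * n + 3) : ℝ) := by
    have := rpow_pos_of_pos hm (1 / (2 * n + 3) : ℝ)
    rw [two_div_pe, inv_rpow hm.le, rpow_sub hm, rpow_one]; field_simp
  have e : 16 * n * (n + 1) * (m ^ (1 / (2 * n + 3) : ℝ) * Vol n ^ (1 / (2 * n + 3) : ℝ))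
      = m ^ (1 / (2 * n + 3) : ℝ) * S := by rw [hSdef]; ring
  rw [e]
  have key : ∀ ε > 0, ∃ E ∈ {E : ℝ | ∃ v : QH n → ℝ, ContDiff ℝ (⊤ : ℕ∞) v ∧
      HasCompactSupport v ∧ (∀ g, 0 ≤ v g) ∧
      m * ∫ g, v g ^ pe n = 1 ∧ E = m * ∫ g, hGradSq n v g},
      E ≤ m ^ (1 / (2 * n + 3) : ℝ) * (S + ε) := by
    intro ε hε
    obtain ⟨v, hv, h1, hE⟩ := hmin ε hε
    have hv' := hv.const_mul (rpow_nonneg hmi (1 / pe n))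
    refine ⟨_, ⟨_, hv'.smooth, hv'.compact, hv'.nonneg, ?_, rfl⟩, ?_⟩
    · rw [hv.integral_const_mul_rpow hmi, h1, mul_one, mul_inv_cancel₀ hm.ne']
    · rw [hv.integral_hGradSq_const_mul hmi, ← mul_assoc, hmγ]
      gcongr
  refine (IsGLB.csInf_eq ⟨?_, fun B hB => ?_⟩ ?_)
  · rintro E ⟨v, h1, h2, h3, h4, rfl⟩
    have h := hS v ⟨h1, h2, h3⟩
    rw [eq_inv_of_mul_eq_one_right h4] at h
    rw [← hmγ]
    nlinarith [mul_le_mul_of_nonneg_left h hm.le]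
  · have hlim : Filter.Tendsto (fun ε : ℝ => m ^ (1 / (2 * n + 3) : ℝ) * (S + ε))
        (nhdsWithin 0 (Set.Ioi 0)) (nhds (m ^ (1 / (2 * n + 3) : ℝ) * (S + 0))) :=
      ((tendsto_const_nhds.add Filter.tendsto_id).const_mul _).mono_left nhdsWithin_le_nhds
    rw [add_zero] at hlim
    refine ge_of_tendsto hlim ?_
    filter_upwards [self_mem_nhdsWithin] with ε hε
    obtain ⟨E, hE, hle⟩ := key ε hε
    exact (hB hE).trans hle
  · obtain ⟨E, hE, -⟩ := key 1 one_pos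
    exact ⟨E, hE⟩

end QH

/-- the best constant w.r.t. the qc volume measure
`dVol = 2^{−3}(2n)! dH`:
`inf { ∫ |∇v|² dVol : v ∈ C_c^∞, v ≥ 0, ∫ v^{2*} dVol = 1 } = 4n(n+1) [(2n)! ω_{4n+3}]^{1/(2n+3)}`. -/
theorem best_constant_qc_volume (n : ℕ) (hn : 1 ≤ n)
    (Q p w : ℝ)
    (hQ : Q = 4 * n + 6)
    (hp : p = 2 * Q / (Q - 2))
    (hw : w = 2 * Real.pi ^ (2 * n + 2) / (2 * n + 1).factorial)
    (μ : MeasureTheory.Measure (QH n))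
    (hμ : μ = ((2 : ENNReal) ^ (-3 : ℤ) * (2 * n).factorial) • MeasureTheory.volume) :
    sInf { E : ℝ | ∃ v : QH n → ℝ, ContDiff ℝ (⊤ : ℕ∞) v ∧ HasCompactSupport v ∧ (∀ g, 0 ≤ v g) ∧
        (∫ g : QH n, v g ^ p ∂μ) = 1 ∧ E = ∫ g : QH n, QH.hGradSq n v g ∂μ }
      = 4 * n * (n + 1) * (((2 * n).factorial : ℝ) * w) ^ ((1 : ℝ) / (2 * n + 3)) := by
  have hpe : p = QH.pe n := by
    have h0 : (0 : ℝ) ≤ n := Nat.cast_nonneg n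
    rw [hp, hQ, QH.pe, div_eq_div_iff (by linarith) (by positivity)]; ring
  have hm : ((2 : ENNReal) ^ (-3 : ℤ) * (2 * n).factorial).toReal
      = 2 ^ (-3 : ℤ) * (2 * n).factorial := by
    rw [ENNReal.toReal_mul, ENNReal.toReal_natCast,
      show (2 : ENNReal) ^ (-3 : ℤ) = (2 ^ 3)⁻¹ from zpow_negSucc 2 2, ENNReal.toReal_inv]
    norm_num
  have hf : (0 : ℝ) < (2 * n).factorial := by exact_mod_cast Nat.factorial_pos _
  have hw0 : 0 ≤ w := by rw [hw]; positivity
  simp only [hμ, integral_smul_measure, hm, hpe, smul_eq_mul]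
  rw [QH.sInf_energy_const_smul hn (by positivity)]
  have e : (2 : ℝ) ^ (-3 : ℤ) * (2 * n).factorial * QH.Vol n
      = ((2 * n).factorial * w) * ((4 : ℝ)⁻¹) ^ (2 * (n : ℝ) + 3) := by
    have e4 : ((4 : ℝ)⁻¹) ^ (2 * (n : ℝ) + 3) = ((4 : ℝ)⁻¹) ^ (2 * n + 3) := by
      rw [← rpow_natCast]; push_cast; rfl
    have e5 : ((4 : ℝ)⁻¹) ^ (2 * n + 3) = 1 / 8 / 2 ^ (4 * n + 3) := by
      rw [show (4 : ℝ)⁻¹ = (2 ^ 2)⁻¹ by norm_num, inv_pow, ← pow_mul,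
        show 2 * (2 * n + 3) = 4 * n + 3 + 3 by ring, pow_add]
      field_simp; norm_num
    rw [e4, e5, QH.Vol, QH.integral_inv_FF_pow, ← hw,
      show (2 : ℝ) ^ (-3 : ℤ) = 1 / 8 by norm_num]
    ring
  rw [e, mul_rpow (by positivity) (by positivity), ← rpow_mul (by norm_num),
    mul_one_div_cancel (by positivity), rpow_one]
  ring
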